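/- Let 0 < r < R < ∞, let n ≤ N be positive integers, and let ι : ℂ^n → ℂ^N be the inclusion z ↦ (z,0,…,0). Let f be a (0,1)-form of class C¹ on B_N(R) ⊆ ℂ^N (l¹ norm) which is ∂̄-closed and Lipschitz continuous on B_N(R). Suppose A, Q ≥ 0 and U is a continuous function on the closed ball {z ∈ ℂ^n : ‖z‖ ≤ r}, continuously (real Fréchet) differentiable on B_n(r), such that ∂̄U(z)(ξ) = f(ι z)(ι ξ) for all z ∈ B_n(r), ξ ∈ ℂ^n, and |U(z)| ≤ A·Q^{#z} for all z with ‖z‖ ≤ r. Then there exists a continuously differentiable u : B_N(r) → ℂ with ∂̄u = f on B_N(r) and |u(ι z) − U(z)| ≤ A·Δ(Q, z/r) for all z ∈ B_n(r). -/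

import Mathlib

open Set
open scoped ENNReal NNReal

noncomputable section

/-- `l¹`: the space of absolutely summable sequences of complex numbers. -/
abbrev L1 : Type := lp (fun _ : ℕ => ℂ) 1

/-- `ℂ^N` equipped with the `l¹` norm. -/
abbrev EN (N : ℕ) : Type := PiLp 1 (fun _ : Fin N => ℂ)

/-- The `(0,1)`-part of the real Fréchet derivative of `u` at `z`, applied to `ξ`:
`∂̄u(z)(ξ) = (Du(z)(ξ) + i·Du(z)(iξ))/2`. -/
noncomputable def dbar {V : Type*} [NormedAddCommGroup V] [NormedSpace ℂ V]
    (u : V → ℂ) (z ξ : V) : ℂ :=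
  (fderiv ℝ u z ξ + Complex.I * fderiv ℝ u z (Complex.I • ξ)) / 2

/-- `f` is a `(0,1)`-form of class `C^m` on `Ω`: each `f z` is (continuous) conjugate-linear
and `(z,ξ) ↦ f z ξ` is `m` times continuously differentiable in the real sense on `Ω × V`. -/
def IsForm01 {V : Type*} [NormedAddCommGroup V] [NormedSpace ℂ V]
    (m : ℕ) (Ω : Set V) (f : V → V → ℂ) : Prop :=
  (∀ z ∈ Ω, ∀ ξ η : V, f z (ξ + η) = f z ξ + f z η) ∧
  (∀ z ∈ Ω, ∀ (a : ℂ) (ξ : V), f z (a • ξ) = (starRingEnd ℂ) a * f z ξ) ∧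
  ContDiffOn ℝ m (fun p : V × V => f p.1 p.2) (Ω ×ˢ (univ : Set V))

/-- A `(0,1)`-form `f` is `∂̄`-closed on `Ω`. -/
def DbarClosed {V : Type*} [NormedAddCommGroup V] [NormedSpace ℂ V]
    (Ω : Set V) (f : V → V → ℂ) : Prop :=
  ∀ z ∈ Ω, ∀ ξ η : V, dbar (fun w => f w ξ) z η = dbar (fun w => f w η) z ξ

/-- The set of values `‖f z ξ‖`, `z ∈ A`, `‖ξ‖ ≤ 1`; its sup is `|f|_{0,A}`. -/
def formSet0 {V : Type*} [NormedAddCommGroup V]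
    (f : V → V → ℂ) (A : Set V) : Set ℝ :=
  {x | ∃ z ∈ A, ∃ ξ : V, ‖ξ‖ ≤ 1 ∧ x = ‖f z ξ‖}

/-- The set of difference quotients `‖f z ξ - f w ξ‖/‖z-w‖`; its sup is `|f|_{1,A}`. -/
def formSet1 {V : Type*} [NormedAddCommGroup V]
    (f : V → V → ℂ) (A : Set V) : Set ℝ :=
  {x | ∃ z ∈ A, ∃ w ∈ A, z ≠ w ∧ ∃ ξ : V, ‖ξ‖ ≤ 1 ∧ x = ‖f z ξ - f w ξ‖ / ‖z - w‖}

/-- `|f|_{0,A}`. -/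
noncomputable def formNorm0 {V : Type*} [NormedAddCommGroup V]
    (f : V → V → ℂ) (A : Set V) : ℝ := sSup (formSet0 f A)

/-- `|f|_{1,A}`. -/
noncomputable def formNorm1 {V : Type*} [NormedAddCommGroup V]
    (f : V → V → ℂ) (A : Set V) : ℝ := sSup (formSet1 f A)

/-- `f` is Lipschitz continuous on `A`: `|f|_{0,A} < ∞` and `|f|_{1,A} < ∞`. -/
def LipschitzForm {V : Type*} [NormedAddCommGroup V]
    (f : V → V → ℂ) (A : Set V) : Prop :=
  BddAbove (formSet0 f A) ∧ BddAbove (formSet1 f A)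

/-- `‖k‖ = ∑_ν k_ν` for a multiindex `k`. -/
def knormN (k : ℕ →₀ ℕ) : ℕ := k.sum fun _ m => m

/-- `k^k = ∏_ν k_ν^{k_ν}` (with `0^0 = 1`). -/
noncomputable def kk (k : ℕ →₀ ℕ) : ℝ := ∏ ν ∈ k.support, (k ν : ℝ) ^ k ν

/-- `‖k‖^{‖k‖}` (with `0^0 = 1`). -/
noncomputable def nn (k : ℕ →₀ ℕ) : ℝ := ((knormN k : ℝ)) ^ knormN k

/-- The monomial `z^k = ∏_ν z_ν^{k_ν}` (with `0^0 = 1`). -/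
noncomputable def monom (k : ℕ →₀ ℕ) (z : ℕ → ℂ) : ℂ := ∏ ν ∈ k.support, z ν ^ k ν

/-- The term of the series defining `Δ(q,z)` corresponding to the multiindex `k`:
`(‖k‖^{‖k‖}/k^k)·|q|^{#k}·|z^k|`. -/
noncomputable def DeltaTerm (q : ℂ) (z : ℕ → ℂ) (k : ℕ →₀ ℕ) : ℝ :=
  (nn k / kk k) * ‖q‖ ^ k.support.card * ∏ ν ∈ k.support, ‖z ν‖ ^ k ν

/-- `Δ(q,z) = ∑_k (‖k‖^{‖k‖}/k^k)·|q|^{#k}·|z^k|`. -/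
noncomputable def Delta (q : ℂ) (z : ℕ → ℂ) : ℝ := ∑' k, DeltaTerm q z k

/-- The inclusion `ℂ^n → ℂ^N`, `z ↦ (z,0,…,0)` (for the `l¹` norms). -/
noncomputable def incl (n N : ℕ) (z : EN n) : EN N :=
  (WithLp.equiv 1 (∀ _ : Fin N, ℂ)).symm
    (fun i : Fin N => if h : (i : ℕ) < n then z ⟨(i : ℕ), h⟩ else 0)

open MeasureTheory Complex in
theorem cp_core0 (G h : ℂ → ℂ) (G' : ℂ → ℂ →L[ℝ] ℂ) (S : Set ℂ) (hS : S.Countable)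
    (hG : Continuous G) (hGs : HasCompactSupport G)
    (hd : ∀ l ∉ S, HasFDerivAt G (G' l) l)
    (hh : Continuous h) (hhs : HasCompactSupport h)
    (hdb : ∀ l, (G' l 1 + I * G' l I) / 2 = h l) :
    ∫ l, h l / l = -(Real.pi : ℂ) * G 0 := by
  -- radius
  obtain ⟨M0, hM0⟩ := hGs.isCompact.isBounded.subset_closedBall 0
  obtain ⟨M1, hM1⟩ := hhs.isCompact.isBounded.subset_closedBall 0
  set M : ℝ := max (max M0 M1) 0 + 1 with hM
  have hMpos : 0 < M := by positivity
  have hGM : ∀ l : ℂ, M ≤ ‖l‖ → G l = 0 := by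
    intro l hl
    by_contra hne
    have := hM0 (subset_tsupport _ hne)
    simp only [Metric.mem_closedBall, dist_zero_right] at this
    have h1 : M0 ≤ max (max M0 M1) 0 := le_trans (le_max_left _ _) (le_max_left _ _)
    linarith
  have hhM : ∀ l : ℂ, M ≤ ‖l‖ → h l = 0 := by
    intro l hl
    by_contra hne
    have := hM1 (subset_tsupport _ hne)
    simp only [Metric.mem_closedBall, dist_zero_right] at this
    have h1 : M1 ≤ max (max M0 M1) 0 := le_trans (le_max_right _ _) (le_max_left _ _)
    linarith
  set e : ℝ → ℂ := fun t => Complex.exp (t * I) with he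
  have hec : Continuous e := by fun_prop
  have hen : ∀ t, ‖e t‖ = 1 := fun t => by simp [he, Complex.norm_exp_ofReal_mul_I]
  have hene : ∀ t, e t ≠ 0 := fun t => Complex.exp_ne_zero _
  have hps : ∀ p : ℝ × ℝ, Complex.polarCoord.symm p = p.1 * e p.2 := by
    intro p
    rw [Complex.polarCoord_symm_apply, he]
    simp only [Complex.exp_mul_I]
    push_cast
    ring
  set k : ℝ × ℝ → ℂ := fun p => (e p.2)⁻¹ * h (p.1 * e p.2) with hk
  have hkc : Continuous k := by
    have : Continuous fun p : ℝ × ℝ => (e p.2)⁻¹ := (hec.comp continuous_snd).inv₀ (fun p => hene _)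
    fun_prop
  have hk0 : ∀ p : ℝ × ℝ, M ≤ p.1 → k p = 0 := by
    intro p hp
    have : h (p.1 * e p.2) = 0 := hhM _ (by rw [norm_mul, hen, mul_one, norm_real]; exact le_trans hp (le_abs_self _))
    simp [hk, this]
  have step1 : ∫ l, h l / l = ∫ r in (0:ℝ)..M, ∫ t in (-Real.pi)..Real.pi, k (r, t) := by
    rw [← Complex.integral_comp_polarCoord_symm]
    have : ∫ p in polarCoord.target, p.1 • (h (Complex.polarCoord.symm p) / Complex.polarCoord.symm p)
        = ∫ p in polarCoord.target, k p := by
      refine setIntegral_congr_fun polarCoord.open_target.measurableSet (fun p hp => ?_)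
      have hp1 : (0:ℝ) < p.1 := by
        rw [polarCoord_target] at hp; exact hp.1
      have hp1' : (p.1 : ℂ) ≠ 0 := by exact_mod_cast hp1.ne'
      simp only [hps, hk, real_smul]
      field_simp [hene]
    rw [this, polarCoord_target]
    have h2 : ∫ p in Ioi (0:ℝ) ×ˢ Ioo (-Real.pi) Real.pi, k p
        = ∫ p in Ioc (0:ℝ) M ×ˢ Ioc (-Real.pi) Real.pi, k p := by
      rw [setIntegral_eq_of_subset_of_forall_sdiff_eq_zero
        (s := Ioc (0:ℝ) M ×ˢ Ioo (-Real.pi) Real.pi) (t := Ioi (0:ℝ) ×ˢ Ioo (-Real.pi) Real.pi)]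
      · refine setIntegral_congr_set ?_
        rw [Measure.volume_eq_prod]
        exact Measure.set_prod_ae_eq (Filter.EventuallyEq.refl _ _) Ioo_ae_eq_Ioc
      · exact measurableSet_Ioi.prod measurableSet_Ioo
      · exact prod_mono Ioc_subset_Ioi_self subset_rfl
      · rintro p ⟨hp1, hp2⟩
        apply hk0
        by_contra hlt
        exact hp2 ⟨⟨hp1.1, by linarith⟩, hp1.2⟩
    rw [h2, Measure.volume_eq_prod, setIntegral_prod]
    · rw [intervalIntegral.integral_of_le hMpos.le]
      refine setIntegral_congr_fun measurableSet_Ioc (fun r hr => ?_)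
      change _ = ∫ t in (-Real.pi)..Real.pi, k (r, t)
      rw [intervalIntegral.integral_of_le (by linarith [Real.pi_pos])]
    · rw [← Measure.volume_eq_prod]
      exact (hkc.continuousOn.integrableOn_compact (isCompact_Icc.prod isCompact_Icc)).mono_set
        (prod_mono (Ioc_subset_Icc_self (a := (0:ℝ)) (b := M)) (Ioc_subset_Icc_self (a := -Real.pi) (b := Real.pi)))
  -- the two functions of ε
  set Φ : ℝ → ℂ := fun ε => ∫ r in ε..M, ∫ t in (-Real.pi)..Real.pi, k (r, t) with hΦ
  set Ψ : ℝ → ℂ := fun ε => -(1/2) * ∫ t in (-Real.pi)..Real.pi, G (ε * e t) with hΨ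
  have hinner : Continuous fun r : ℝ => ∫ t in (-Real.pi)..Real.pi, k (r, t) := by
    apply intervalIntegral.continuous_parametric_intervalIntegral_of_continuous'
    exact hkc
  have hΦc : Continuous Φ := by
    have : Φ = fun ε => -∫ r in M..ε, ∫ t in (-Real.pi)..Real.pi, k (r, t) := by
      ext ε; simp only [hΦ]; rw [intervalIntegral.integral_symm]
    rw [this]
    exact (intervalIntegral.continuous_primitive (fun a b => hinner.intervalIntegrable a b) M).neg
  have hΨc : Continuous Ψ := by
    apply continuous_const.mul
    apply intervalIntegral.continuous_parametric_intervalIntegral_of_continuous'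
    fun_prop
  have heq : ∀ ε ∈ Ioo (0:ℝ) M, Φ ε = Ψ ε := by
    intro ε hε
    set P : ℝ × ℝ → ℂ := fun p => p.1 * e p.2 with hP
    set P' : ℝ × ℝ → (ℝ × ℝ →L[ℝ] ℂ) := fun p =>
      (ContinuousLinearMap.fst ℝ ℝ ℝ).smulRight (e p.2) +
        (ContinuousLinearMap.snd ℝ ℝ ℝ).smulRight (p.1 * (I * e p.2)) with hP'
    have hed : ∀ t, HasDerivAt e (I * e t) t := by
      intro t
      have : HasDerivAt (fun t : ℝ => (t:ℂ) * I) (1 * I) t := (Complex.ofRealCLM.hasDerivAt (x := t)).mul_const I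
      convert this.cexp using 1
      simp only [he]; ring
    have hPd : ∀ p, HasFDerivAt P (P' p) p := by
      intro p
      have h1 : HasFDerivAt (fun p : ℝ × ℝ => (p.1 : ℂ)) (Complex.ofRealCLM.comp (ContinuousLinearMap.fst ℝ ℝ ℝ)) p :=
        (Complex.ofRealCLM.comp (ContinuousLinearMap.fst ℝ ℝ ℝ)).hasFDerivAt
      have h2 : HasFDerivAt (fun p : ℝ × ℝ => e p.2) _ p :=
        (hed p.2).hasFDerivAt.comp p (ContinuousLinearMap.snd ℝ ℝ ℝ).hasFDerivAt
      convert! h1.mul h2 using 1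
      ext <;> simp [hP']
    set s : Set (ℝ × ℝ) := Complex.polarCoord '' S with hs
    have hscount : s.Countable := hS.image _
    have hmem : ∀ p ∈ Ioo ε M ×ˢ Ioo (-Real.pi) Real.pi \ s, P p ∉ S := by
      rintro p ⟨hp, hps'⟩ hpS
      apply hps'
      refine ⟨P p, hpS, ?_⟩
      have : P p = Complex.polarCoord.symm p := (hps p).symm
      rw [this]
      apply Complex.polarCoord.right_inv
      rw [Complex.polarCoord_target]
      exact ⟨lt_trans hε.1 hp.1.1, hp.2⟩
    have hsub : ∀ p ∈ uIcc ε M ×ˢ uIcc (-Real.pi) Real.pi, (p.1 : ℂ) ≠ 0 := by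
      rintro p ⟨hp, -⟩
      rw [uIcc_of_le hε.2.le] at hp
      have : 0 < p.1 := lt_of_lt_of_le hε.1 hp.1
      exact_mod_cast this.ne'
    have hPc : Continuous P := by simp only [hP]; fun_prop
    have hinv : ∀ p : ℝ × ℝ, (p.1:ℂ) ≠ 0 → HasFDerivAt (fun p : ℝ × ℝ => I * (p.1 : ℂ)⁻¹)
        ((ContinuousLinearMap.fst ℝ ℝ ℝ).smulRight (-(I * ((p.1:ℂ)^2)⁻¹))) p := by
      intro p hp
      have h1 : HasDerivAt (fun r : ℝ => I * (r:ℂ)⁻¹) (I * -((p.1:ℂ)^2)⁻¹) p.1 := by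
        have := (hasDerivAt_inv hp).comp_ofReal
        exact this.const_mul I
      convert! h1.hasFDerivAt.comp p (ContinuousLinearMap.fst ℝ ℝ ℝ).hasFDerivAt using 1
      ext <;> simp
    have key := integral2_divergence_prod_of_hasFDerivAt_off_countable
      (fun p => G (P p)) (fun p => I * (p.1:ℂ)⁻¹ * G (P p))
      (fun p => (G' (P p)).comp (P' p))
      (fun p => (I * (p.1:ℂ)⁻¹) • ((G' (P p)).comp (P' p)) +
        (G (P p)) • ((ContinuousLinearMap.fst ℝ ℝ ℝ).smulRight (-(I * ((p.1:ℂ)^2)⁻¹))))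
      ε (-Real.pi) M Real.pi s hscount (hG.comp hPc).continuousOn
      (by
        apply ContinuousOn.mul _ (hG.comp hPc).continuousOn
        apply continuousOn_const.mul
        apply ContinuousOn.inv₀ _ hsub
        fun_prop)
      (by
        intro p hp
        rw [min_eq_left hε.2.le, max_eq_right hε.2.le, min_eq_left (by linarith [Real.pi_pos]),
          max_eq_right (by linarith [Real.pi_pos])] at hp
        exact (hd _ (hmem p hp)).comp p (hPd p))
      (by
        intro p hp
        have hp' := hp
        rw [min_eq_left hε.2.le, max_eq_right hε.2.le, min_eq_left (by linarith [Real.pi_pos]),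
          max_eq_right (by linarith [Real.pi_pos])] at hp
        have hne : (p.1 : ℂ) ≠ 0 := by
          have : 0 < p.1 := lt_trans hε.1 hp.1.1.1
          exact_mod_cast this.ne'
        have := (hinv p hne).mul ((hd _ (hmem p hp)).comp p (hPd p))
        exact this)
    have hdiv : ∀ p : ℝ × ℝ, (p.1:ℂ) ≠ 0 →
        ((G' (P p)).comp (P' p)) (1, 0) + ((I * (p.1:ℂ)⁻¹) • ((G' (P p)).comp (P' p)) +
        (G (P p)) • ((ContinuousLinearMap.fst ℝ ℝ ℝ).smulRight (-(I * ((p.1:ℂ)^2)⁻¹)))) (0, 1)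
        = 2 * k p := by
      intro p hp
      have hlin : ∀ c : ℂ, G' (P p) c = c.re * G' (P p) 1 + c.im * G' (P p) I := by
        intro c
        conv_lhs => rw [show c = c.re • (1:ℂ) + c.im • I by simp]
        rw [map_add, map_smul, map_smul, real_smul, real_smul]
      have e1 : P' p (1, 0) = e p.2 := by simp [hP']
      have e2 : P' p (0, 1) = p.1 * (I * e p.2) := by simp [hP']
      simp only [add_apply, smul_apply,
        ContinuousLinearMap.comp_apply, ContinuousLinearMap.smulRight_apply, e1, e2,
        ContinuousLinearMap.coe_fst', smul_eq_mul, zero_smul, mul_zero, add_zero]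
      have e3 : (p.1 : ℂ) * (I * e p.2) = p.1 • (I * e p.2) := by rw [real_smul]
      rw [e3, map_smul, real_smul]
      have e4 : k p = (e p.2)⁻¹ * h (P p) := rfl
      rw [e4, ← hdb, hlin (e p.2), hlin (I * e p.2)]
      have hn := hene p.2
      have e5 : (e p.2) = (e p.2).re + (e p.2).im * I := (re_add_im _).symm
      have e6 : (e p.2)⁻¹ = (e p.2).re - (e p.2).im * I := by
        rw [Complex.inv_def, normSq_eq_norm_sq, hen]
        simp [Complex.ext_iff]
      rw [e6]
      simp only [mul_re, I_re, I_im, mul_im]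
      push_cast
      field_simp
      ring_nf
      rw [I_sq]
      ring
    have key2 := key (by
      have hk2 : IntegrableOn (fun p => 2 * k p) (uIcc ε M ×ˢ uIcc (-Real.pi) Real.pi) :=
        (continuous_const.mul hkc).continuousOn.integrableOn_compact (isCompact_uIcc.prod isCompact_uIcc)
      refine hk2.congr_fun (fun p hp => (hdiv p (hsub p hp)).symm) (isCompact_uIcc.prod isCompact_uIcc).measurableSet)
    have hlhs : 2 * Φ ε = (∫ x in ε..M, ∫ y in (-Real.pi)..Real.pi,
        (fun p : ℝ × ℝ => ((G' (P p)).comp (P' p)) (1, 0) + ((I * (p.1:ℂ)⁻¹) • ((G' (P p)).comp (P' p)) +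
        (G (P p)) • ((ContinuousLinearMap.fst ℝ ℝ ℝ).smulRight (-(I * ((p.1:ℂ)^2)⁻¹)))) (0, 1)) (x, y)) := by
      rw [hΦ, ← intervalIntegral.integral_const_mul]
      refine intervalIntegral.integral_congr (fun x hx => ?_)
      simp only
      rw [← intervalIntegral.integral_const_mul]
      refine intervalIntegral.integral_congr (fun y hy => ?_)
      exact (hdiv (x, y) (hsub (x, y) ⟨hx, hy⟩)).symm
    have key3 := hlhs.trans key2
    have t1 : ∀ x : ℝ, P (x, Real.pi) = P (x, -Real.pi) := by
      intro x; simp only [hP, he]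
      push_cast
      rw [neg_mul, Complex.exp_neg, Complex.exp_pi_mul_I]; norm_num
    have t2 : ∀ y : ℝ, G (P (M, y)) = 0 := by
      intro y; apply hGM
      simp only [hP, norm_mul, hen, mul_one, norm_real]; exact le_abs_self _
    simp only [t1, t2, sub_self, intervalIntegral.integral_zero, zero_add, zero_sub] at key3
    simp only [hΨ]
    have t3 : Φ ε = (2 * Φ ε) / 2 := by ring
    rw [t3, key3]
    ring
  have h0 : Φ 0 = Ψ 0 := by
    have hcl : (0:ℝ) ∈ closure (Ioo (0:ℝ) M) := by
      rw [closure_Ioo hMpos.ne]; exact ⟨le_rfl, hMpos.le⟩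
    exact (isClosed_eq hΦc hΨc).closure_subset_iff.2 heq hcl
  rw [step1]
  change Φ 0 = _
  rw [h0]
  simp only [hΨ, ofReal_zero, zero_mul, intervalIntegral.integral_const, real_smul]
  push_cast
  ring

open MeasureTheory Complex in
theorem cp_core (G h : ℂ → ℂ) (G' : ℂ → ℂ →L[ℝ] ℂ) (S : Set ℂ) (hS : S.Countable)
    (hG : Continuous G) (hGs : HasCompactSupport G)
    (hd : ∀ l ∉ S, HasFDerivAt G (G' l) l)
    (hh : Continuous h) (hhs : HasCompactSupport h)
    (hdb : ∀ l ∉ S, (G' l 1 + I * G' l I) / 2 = h l) :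
    ∫ l, h l / l = -(Real.pi : ℂ) * G 0 := by
  classical
  refine cp_core0 G h (fun l => if l ∈ S then h l • (Complex.conjCLE : ℂ →L[ℝ] ℂ) else G' l) S hS hG hGs ?_ hh hhs ?_
  · intro l hl; simpa [hl] using hd l hl
  · intro l
    by_cases hl : l ∈ S
    · simp only [hl, if_true, smul_apply]
      simp
      ring_nf
      simp
      try ring
    · simpa [hl] using hdb l hl

open MeasureTheory in
theorem integrableOn_inv_ball (M : ℝ) : IntegrableOn (fun l : ℂ => l⁻¹) (Metric.ball 0 M) := by
  refine integrableOn_ball_of_norm_le_rpow (C := 1) (α := 1) (by simp) (by simp) ?_ ?_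
  · refine ae_of_all _ (fun l => ?_)
    rw [norm_inv, Real.rpow_neg_one, one_mul]
  · exact (measurable_inv).aestronglyMeasurable

open MeasureTheory in
theorem integrable_kernel (χ : ℂ → ℂ) (hχ : Continuous χ) (hc : HasCompactSupport χ) (a : ℂ) :
    Integrable (fun l => χ l / (l - a)) := by
  obtain ⟨M0, hM0⟩ := hc.isCompact.isBounded.subset_ball a
  have h1 : IntegrableOn (fun l : ℂ => (l - a)⁻¹) (Metric.ball a M0) := by
    have := (measurePreserving_sub_right (volume : Measure ℂ) a).integrableOn_comp_preimage
      (f := fun l : ℂ => l⁻¹) (s := Metric.ball 0 M0) (Homeomorph.subRight a).measurableEmbedding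
    have h2 := this.2 (integrableOn_inv_ball M0)
    have h3 : (fun x => x - a) ⁻¹' Metric.ball (0:ℂ) M0 = Metric.ball a M0 := by
      ext x; simp [dist_eq_norm]
    rw [h3] at h2
    exact h2
  obtain ⟨C, hC⟩ := hχ.bounded_above_of_compact_support hc
  have h2 : IntegrableOn (fun l : ℂ => χ l * (l - a)⁻¹) (Metric.ball a M0) :=
    h1.bdd_mul (hχ.aestronglyMeasurable) (ae_of_all _ hC)
  have h3 := h2.integrable_indicator Metric.isOpen_ball.measurableSet
  have h4 : (fun l => χ l / (l - a)) =
      (Metric.ball a M0).indicator (fun l : ℂ => χ l * (l - a)⁻¹) := by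
    ext l
    by_cases hl : l ∈ Metric.ball a M0
    · simp only [hl, indicator_of_mem, div_eq_mul_inv]
    · have : χ l = 0 := by
        by_contra hne
        exact hl (hM0 (subset_tsupport _ hne))
      rw [indicator_of_notMem hl, this, zero_div]
  rw [h4]
  exact h3

/-- the `dbar` part of a real linear map on `ℂ`. -/
def dbL (L : ℂ →L[ℝ] ℂ) : ℂ := (L 1 + Complex.I * L Complex.I) / 2

theorem continuous_dbL : Continuous dbL := by
  unfold dbL; fun_prop

theorem dbL_add (L L' : ℂ →L[ℝ] ℂ) : dbL (L + L') = dbL L + dbL L' := by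
  simp [dbL]; ring

theorem dbL_smul (c : ℂ) (L : ℂ →L[ℝ] ℂ) : dbL (c • L) = c * dbL L := by
  simp [dbL]; ring

theorem continuous_mul_of_tsupport {χ g : ℂ → ℂ} (hχ : Continuous χ) {O : Set ℂ} (hO : IsOpen O)
    (hs : tsupport χ ⊆ O) (hg : ContinuousOn g O) : Continuous fun l => χ l * g l := by
  rw [continuous_iff_continuousAt]
  intro l
  by_cases hl : l ∈ O
  · exact hχ.continuousAt.mul (hg.continuousAt (hO.mem_nhds hl))
  · have h1 : l ∉ tsupport χ := fun h => hl (hs h)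
    have h2 : (fun l => χ l * g l) =ᶠ[nhds l] fun _ => 0 := by
      filter_upwards [(isClosed_tsupport χ).isOpen_compl.mem_nhds h1] with x hx
      rw [image_eq_zero_of_notMem_tsupport hx, zero_mul]
    exact h2.continuousAt

theorem tsupport_dbL_subset (χ : ℂ → ℂ) : tsupport (fun l => dbL (fderiv ℝ χ l)) ⊆ tsupport χ := by
  refine closure_minimal ?_ (isClosed_tsupport _)
  intro l hl
  refine support_fderiv_subset ℝ ?_
  intro h0
  apply hl
  have h0' : fderiv ℝ χ l = 0 := h0
  simp [h0', dbL]

open MeasureTheory in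
theorem cp_loc (χ g h : ℂ → ℂ) (g' : ℂ → ℂ →L[ℝ] ℂ) (O S : Set ℂ) (hS : S.Countable)
    (hO : IsOpen O) (hχ : ContDiff ℝ 1 χ) (hc : HasCompactSupport χ) (hs : tsupport χ ⊆ O)
    (hg : ContinuousOn g O) (hh : ContinuousOn h O)
    (hd : ∀ l ∈ O, l ∉ S → HasFDerivAt g (g' l) l)
    (hdb : ∀ l ∈ O, l ∉ S → dbL (g' l) = h l) :
    ∫ l, (χ l * h l + dbL (fderiv ℝ χ l) * g l) / l = -(Real.pi : ℂ) * (χ 0 * g 0) := by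
  classical
  have hbc : Continuous fun l => dbL (fderiv ℝ χ l) :=
    continuous_dbL.comp (hχ.continuous_fderiv (by norm_num))
  have hbs := tsupport_dbL_subset χ
  refine cp_core (fun l => χ l * g l) _
    (fun l => if l ∈ O then χ l • g' l + g l • fderiv ℝ χ l else 0) S hS
    (continuous_mul_of_tsupport hχ.continuous hO hs hg) ?_ ?_ ?_ ?_ ?_
  · exact hc.mul_right
  · intro l hl
    by_cases hlO : l ∈ O
    · simp only [hlO, if_true]
      exact ((hχ.differentiable (by norm_num)) l).hasFDerivAt.mul (hd l hlO hl)
    · simp only [hlO, if_false]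
      have h1 : l ∉ tsupport χ := fun h => hlO (hs h)
      have h2 : (fun l => χ l * g l) =ᶠ[nhds l] fun _ => 0 := by
        filter_upwards [(isClosed_tsupport χ).isOpen_compl.mem_nhds h1] with x hx
        rw [image_eq_zero_of_notMem_tsupport hx, zero_mul]
      exact (hasFDerivAt_const (0:ℂ) l).congr_of_eventuallyEq h2
  · exact (continuous_mul_of_tsupport hχ.continuous hO hs hh).add
      (continuous_mul_of_tsupport hbc hO (hbs.trans hs) hg)
  · refine HasCompactSupport.add hc.mul_right ?_
    refine HasCompactSupport.mul_right ?_
    exact hc.isCompact.of_isClosed_subset (isClosed_tsupport _) hbs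
  · intro l hl
    by_cases hlO : l ∈ O
    · have := hdb l hlO hl
      simp only [hlO, if_true]
      change dbL _ = _
      rw [dbL_add, dbL_smul, dbL_smul, this]
      ring
    · have h1 : l ∉ tsupport χ := fun h => hlO (hs h)
      have h2 : l ∉ tsupport (fun l => dbL (fderiv ℝ χ l)) := fun h => h1 (hbs h)
      have h3 : dbL (fderiv ℝ χ l) = 0 := image_eq_zero_of_notMem_tsupport (f := fun l => dbL (fderiv ℝ χ l)) h2
      have h4 := image_eq_zero_of_notMem_tsupport h1
      simp [hlO, h3, h4]

theorem contDiffOn_one_of {E : Type*} [NormedAddCommGroup E] [NormedSpace ℝ E]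
    {Ω : Set E} (hΩ : IsOpen Ω) {u : E → ℂ} {u' : E → E →L[ℝ] ℂ}
    (h : ∀ z ∈ Ω, HasFDerivAt u (u' z) z) (hc : ContinuousOn u' Ω) : ContDiffOn ℝ 1 u Ω := by
  have h1 : (1 : WithTop ℕ∞) = 0 + 1 := by norm_num
  rw [h1, contDiffOn_succ_iff_fderiv_of_isOpen hΩ]
  refine ⟨fun z hz => (h z hz).differentiableAt.differentiableWithinAt, by simp, ?_⟩
  rw [contDiffOn_zero]
  exact hc.congr (fun z hz => (h z hz).fderiv)

open MeasureTheory in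
theorem param_cont {E F : Type*} [NormedAddCommGroup E] [NormedSpace ℝ E]
    [NormedAddCommGroup F] [NormedSpace ℂ F] [SecondCountableTopology F]
    (K : ℂ → ℂ) (hK : Integrable K) (S : Set ℂ) (hS : IsClosed S) (hKS : ∀ l, l ∉ S → K l = 0)
    (Ω : Set E) (G : ℂ → E → F)
    (hGc : ContinuousOn (fun p : ℂ × E => G p.1 p.2) (S ×ˢ Ω)) (b : ℝ)
    (hGb : ∀ l ∈ S, ∀ z ∈ Ω, ‖G l z‖ ≤ b) :
    (∀ z ∈ Ω, Integrable (fun l => K l • G l z)) ∧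
    ContinuousOn (fun z => ∫ l, K l • G l z) Ω ∧
    ∀ z ∈ Ω, ‖∫ l, K l • G l z‖ ≤ (∫ l, ‖K l‖) * b := by
  have hm : ∀ z ∈ Ω, AEStronglyMeasurable (fun l => K l • G l z) := by
    intro z hz
    have h1 : AEStronglyMeasurable (fun l => G l z) (volume.restrict S) := by
      refine ContinuousOn.aestronglyMeasurable ?_ hS.measurableSet
      exact hGc.comp (f := fun l : ℂ => (l, z)) (by fun_prop) (fun l hl => ⟨hl, hz⟩)
    have h2 := (aestronglyMeasurable_indicator_iff hS.measurableSet).2 h1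
    have h3 : (fun l => K l • G l z) = fun l => K l • S.indicator (fun l => G l z) l := by
      ext l
      by_cases hl : l ∈ S
      · simp [hl]
      · simp [hKS l hl]
    rw [h3]
    exact hK.aestronglyMeasurable.smul h2
  have hb : ∀ z ∈ Ω, ∀ l, ‖K l • G l z‖ ≤ ‖K l‖ * b := by
    intro z hz l
    by_cases hl : l ∈ S
    · rw [norm_smul]
      exact mul_le_mul_of_nonneg_left (hGb l hl z hz) (norm_nonneg _)
    · simp [hKS l hl]
  refine ⟨fun z hz => (hK.norm.mul_const b).mono' (hm z hz) (ae_of_all _ (hb z hz)), ?_, ?_⟩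
  · refine continuousOn_of_dominated (bound := fun l => ‖K l‖ * b) hm
      (fun z hz => ae_of_all _ (hb z hz)) (hK.norm.mul_const b) (ae_of_all _ fun l => ?_)
    by_cases hl : l ∈ S
    · exact continuousOn_const.smul
        (hGc.comp (f := fun z : E => (l, z)) (by fun_prop) (fun z hz => ⟨hl, hz⟩))
    · simp only [hKS l hl, zero_smul]
      exact continuousOn_const
  · intro z hz
    refine (norm_integral_le_of_norm_le (hK.norm.mul_const b) (ae_of_all _ (hb z hz))).trans ?_
    rw [integral_mul_const]

open MeasureTheory in
theorem param_deriv {E : Type*} [NormedAddCommGroup E] [NormedSpace ℝ E] [FiniteDimensional ℝ E]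
    (K : ℂ → ℂ) (hK : Integrable K) (S : Set ℂ) (hS : IsClosed S) (hKS : ∀ l, l ∉ S → K l = 0)
    (Ω : Set E) (hΩ : IsOpen Ω) (G : ℂ → E → ℂ) (G' : ℂ → E → E →L[ℝ] ℂ)
    (hGc : ContinuousOn (fun p : ℂ × E => G p.1 p.2) (S ×ˢ Ω)) (b : ℝ)
    (hGb : ∀ l ∈ S, ∀ z ∈ Ω, ‖G l z‖ ≤ b)
    (hGc' : ContinuousOn (fun p : ℂ × E => G' p.1 p.2) (S ×ˢ Ω)) (b' : ℝ)
    (hGb' : ∀ l ∈ S, ∀ z ∈ Ω, ‖G' l z‖ ≤ b')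
    (hd : ∀ l ∈ S, ∀ z ∈ Ω, HasFDerivAt (G l) (G' l z) z) :
    (∀ z ∈ Ω, HasFDerivAt (fun z => ∫ l, K l • G l z) (∫ l, K l • G' l z) z) ∧
    ContDiffOn ℝ 1 (fun z => ∫ l, K l • G l z) Ω ∧ 
    ∀ z ∈ Ω, ∀ x, (∫ l, K l • G' l z) x = ∫ l, K l * G' l z x := by
  obtain ⟨i1, c1, n1⟩ := param_cont K hK S hS hKS Ω G hGc b hGb
  obtain ⟨i2, c2, n2⟩ := param_cont K hK S hS hKS Ω G' hGc' b' hGb'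
  have key : ∀ z ∈ Ω, HasFDerivAt (fun z => ∫ l, K l • G l z) (∫ l, K l • G' l z) z := by
    intro z hz
    obtain ⟨ε, hε, hball⟩ := Metric.isOpen_iff.1 hΩ z hz
    refine hasFDerivAt_integral_of_dominated_of_fderiv_le (s := Metric.ball z ε) (bound := fun l => ‖K l‖ * b')
      (F' := fun z l => K l • G' l z) (Metric.ball_mem_nhds z hε) ?_ (i1 z hz) (i2 z hz).aestronglyMeasurable ?_ (hK.norm.mul_const b') ?_
    · filter_upwards [hΩ.mem_nhds hz] with w hw using (i1 w hw).aestronglyMeasurable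
    · refine ae_of_all _ (fun l w hw => ?_)
      by_cases hl : l ∈ S
      · rw [norm_smul]
        exact mul_le_mul_of_nonneg_left (hGb' l hl w (hball hw)) (norm_nonneg _)
      · simp [hKS l hl]
    · refine ae_of_all _ (fun l w hw => ?_)
      by_cases hl : l ∈ S
      · exact (hd l hl w (hball hw)).const_smul (K l)
      · simp only [hKS l hl, zero_smul]
        have h0 : (0:ℂ) • G' l w = 0 := by ext; simp
        rw [h0]
        exact hasFDerivAt_const (𝕜 := ℝ) (0:ℂ) w
  refine ⟨key, ?_, ?_⟩
  · exact contDiffOn_one_of hΩ key c2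
  · intro z hz x
    rw [ContinuousLinearMap.integral_apply (i2 z hz)]
    rfl

/-- complex number times a basis vector -/
def eC (N : ℕ) (j : Fin N) : ℂ →L[ℝ] (Fin N → ℂ) := ContinuousLinearMap.single ℝ (fun _ : Fin N => ℂ) j

theorem eC_apply {N : ℕ} (j : Fin N) (t : ℂ) : eC N j t = Pi.single j t := rfl

theorem norm_eC {N : ℕ} (j : Fin N) (t : ℂ) : ‖eC N j t‖ = ‖t‖ := by
  rw [eC_apply, Pi.norm_single]

/-- partial sums -/
def pS {N : ℕ} (s : Finset (Fin N)) (h : Fin N → ℂ) : Fin N → ℂ := fun i => if i ∈ s then h i else 0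

theorem norm_pS {N : ℕ} (s : Finset (Fin N)) (h : Fin N → ℂ) : ‖pS s h‖ ≤ ‖h‖ := by
  rw [pi_norm_le_iff_of_nonneg (norm_nonneg _)]
  intro i
  unfold pS
  split_ifs
  · exact norm_le_pi_norm h i
  · simp

theorem partials_C1 {N : ℕ} (Ω : Set (Fin N → ℂ)) (hΩ : IsOpen Ω) (u : (Fin N → ℂ) → ℂ)
    (p : Fin N → (Fin N → ℂ) → ℂ →L[ℝ] ℂ) (hp : ∀ j, ContinuousOn (p j) Ω)
    (hd : ∀ j, ∀ z ∈ Ω, HasFDerivAt (fun t : ℂ => u (z + eC N j t)) (p j z) 0) :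
    ∀ z ∈ Ω, HasFDerivAt u (∑ j, (p j z).comp (ContinuousLinearMap.proj j)) z := by
  intro z hz
  have main : ∀ s : Finset (Fin N), ∀ c > 0, ∀ᶠ h in nhds (0 : Fin N → ℂ),
      ‖u (z + pS s h) - u z - ∑ j ∈ s, p j z (h j)‖ ≤ c * ‖h‖ := by
    intro s
    induction s using Finset.induction_on with
    | empty =>
      intro c hc
      refine Filter.Eventually.of_forall fun h => ?_
      have : pS (∅ : Finset (Fin N)) h = 0 := by ext i; simp [pS]
      simp [this]; positivity
    | insert j s hj ih =>
      intro c hc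
      have h1 := ih (c/2) (by positivity)
      have h2 : ∀ᶠ w in nhds z, w ∈ Ω ∧ ‖p j w - p j z‖ ≤ c / 2 := by
        refine Filter.Eventually.and (hΩ.mem_nhds hz) ?_
        have := ((hp j).continuousAt (hΩ.mem_nhds hz))
        have := Metric.continuousAt_iff'.1 this (c/2) (by positivity)
        filter_upwards [this] with w hw
        rw [← dist_eq_norm]; exact hw.le
      obtain ⟨ε, hε, hball⟩ := Metric.eventually_nhds_iff.1 h2
      filter_upwards [h1, Metric.ball_mem_nhds (0 : Fin N → ℂ) hε] with h hh hhε
      have hhε : ‖h‖ < ε := by simpa using hhε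
      have hins : ∀ t : ℂ, ‖t‖ ≤ ‖h‖ → ‖pS s h + eC N j t‖ ≤ ‖h‖ := by
        intro t ht
        rw [pi_norm_le_iff_of_nonneg (norm_nonneg _)]
        intro i
        rw [eC_apply]
        by_cases hij : i = j
        · subst hij
          simpa [pS, hj] using ht
        · simp only [Pi.add_apply, Pi.single_eq_of_ne hij, add_zero]
          exact (norm_le_pi_norm _ i).trans (norm_pS s h)
      have hw : ∀ t : ℂ, ‖t‖ ≤ ‖h‖ → dist (z + pS s h + eC N j t) z < ε := by
        intro t ht
        rw [dist_eq_norm, add_assoc, add_sub_cancel_left]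
        exact (hins t ht).trans_lt hhε
      have hder : ∀ t ∈ Metric.closedBall (0:ℂ) ‖h‖,
          HasFDerivWithinAt (fun t => u (z + pS s h + eC N j t)) (p j (z + pS s h + eC N j t))
            (Metric.closedBall (0:ℂ) ‖h‖) t := by
        intro t ht
        have ht : ‖t‖ ≤ ‖h‖ := by simpa using ht
        have h3 := hd j _ (hball (hw t ht)).1
        have h4 : HasFDerivAt (fun t' : ℂ => t' - t) (ContinuousLinearMap.id ℝ ℂ) t :=
          (hasFDerivAt_id t).sub_const t
        have h5 : HasFDerivAt (fun t' : ℂ => u (z + pS s h + eC N j t + eC N j (t' - t)))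
            ((p j (z + pS s h + eC N j t)).comp (ContinuousLinearMap.id ℝ ℂ)) t := by
          refine HasFDerivAt.comp (g := fun t' : ℂ => u (z + pS s h + eC N j t + eC N j t')) t ?_ h4
          rw [sub_self]; exact h3
        rw [ContinuousLinearMap.comp_id] at h5
        refine HasFDerivAt.hasFDerivWithinAt ?_
        convert! h5 using 2 with t'
        rw [map_sub]; congr 1; abel
      have h6 := (convex_closedBall (0:ℂ) ‖h‖).norm_image_sub_le_of_norm_hasFDerivWithin_le'
        (φ := p j z) (C := c/2) hder
        (fun t ht => (hball (hw t (by simpa using ht))).2)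
        (x := 0) (y := h j) (by simp) (by simpa using norm_le_pi_norm h j)
      have h7 : pS (insert j s) h = pS s h + eC N j (h j) := by
        ext i
        rw [eC_apply]
        by_cases hij : i = j
        · subst hij; simp [pS, hj]
        · simp [pS, hij]
      rw [Finset.sum_insert hj, h7]
      have h8 : ‖h j‖ ≤ ‖h‖ := norm_le_pi_norm h j
      simp only [map_zero, add_zero, sub_zero] at h6
      calc _ = ‖(u (z + pS s h + eC N j (h j)) - u (z + pS s h) - p j z (h j)) +
            (u (z + pS s h) - u z - ∑ j ∈ s, p j z (h j))‖ := by
            congr 1; rw [← add_assoc]; ring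
        _ ≤ c / 2 * ‖h j‖ + c / 2 * ‖h‖ := (norm_add_le _ _).trans (add_le_add h6 hh)
        _ ≤ c * ‖h‖ := by nlinarith
  rw [hasFDerivAt_iff_isLittleO_nhds_zero, Asymptotics.isLittleO_iff]
  intro c hc
  filter_upwards [main Finset.univ c hc] with h hh
  have : pS Finset.univ h = h := by ext i; simp [pS]
  rw [this] at hh
  simpa using hh

open scoped ContDiff in
theorem exists_bump (ε : ℝ) (hε : 0 < ε) : ∃ χ : ℂ → ℂ, ContDiff ℝ 1 χ ∧ HasCompactSupport χ ∧
    tsupport χ ⊆ Metric.closedBall 0 ε ∧ χ 0 = 1 ∧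
    ContDiff ℝ 1 (fun l => dbL (fderiv ℝ χ l) / l) := by
  let f : ContDiffBump (0:ℂ) := ⟨ε/2, ε, by positivity, by linarith⟩
  let χ : ℂ → ℂ := fun l => ((f l : ℝ) : ℂ)
  have hχ : ContDiff ℝ ∞ χ := Complex.ofRealCLM.contDiff.comp f.contDiff
  have hsup : tsupport χ ⊆ Metric.closedBall 0 ε := by
    refine closure_minimal ?_ Metric.isClosed_closedBall
    intro l hl
    have h1 : l ∈ Function.support f := by
      intro h; apply hl; simp [χ, h]
    rw [f.support_eq] at h1
    exact Metric.ball_subset_closedBall h1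
  refine ⟨χ, hχ.of_le (by norm_cast), ?_, hsup, ?_, ?_⟩
  · exact (isCompact_closedBall (0:ℂ) ε).of_isClosed_subset (isClosed_tsupport _) hsup
  · simp only [χ]
    rw [f.one_of_mem_closedBall (by simp [f.rIn_pos.le])]; simp
  · have h1 : ContDiff ℝ 1 (fun l => dbL (fderiv ℝ χ l)) := by
      have h2 : ContDiff ℝ 1 (fderiv ℝ χ) := hχ.fderiv_right (by norm_cast)
      unfold dbL
      have h3 : ∀ v : ℂ, ContDiff ℝ 1 (fun l => fderiv ℝ χ l v) := fun v => h2.clm_apply contDiff_const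
      exact ((h3 1).add (contDiff_const.mul (h3 Complex.I))).div_const 2
    rw [contDiff_iff_contDiffAt]
    intro l
    by_cases hl : l = 0
    · subst hl
      have h4 : (fun l => dbL (fderiv ℝ χ l) / l) =ᶠ[nhds 0] fun _ => 0 := by
        filter_upwards [Metric.ball_mem_nhds (0:ℂ) (half_pos hε)] with l hl
        have h5 : χ =ᶠ[nhds l] fun _ => 1 := by
          filter_upwards [Metric.isOpen_ball.mem_nhds hl] with w hw
          simp only [χ]
          rw [f.one_of_mem_closedBall (Metric.ball_subset_closedBall hw)]; simp
        rw [h5.fderiv_eq]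
        simp [dbL]
      exact contDiffAt_const.congr_of_eventuallyEq h4
    · simp only [div_eq_mul_inv]
      exact h1.contDiffAt.mul (contDiffAt_inv ℝ hl)

/-- weak form of the `dbar` equation in direction `j` -/
def WeakDb {N : ℕ} (Ω : Set (Fin N → ℂ)) (j : Fin N) (u h : (Fin N → ℂ) → ℂ) : Prop :=
  ∀ z ∈ Ω, ∀ χ : ℂ → ℂ, ContDiff ℝ 1 χ → HasCompactSupport χ →
    (∀ l ∈ tsupport χ, z + eC N j l ∈ Ω) →
    ∫ l, (χ l * h (z + eC N j l) + dbL (fderiv ℝ χ l) * u (z + eC N j l)) / l =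
      -(Real.pi : ℂ) * (χ 0 * u z)

theorem slice_open {N : ℕ} {Ω : Set (Fin N → ℂ)} (hΩ : IsOpen Ω) (j : Fin N) (z : Fin N → ℂ) :
    IsOpen {l : ℂ | z + eC N j l ∈ Ω} :=
  hΩ.preimage (by fun_prop)

theorem slice_contOn {N : ℕ} {Ω : Set (Fin N → ℂ)} {u : (Fin N → ℂ) → ℂ} (hu : ContinuousOn u Ω) (j : Fin N) (z : Fin N → ℂ) :
    ContinuousOn (fun l => u (z + eC N j l)) {l : ℂ | z + eC N j l ∈ Ω} :=
  hu.comp (by fun_prop) (fun _ h => h)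

open MeasureTheory in
theorem weak_integrable {N : ℕ} {Ω : Set (Fin N → ℂ)} (hΩ : IsOpen Ω) (j : Fin N)
    {u : (Fin N → ℂ) → ℂ} (hu : ContinuousOn u Ω) (z : Fin N → ℂ)
    (χ : ℂ → ℂ) (hχ : Continuous χ) (hc : HasCompactSupport χ)
    (hs : ∀ l ∈ tsupport χ, z + eC N j l ∈ Ω) :
    Integrable (fun l => χ l * u (z + eC N j l) / l) := by
  have := integrable_kernel (fun l => χ l * u (z + eC N j l))
    (continuous_mul_of_tsupport hχ (slice_open hΩ j z) hs (slice_contOn hu j z)) hc.mul_right 0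
  simpa using this

theorem dbL_compact {χ : ℂ → ℂ} (hc : HasCompactSupport χ) :
    HasCompactSupport (fun l => dbL (fderiv ℝ χ l)) :=
  hc.isCompact.of_isClosed_subset (isClosed_tsupport _) (tsupport_dbL_subset χ)

theorem dbL_cont {χ : ℂ → ℂ} (hχ : ContDiff ℝ 1 χ) :
    Continuous (fun l => dbL (fderiv ℝ χ l)) :=
  continuous_dbL.comp (hχ.continuous_fderiv (by norm_num))

open MeasureTheory in
theorem weak_unique {N : ℕ} {Ω : Set (Fin N → ℂ)} (hΩ : IsOpen Ω) (j : Fin N)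
    {u g h : (Fin N → ℂ) → ℂ} (hu : ContinuousOn u Ω) (hg : ContinuousOn g Ω) (hh : ContinuousOn h Ω)
    (h1 : WeakDb Ω j u g) (h2 : WeakDb Ω j u h) : ∀ z ∈ Ω, g z = h z := by
  intro z hz
  have hO := slice_open hΩ j z
  have h0 : (0:ℂ) ∈ {l : ℂ | z + eC N j l ∈ Ω} := by simpa using hz
  have hgc := slice_contOn hg j z
  have hhc := slice_contOn hh j z
  have hlc : LocallyIntegrableOn (fun l => g (z + eC N j l) - h (z + eC N j l)) {l : ℂ | z + eC N j l ∈ Ω} :=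
    (hgc.sub hhc).locallyIntegrableOn hO.measurableSet
  have key := hO.ae_eq_zero_of_integral_contDiff_smul_eq_zero hlc ?_
  · have h4 := Measure.eqOn_open_of_ae_eq (μ := volume) (U := {l : ℂ | z + eC N j l ∈ Ω}) (f := fun l => g (z + eC N j l) - h (z + eC N j l))
      (g := fun _ => (0:ℂ)) ?_ hO (hgc.sub hhc) continuousOn_const h0
    · simpa [sub_eq_zero] using h4
    · rw [Filter.EventuallyEq, ae_restrict_iff' hO.measurableSet]
      exact key
  · intro ψ hψ hψc hψs
    let χ : ℂ → ℂ := fun l => l * ((ψ l : ℝ) : ℂ)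
    have hχ : ContDiff ℝ 1 χ :=
      contDiff_id.mul ((Complex.ofRealCLM.contDiff.comp hψ).of_le (by norm_cast))
    have hts : tsupport χ ⊆ tsupport ψ := by
      refine closure_mono ?_
      intro l hl hl2; apply hl; simp [χ, hl2]
    have hcs : HasCompactSupport χ := hψc.isCompact.of_isClosed_subset (isClosed_tsupport _) hts
    have hs : ∀ l ∈ tsupport χ, z + eC N j l ∈ Ω := fun l hl => hψs (hts hl)
    have e1 := h1 z hz χ hχ hcs hs
    have e2 := h2 z hz χ hχ hcs hs
    have i1 := weak_integrable hΩ j hg z χ hχ.continuous hcs hs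
    have i2 := weak_integrable hΩ j hh z χ hχ.continuous hcs hs
    have i3 := weak_integrable hΩ j hu z _ (dbL_cont hχ) (dbL_compact hcs)
      (fun l hl => hs l (tsupport_dbL_subset χ hl))
    simp only [add_div] at e1 e2
    rw [integral_add i1 i3] at e1
    rw [integral_add i2 i3] at e2
    have e3 : ∫ l, χ l * g (z + eC N j l) / l = ∫ l, χ l * h (z + eC N j l) / l := by
      have := e1.trans e2.symm
      exact add_right_cancel this
    have e4 : ∫ l, (χ l * g (z + eC N j l) / l - χ l * h (z + eC N j l) / l) = 0 := by
      rw [integral_sub i1 i2, e3, sub_self]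
    rw [← e4]
    refine integral_congr_ae ?_
    have : ∀ᵐ l : ℂ, l ≠ 0 := by
      rw [ae_iff]; simp
    filter_upwards [this] with l hl
    simp only [χ, Complex.real_smul]
    field_simp

open MeasureTheory in
theorem conv_deriv (κ : ℂ → ℂ) (hκ : ContDiff ℝ 1 κ) (hκc : HasCompactSupport κ)
    (K : ℂ → ℂ) (hK : Integrable K) :
    HasFDerivAt (fun t => ∫ l, K l • κ (l - t)) (∫ l, K l • (- fderiv ℝ κ l)) 0 := by
  obtain ⟨b, hb⟩ := hκ.continuous.bounded_above_of_compact_support hκc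
  have hcd : Continuous (fderiv ℝ κ) := hκ.continuous_fderiv (by norm_num)
  obtain ⟨b', hb'⟩ := hcd.bounded_above_of_compact_support (hκc.fderiv ℝ)
  have := (param_deriv K hK univ isClosed_univ (by simp) univ isOpen_univ (fun l t => κ (l - t))
    (fun l t => - fderiv ℝ κ (l - t)) (hκ.continuous.comp (by fun_prop)).continuousOn b
    (fun l _ z _ => hb _) (hcd.comp (by fun_prop)).neg.continuousOn b'
    (fun l _ z _ => by rw [norm_neg]; exact hb' _) ?_).1 0 (mem_univ _)
  · simpa using this
  · intro l _ t _
    have h1 : HasFDerivAt (fun t : ℂ => l - t) (-(ContinuousLinearMap.id ℝ ℂ)) t :=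
      (hasFDerivAt_id t).const_sub l
    have h2 := ((hκ.differentiable (by norm_num)) (l - t)).hasFDerivAt.comp t h1
    convert! h2 using 1
    ext x; simp

open MeasureTheory in
theorem weak_partial {N : ℕ} {Ω : Set (Fin N → ℂ)} (hΩ : IsOpen Ω) (j : Fin N)
    {u h : (Fin N → ℂ) → ℂ} (hu : ContinuousOn u Ω) (hh : ContDiffOn ℝ 1 h Ω)
    (hw : WeakDb Ω j u h) (z0 : Fin N → ℂ) (hz0 : z0 ∈ Ω) :
    ∃ ε > 0, ∃ p : (Fin N → ℂ) → ℂ →L[ℝ] ℂ, ContinuousOn p (Metric.ball z0 ε) ∧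
      ∀ z ∈ Metric.ball z0 ε, HasFDerivAt (fun t : ℂ => u (z + eC N j t)) (p z) 0 := by
  obtain ⟨ε', hε', hball⟩ := Metric.nhds_basis_closedBall.mem_iff.1 (hΩ.mem_nhds hz0)
  obtain ⟨ε, hε, rfl⟩ : ∃ ε > 0, ε' = 4 * ε := ⟨ε'/4, by positivity, by ring⟩
  have hcomp : IsCompact (Metric.closedBall z0 (4*ε)) := isCompact_closedBall _ _
  have hmem : ∀ z ∈ Metric.ball z0 (2*ε), ∀ l : ℂ, ‖l‖ ≤ 2*ε → z + eC N j l ∈ Metric.closedBall z0 (4*ε) := by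
    intro z hz l hl
    rw [Metric.mem_closedBall, dist_eq_norm]
    rw [Metric.mem_ball, dist_eq_norm] at hz
    calc ‖z + eC N j l - z0‖ = ‖(z - z0) + eC N j l‖ := by congr 1; abel
      _ ≤ ‖z - z0‖ + ‖l‖ := by rw [← norm_eC j l]; exact norm_add_le _ _
      _ ≤ 4 * ε := by linarith
  obtain ⟨bu, hbu⟩ := hcomp.exists_bound_of_continuousOn (hu.mono hball)
  obtain ⟨bh, hbh⟩ := hcomp.exists_bound_of_continuousOn (hh.continuousOn.mono hball)
  have hhc' : ContinuousOn (fderiv ℝ h) Ω := hh.continuousOn_fderiv_of_isOpen hΩ (by norm_num)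
  obtain ⟨bh', hbh'⟩ := hcomp.exists_bound_of_continuousOn (hhc'.mono hball)
  obtain ⟨χ, hχ, hχc, hχs, hχ0, hκ⟩ := exists_bump ε hε
  set κ : ℂ → ℂ := fun l => dbL (fderiv ℝ χ l) / l with hκdef
  have hκ0 : ∀ l : ℂ, ε < ‖l‖ → κ l = 0 := by
    intro l hl
    have h1 : l ∉ tsupport (fun l => dbL (fderiv ℝ χ l)) := by
      intro h2
      have := hχs (tsupport_dbL_subset χ h2)
      simp at this; linarith
    have h2 : dbL (fderiv ℝ χ l) = 0 := image_eq_zero_of_notMem_tsupport (f := fun l => dbL (fderiv ℝ χ l)) h1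
    simp [hκdef, h2]
  have hκc : HasCompactSupport κ := by
    refine HasCompactSupport.intro (isCompact_closedBall (0:ℂ) ε) fun l hl => hκ0 l ?_
    simpa using hl
  have hK1 : Integrable (fun l => χ l / l) := by simpa using integrable_kernel χ hχ.continuous hχc 0
  have hK10 : ∀ l, l ∉ Metric.closedBall (0:ℂ) ε → χ l / l = 0 := by
    intro l hl
    rw [image_eq_zero_of_notMem_tsupport (fun h => hl (hχs h)), zero_div]
  -- the smooth part
  have hjc : ContinuousOn (fun p : ℂ × (Fin N → ℂ) => p.2 + eC N j p.1) (Metric.closedBall (0:ℂ) (2*ε) ×ˢ Metric.ball z0 (2*ε)) := by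
    fun_prop
  have hjm : MapsTo (fun p : ℂ × (Fin N → ℂ) => p.2 + eC N j p.1) (Metric.closedBall (0:ℂ) (2*ε) ×ˢ Metric.ball z0 (2*ε)) (Metric.closedBall z0 (4*ε)) := by
    rintro ⟨l, z⟩ ⟨hl, hz⟩
    exact hmem z hz l (by simpa using hl)
  have hsub : Metric.closedBall (0:ℂ) ε ⊆ Metric.closedBall (0:ℂ) (2*ε) := Metric.closedBall_subset_closedBall (by linarith)
  have hl2 : ∀ l ∈ Metric.closedBall (0:ℂ) ε, ‖l‖ ≤ 2 * ε := fun l hl => by simpa using hsub hl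
  obtain ⟨d1, d2, -⟩ := param_deriv (fun l => χ l / l) hK1 (Metric.closedBall 0 ε) Metric.isClosed_closedBall hK10
    (Metric.ball z0 (2*ε)) Metric.isOpen_ball (fun l z => h (z + eC N j l))
    (fun l z => fderiv ℝ h (z + eC N j l))
    ((hh.continuousOn.mono hball).comp (hjc.mono (prod_mono_left hsub)) (hjm.mono_left (prod_mono_left hsub)))
    bh (fun l hl z hz => hbh _ (hmem z hz l (hl2 l hl)))
    ((hhc'.mono hball).comp (hjc.mono (prod_mono_left hsub)) (hjm.mono_left (prod_mono_left hsub)))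
    bh' (fun l hl z hz => hbh' _ (hmem z hz l (hl2 l hl)))
    (fun l hl z hz => by
      have h1 := hball (hmem z hz l (hl2 l hl))
      have h2 := ((hh.differentiableOn (by norm_num)).differentiableAt (hΩ.mem_nhds h1)).hasFDerivAt
      have h3 : HasFDerivAt (fun z : Fin N → ℂ => z + eC N j l) (ContinuousLinearMap.id ℝ _) z :=
        (hasFDerivAt_id z).add_const _
      simpa using! h2.comp z h3)
  set Vf : (Fin N → ℂ) → ℂ := fun z => ∫ l, (χ l / l) • h (z + eC N j l) with hVf
  have hV' : ContinuousOn (fderiv ℝ Vf) (Metric.ball z0 (2*ε)) :=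
    d2.continuousOn_fderiv_of_isOpen Metric.isOpen_ball (by norm_num)
  have hid : ∀ z ∈ Metric.ball z0 (2*ε), u z = -(Real.pi:ℂ)⁻¹ * (Vf z + ∫ l, κ l * u (z + eC N j l)) := by
    intro z hz
    have hs : ∀ l ∈ tsupport χ, z + eC N j l ∈ Ω := fun l hl => hball (hmem z hz l (hl2 l (hχs hl)))
    have hzΩ : z ∈ Ω := by
      have := hball (hmem z hz 0 (by simpa using hε.le))
      simpa using this
    have h1 := hw z hzΩ χ hχ hχc hs
    simp only [add_div] at h1
    rw [integral_add (weak_integrable hΩ j hh.continuousOn z χ hχ.continuous hχc hs)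
      (weak_integrable hΩ j hu z _ (dbL_cont hχ) (dbL_compact hχc)
      (fun l hl => hs l (tsupport_dbL_subset χ hl))), hχ0, one_mul] at h1
    have h2 : Vf z + ∫ l, κ l * u (z + eC N j l) = -(Real.pi:ℂ) * u z := by
      rw [← h1, hVf]
      congr 1
      · refine integral_congr_ae (ae_of_all _ fun l => ?_)
        simp only [smul_eq_mul]; ring
      · refine integral_congr_ae (ae_of_all _ fun l => ?_)
        simp only [hκdef]; ring
    have hpi : (Real.pi : ℂ) ≠ 0 := by exact_mod_cast Real.pi_ne_zero
    rw [h2]; field_simp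
  let Kz : (Fin N → ℂ) → ℂ → ℂ := fun z => (Metric.closedBall (0:ℂ) (2*ε)).indicator (fun l => u (z + eC N j l))
  have hKz : ∀ z ∈ Metric.ball z0 (2*ε), Integrable (Kz z) := by
    intro z hz
    refine IntegrableOn.integrable_indicator ?_ Metric.isClosed_closedBall.measurableSet
    refine ContinuousOn.integrableOn_compact (isCompact_closedBall _ _) ?_
    exact (hu.mono hball).comp (by fun_prop) (fun l hl => hmem z hz l (by simpa using hl))
  have hconv : ∀ z ∈ Metric.ball z0 ε, HasFDerivAt (fun t => ∫ l, κ l * u (z + eC N j t + eC N j l))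
      (∫ l, Kz z l • (- fderiv ℝ κ l)) 0 := by
    intro z hz
    have hz2 : z ∈ Metric.ball z0 (2*ε) := Metric.ball_subset_ball (by linarith) hz
    refine (conv_deriv κ hκ hκc (Kz z) (hKz z hz2)).congr_of_eventuallyEq ?_
    filter_upwards [Metric.ball_mem_nhds (0:ℂ) hε] with t ht
    have ht : ‖t‖ < ε := by simpa using ht
    rw [← integral_sub_right_eq_self (fun l => κ l * u (z + eC N j t + eC N j l)) t]
    refine integral_congr_ae (ae_of_all _ fun l => ?_)
    have h1 : z + eC N j t + eC N j (l - t) = z + eC N j l := by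
      rw [map_sub]; abel
    simp only [h1, Kz]
    by_cases hl : l ∈ Metric.closedBall (0:ℂ) (2*ε)
    · simp only [indicator_of_mem hl, smul_eq_mul]; ring
    · have h2 : κ (l - t) = 0 := by
        refine hκ0 _ ?_
        have h3 : 2 * ε < ‖l‖ := by simpa using hl
        have := norm_sub_norm_le l t
        linarith
      simp [h2]
  refine ⟨ε, hε, fun z => -(Real.pi:ℂ)⁻¹ • ((fderiv ℝ Vf z).comp (eC N j) + ∫ l, Kz z l • (- fderiv ℝ κ l)), ?_, ?_⟩
  · refine ContinuousOn.mono ?_ (Metric.ball_subset_ball (x := z0) (by linarith : ε ≤ 2 * ε))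
    refine ContinuousOn.const_smul (ContinuousOn.add ?_ ?_) (-(Real.pi:ℂ)⁻¹)
    · exact hV'.clm_comp continuousOn_const
    · have hcd : Continuous (fderiv ℝ κ) := hκ.continuous_fderiv (by norm_num)
      obtain ⟨b', hb'⟩ := hcd.bounded_above_of_compact_support (hκc.fderiv ℝ)
      obtain ⟨-, h2, -⟩ := param_cont (F := ℂ →L[ℝ] ℂ) ((Metric.closedBall (0:ℂ) (2*ε)).indicator (fun _ => (1:ℂ)))
        (IntegrableOn.integrable_indicator (integrableOn_const (by exact (measure_closedBall_lt_top).ne)) Metric.isClosed_closedBall.measurableSet)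
        (Metric.closedBall (0:ℂ) (2*ε)) Metric.isClosed_closedBall (fun l hl => indicator_of_notMem hl _)
        (Metric.ball z0 (2*ε)) (fun l z => u (z + eC N j l) • (- fderiv ℝ κ l))
        (ContinuousOn.smul ((hu.mono hball).comp hjc hjm) ((hcd.comp continuous_fst).neg.continuousOn)) (bu * b')
        (fun l hl z hz => by
          rw [norm_smul, norm_neg]
          have h3 := hbu _ (hmem z hz l (by simpa using hl))
          exact mul_le_mul h3 (hb' l) (norm_nonneg _) ((norm_nonneg _).trans h3))
      refine h2.congr (fun z hz => ?_)
      refine integral_congr_ae (ae_of_all _ fun l => ?_)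
      simp only [Kz]
      by_cases hl : l ∈ Metric.closedBall (0:ℂ) (2*ε)
      · simp only [indicator_of_mem hl, one_smul]
      · simp only [indicator_of_notMem hl]
        ext x; simp
  · intro z hz
    have hz2 : z ∈ Metric.ball z0 (2*ε) := Metric.ball_subset_ball (by linarith) hz
    have h1 : HasFDerivAt (fun t : ℂ => Vf (z + eC N j t)) ((fderiv ℝ Vf z).comp (eC N j)) 0 := by
      have h2 : HasFDerivAt (fun t : ℂ => z + eC N j t) (eC N j) 0 := ((eC N j).hasFDerivAt).const_add z
      refine HasFDerivAt.comp (g := Vf) 0 ?_ h2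
      rw [map_zero, add_zero]
      exact (d1 z hz2).differentiableAt.hasFDerivAt
    have h3 := ((h1.add (hconv z hz)).const_smul (-(Real.pi:ℂ)⁻¹))
    refine h3.congr_of_eventuallyEq ?_
    filter_upwards [Metric.ball_mem_nhds (0:ℂ) hε] with t ht
    have ht : ‖t‖ < ε := by simpa using ht
    refine hid _ ?_
    rw [Metric.mem_ball, dist_eq_norm] at hz ⊢
    calc ‖z + eC N j t - z0‖ = ‖(z - z0) + eC N j t‖ := by congr 1; abel
      _ ≤ ‖z - z0‖ + ‖t‖ := by rw [← norm_eC j t]; exact norm_add_le _ _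
      _ < 2 * ε := by linarith

/-- `dbar` component of a real linear map -/
def dbj {N : ℕ} (j : Fin N) (L : (Fin N → ℂ) →L[ℝ] ℂ) : ℂ := dbL (L.comp (eC N j))

theorem weak_of_classical {N : ℕ} {Ω : Set (Fin N → ℂ)} (hΩ : IsOpen Ω) (j : Fin N)
    {u h : (Fin N → ℂ) → ℂ} (u' : (Fin N → ℂ) → (Fin N → ℂ) →L[ℝ] ℂ)
    (hu : ∀ z ∈ Ω, HasFDerivAt u (u' z) z) (hh : ContinuousOn h Ω)
    (hdb : ∀ z ∈ Ω, dbj j (u' z) = h z) : WeakDb Ω j u h := by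
  intro z hz χ hχ hχc hs
  have huc : ContinuousOn u Ω := fun z hz => (hu z hz).continuousAt.continuousWithinAt
  have := cp_loc χ (fun l => u (z + eC N j l)) (fun l => h (z + eC N j l))
    (fun l => (u' (z + eC N j l)).comp (eC N j)) {l : ℂ | z + eC N j l ∈ Ω} ∅ countable_empty
    (slice_open hΩ j z) hχ hχc hs (slice_contOn huc j z) (slice_contOn hh j z) ?_ ?_
  · simpa using this
  · intro l hl _
    have h2 : HasFDerivAt (fun t : ℂ => z + eC N j t) (eC N j) l := ((eC N j).hasFDerivAt).const_add z
    exact HasFDerivAt.comp (g := u) l (hu _ hl) h2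
  · intro l hl _
    exact hdb _ hl

theorem weak_regular {N : ℕ} {Ω : Set (Fin N → ℂ)} (hΩ : IsOpen Ω)
    {u : (Fin N → ℂ) → ℂ} {f : Fin N → (Fin N → ℂ) → ℂ} (hu : ContinuousOn u Ω)
    (hf : ∀ j, ContDiffOn ℝ 1 (f j) Ω)
    (hw : ∀ j, WeakDb Ω j u (f j)) :
    ContDiffOn ℝ 1 u Ω ∧ ∀ z ∈ Ω, ∀ j, dbj j (fderiv ℝ u z) = f j z := by
  have hloc : ContDiffOn ℝ 1 u Ω := by
    intro z0 hz0
    choose ε hε p hp hd using fun j => weak_partial hΩ j hu (hf j) (hw j) z0 hz0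
    let W : Set (Fin N → ℂ) := ⋂ j, Metric.ball z0 (ε j)
    have hW : IsOpen W := isOpen_iInter_of_finite fun j => Metric.isOpen_ball
    have hWs : ∀ j, W ⊆ Metric.ball z0 (ε j) := fun j => iInter_subset _ j
    have hz0W : z0 ∈ W := mem_iInter.2 fun j => Metric.mem_ball_self (hε j)
    have h1 := partials_C1 W hW u p (fun j => (hp j).mono (hWs j)) (fun j z hz => hd j z (hWs j hz))
    have h2 := contDiffOn_one_of hW h1 (by
      refine continuousOn_finset_sum _ fun j _ => ?_
      exact ((hp j).mono (hWs j)).clm_comp continuousOn_const)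
    exact (h2.contDiffAt (hW.mem_nhds hz0W)).contDiffWithinAt
  refine ⟨hloc, fun z hz j => ?_⟩
  have hd : ∀ z ∈ Ω, HasFDerivAt u (fderiv ℝ u z) z := fun z hz =>
    ((hloc.differentiableOn (by norm_num)).differentiableAt (hΩ.mem_nhds hz)).hasFDerivAt
  have hc : ContinuousOn (fun z => dbj j (fderiv ℝ u z)) Ω := by
    refine continuous_dbL.comp_continuousOn ?_
    exact (hloc.continuousOn_fderiv_of_isOpen hΩ (by norm_num)).clm_comp continuousOn_const
  exact weak_unique hΩ j hu hc (hf j).continuousOn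
    (weak_of_classical hΩ j _ hd hc fun _ _ => rfl) (hw j) z hz

open MeasureTheory in
theorem weak_of_dense {N : ℕ} {Ω : Set (Fin N → ℂ)} (hΩ : IsOpen Ω) (j : Fin N)
    {u h : (Fin N → ℂ) → ℂ} (hu : ContinuousOn u Ω) (hh : ContinuousOn h Ω) (b : ℝ)
    (hub : ∀ z ∈ Ω, ‖u z‖ ≤ b) (hhb : ∀ z ∈ Ω, ‖h z‖ ≤ b) (D : Set (Fin N → ℂ)) (hD : Dense D)
    (hw : ∀ z ∈ Ω, z ∈ D → ∀ χ : ℂ → ℂ, ContDiff ℝ 1 χ → HasCompactSupport χ →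
    (∀ l ∈ tsupport χ, z + eC N j l ∈ Ω) →
    ∫ l, (χ l * h (z + eC N j l) + dbL (fderiv ℝ χ l) * u (z + eC N j l)) / l =
      -(Real.pi : ℂ) * (χ 0 * u z)) : WeakDb Ω j u h := by
  intro z hz χ hχ hχc hs
  have hKc : IsCompact ((fun l => z + eC N j l) '' tsupport χ) := hχc.isCompact.image (by fun_prop)
  obtain ⟨δ, hδ, hδs⟩ := hKc.exists_thickening_subset_open hΩ (by rintro _ ⟨l, hl, rfl⟩; exact hs l hl)
  let W := Ω ∩ Metric.ball z δ
  have hW : IsOpen W := hΩ.inter Metric.isOpen_ball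
  have hzW : z ∈ W := ⟨hz, Metric.mem_ball_self hδ⟩
  have hWs : ∀ w ∈ W, ∀ l ∈ tsupport χ, w + eC N j l ∈ Ω := by
    intro w hw l hl
    refine hδs (Metric.mem_thickening_iff.2 ⟨_, ⟨l, hl, rfl⟩, ?_⟩)
    rw [dist_add_right]
    exact hw.2
  have hjc : ContinuousOn (fun p : ℂ × (Fin N → ℂ) => p.2 + eC N j p.1) (tsupport χ ×ˢ W) := by fun_prop
  have hjm : MapsTo (fun p : ℂ × (Fin N → ℂ) => p.2 + eC N j p.1) (tsupport χ ×ˢ W) Ω := by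
    rintro ⟨l, w⟩ ⟨hl, hw⟩
    exact hWs w hw l hl
  have hK1 : Integrable (fun l => χ l / l) := by simpa using integrable_kernel χ hχ.continuous hχc 0
  have hK2 : Integrable (fun l => dbL (fderiv ℝ χ l) / l) := by
    simpa using integrable_kernel _ (dbL_cont hχ) (dbL_compact hχc) 0
  obtain ⟨i1, c1, -⟩ := param_cont (fun l => χ l / l) hK1 (tsupport χ) (isClosed_tsupport _)
    (fun l hl => by rw [image_eq_zero_of_notMem_tsupport hl, zero_div]) W
    (fun l w => h (w + eC N j l)) (hh.comp hjc hjm) b (fun l hl w hw => hhb _ (hWs w hw l hl))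
  obtain ⟨i2, c2, -⟩ := param_cont (fun l => dbL (fderiv ℝ χ l) / l) hK2 (tsupport χ) (isClosed_tsupport _)
    (fun l hl => by
      have h1 : dbL (fderiv ℝ χ l) = 0 := image_eq_zero_of_notMem_tsupport (f := fun l => dbL (fderiv ℝ χ l))
        (fun h => hl (tsupport_dbL_subset χ h))
      rw [h1, zero_div]) W
    (fun l w => u (w + eC N j l)) (hu.comp hjc hjm) b (fun l hl w hw => hub _ (hWs w hw l hl))
  have hc : ContinuousOn (fun w => ∫ l, (χ l * h (w + eC N j l) + dbL (fderiv ℝ χ l) * u (w + eC N j l)) / l) W := by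
    refine (c1.add c2).congr fun w hw => ?_
    refine Eq.trans ?_ (integral_add (i1 w hw) (i2 w hw))
    refine integral_congr_ae (ae_of_all _ fun l => ?_)
    simp only [smul_eq_mul]; ring
  have hc2 : ContinuousOn (fun w => -(Real.pi : ℂ) * (χ 0 * u w)) W := by
    have := hu.mono (inter_subset_left : W ⊆ Ω)
    fun_prop
  have heq : EqOn (fun w => ∫ l, (χ l * h (w + eC N j l) + dbL (fderiv ℝ χ l) * u (w + eC N j l)) / l)
     (fun w => -(Real.pi : ℂ) * (χ 0 * u w)) (W ∩ D) := by
    intro w hw'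
    exact hw w hw'.1.1 hw'.2 χ hχ hχc (hWs w hw'.1)
  exact heq.of_subset_closure hc hc2 inter_subset_left (hD.open_subset_closure_inter hW) hzW

theorem dense_nonzero (N : ℕ) : Dense {z : Fin N → ℂ | ∀ i, z i ≠ 0} := by
  have := dense_pi (I := (univ : Set (Fin N))) (s := fun _ => ({0}ᶜ : Set ℂ)) (fun _ _ => dense_compl_singleton 0)
  convert this using 1
  ext z; simp

/-- the l¹ ball -/
def Bl (N : ℕ) (r : ℝ) : Set (Fin N → ℂ) := {z | ∑ i, ‖z i‖ < r}

theorem isOpen_Bl (N : ℕ) (r : ℝ) : IsOpen (Bl N r) :=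
  isOpen_lt (by fun_prop) continuous_const

theorem Bl_mono {N : ℕ} {r R : ℝ} (h : r ≤ R) : Bl N r ⊆ Bl N R := fun _ hz => lt_of_lt_of_le hz h

theorem compact_cBl (N : ℕ) (r : ℝ) : IsCompact {z : Fin N → ℂ | ∑ i, ‖z i‖ ≤ r} := by
  refine (isCompact_closedBall (0 : Fin N → ℂ) r).of_isClosed_subset ?_ ?_
  · exact isClosed_le (by fun_prop) continuous_const
  · intro z hz
    have hz : ∑ i, ‖z i‖ ≤ r := hz
    have h0 : 0 ≤ r := (Finset.sum_nonneg fun i _ => norm_nonneg _).trans hz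
    rw [mem_closedBall_zero_iff, pi_norm_le_iff_of_nonneg h0]
    intro i
    exact (Finset.single_le_sum (f := fun i => ‖z i‖) (fun i _ => norm_nonneg _) (Finset.mem_univ i)).trans hz

/-- closed C¹ forms -/
def ClosedF {N : ℕ} (R : ℝ) (f : Fin N → (Fin N → ℂ) → ℂ) : Prop :=
  (∀ i, ContDiffOn ℝ 1 (f i) (Bl N R)) ∧
  ∀ z ∈ Bl N R, ∀ i j, dbj i (fderiv ℝ (f j) z) = dbj j (fderiv ℝ (f i) z)

/-- scaling of a coordinate -/
def sc {N : ℕ} (j : Fin N) (a : ℂ) (z : Fin N → ℂ) : Fin N → ℂ := fun i => if i = j then a * z i else z i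

/-- homogeneity in one coordinate -/
def Mode {N : ℕ} (R : ℝ) (m : ℕ) (i : Fin N) (f : Fin N → (Fin N → ℂ) → ℂ) : Prop :=
  ∀ a : ℂ, ‖a‖ = 1 → ∀ l, ∀ z ∈ Bl N R, f l (sc i a z) = a ^ m * (if l = i then a else 1) * f l z

theorem exists_p (N : ℕ) (r R : ℝ) (hr : 0 < r) (hrR : r < R) (k : Fin N → ℕ) :
    ∃ p : Fin N → ℝ, (∀ j, 0 < p j) ∧ ∑ j, p j < R ∧ ∀ x : Fin N → ℝ, (∀ j, 0 ≤ x j) → ∑ j, x j < r →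
      ∑ j, (k j : ℝ) * ((x j - p j) / p j) ≤ 0 := by
  set m : ℝ := ∑ j, (k j : ℝ) with hm
  set δ : ℝ := (R - r) / (2 * (N + 1)) with hδ
  have hδ0 : 0 < δ := by
    rw [hδ]; apply div_pos <;> [linarith; positivity]
  have hm0 : 0 ≤ m := Finset.sum_nonneg fun _ _ => by positivity
  have hp0 : ∀ j, 0 < r * k j / m + δ := fun j => by positivity
  refine ⟨fun j => r * k j / m + δ, hp0, ?_, ?_⟩
  · rw [Finset.sum_add_distrib, ← Finset.sum_div, ← Finset.mul_sum, ← hm]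
    have h1 : r * m / m ≤ r := by
      rcases hm0.eq_or_lt with h | h
      · rw [← h]; simpa using hr.le
      · rw [mul_div_assoc, div_self h.ne', mul_one]
    have h2 : ∑ _j : Fin N, δ < R - r := by
      simp only [Finset.sum_const, Finset.card_univ, Fintype.card_fin, nsmul_eq_mul]
      rw [hδ, mul_div_assoc', div_lt_iff₀ (by positivity)]
      nlinarith
    linarith
  · intro x hx hxs
    have h1 : ∀ j, (k j : ℝ) * ((x j - (r * k j / m + δ)) / (r * k j / m + δ)) ≤ m / r * x j - k j := by
      intro j
      rw [sub_div, div_self (hp0 j).ne', mul_sub, mul_one]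
      refine sub_le_sub_right ?_ _
      rw [mul_div_assoc', div_le_iff₀ (hp0 j)]
      have h3 : (k j : ℝ) ≤ m := Finset.single_le_sum (f := fun j => (k j : ℝ)) (fun _ _ => by positivity) (Finset.mem_univ j)
      rcases hm0.eq_or_lt with h | h
      · have : (k j : ℝ) = 0 := le_antisymm (by linarith) (by positivity)
        rw [this, ← h]; simp
      · have h4 : m / r * x j * (r * k j / m + δ) = k j * x j + m / r * x j * δ := by
          field_simp
        rw [h4]
        have : 0 ≤ m / r * x j * δ := by have := hx j; positivity
        linarith
    refine (Finset.sum_le_sum fun j _ => h1 j).trans ?_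
    rw [Finset.sum_sub_distrib, ← Finset.mul_sum, ← hm]
    have : m / r * ∑ j, x j ≤ m / r * r := mul_le_mul_of_nonneg_left hxs.le (by positivity)
    rw [div_mul_cancel₀ _ hr.ne'] at this
    linarith

theorem prod_ratio_le (N : ℕ) (k : Fin N → ℕ) (p x : Fin N → ℝ) (hp : ∀ j, 0 < p j) (hx : ∀ j, 0 ≤ x j)
    (h : ∑ j, (k j : ℝ) * ((x j - p j) / p j) ≤ 0) (t : ℝ) (ht0 : 0 ≤ t) (ht1 : t < 1) :
    ∏ j, (x j / ((1 - t) * p j + t * x j)) ^ k j ≤ 1 := by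
  have hy : ∀ j, 0 < (1 - t) * p j + t * x j := fun j => by
    have h1 := mul_pos (sub_pos.2 ht1) (hp j)
    have h2 := mul_nonneg ht0 (hx j)
    linarith
  have h1 : ∀ j, (x j / ((1 - t) * p j + t * x j)) ^ k j ≤ Real.exp ((1 - t) * (k j * ((x j - p j) / p j))) := by
    intro j
    set y := (1 - t) * p j + t * x j with hydef
    have h2 : x j / y ≤ Real.exp (x j / y - 1) := by
      have := Real.add_one_le_exp (x j / y - 1)
      linarith
    have h3 : (x j / y) ^ k j ≤ Real.exp (k j * (x j / y - 1)) := by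
      rw [Real.exp_nat_mul]
      exact pow_le_pow_left₀ (div_nonneg (hx j) (hy j).le) h2 _
    refine h3.trans (Real.exp_le_exp.2 ?_)
    rw [mul_left_comm]
    refine mul_le_mul_of_nonneg_left ?_ (by positivity)
    have hyj := hy j
    have hpj := hp j
    have h4 : x j / y - 1 = (1 - t) * ((x j - p j) / y) := by
      have hy0 : y ≠ 0 := hyj.ne'
      rw [div_sub_one hy0, mul_div_assoc']
      congr 1
      rw [hydef]; ring
    rw [h4]
    refine mul_le_mul_of_nonneg_left ?_ (by linarith)
    rw [div_le_div_iff₀ hyj hpj]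
    have : (x j - p j) * y - (x j - p j) * p j = t * (x j - p j)^2 := by rw [hydef]; ring
    nlinarith [mul_nonneg ht0 (sq_nonneg (x j - p j))]
  refine (Finset.prod_le_prod (fun j _ => pow_nonneg (div_nonneg (hx j) (hy j).le) _) fun j _ => h1 j).trans ?_
  rw [← Real.exp_sum, ← Finset.mul_sum]
  rw [Real.exp_le_one_iff]
  exact mul_nonpos_of_nonneg_of_nonpos (by linarith) h

/-- real points -/
def cr (N : ℕ) : (Fin N → ℝ) →L[ℝ] (Fin N → ℂ) :=
  ContinuousLinearMap.pi fun i => Complex.ofRealCLM.comp (ContinuousLinearMap.proj i)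

theorem cr_apply {N : ℕ} (x : Fin N → ℝ) (i : Fin N) : cr N x i = (x i : ℂ) := rfl

/-- positive real points of the ball -/
def Dp (N : ℕ) (R : ℝ) : Set (Fin N → ℝ) := {x | (∀ i, 0 < x i) ∧ ∑ i, x i < R}

theorem cr_mem {N : ℕ} {R : ℝ} {x : Fin N → ℝ} (hx : x ∈ Dp N R) : cr N x ∈ Bl N R := by
  have : ∑ i, ‖cr N x i‖ = ∑ i, x i := by
    refine Finset.sum_congr rfl fun i _ => ?_
    rw [cr_apply, Complex.norm_real, Real.norm_of_nonneg (hx.1 i).le]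
  simpa [Bl, this] using hx.2

theorem isOpen_Dp (N : ℕ) (R : ℝ) : IsOpen (Dp N R) := by
  have h1 : IsOpen {x : Fin N → ℝ | ∀ i, 0 < x i} := by
    have h0 : {x : Fin N → ℝ | ∀ i, 0 < x i} = ⋂ i, {x | 0 < x i} := by ext; simp
    rw [h0]
    exact isOpen_iInter_of_finite fun i => isOpen_lt continuous_const (continuous_apply i)
  exact h1.inter (isOpen_lt (f := fun x : Fin N → ℝ => ∑ i, x i) (by fun_prop) continuous_const)

theorem convex_Dp (N : ℕ) (R : ℝ) : Convex ℝ (Dp N R) := by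
  rw [convex_iff_forall_pos]
  intro x hx y hy a b ha hb hab
  refine ⟨fun i => ?_, ?_⟩
  · have := mul_pos ha (hx.1 i); have := mul_pos hb (hy.1 i)
    simp only [Pi.add_apply, Pi.smul_apply, smul_eq_mul]; linarith
  · simp only [Pi.add_apply, Pi.smul_apply, smul_eq_mul, Finset.sum_add_distrib, ← Finset.mul_sum]
    have h1 := mul_lt_mul_of_pos_left hx.2 ha
    have h2 := mul_lt_mul_of_pos_left hy.2 hb
    calc _ < a * R + b * R := add_lt_add h1 h2
      _ = R := by rw [← add_mul, hab, one_mul]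

theorem mode_deriv {N : ℕ} {R : ℝ} {f : Fin N → (Fin N → ℂ) → ℂ} (hf : ∀ i, ContDiffOn ℝ 1 (f i) (Bl N R))
    {m : ℕ} {i : Fin N} (hm : Mode R m i f) (j : Fin N) (z : Fin N → ℂ) (hz : z ∈ Bl N R) :
    fderiv ℝ (f j) z (eC N i (Complex.I * z i)) =
      Complex.I * (m + if j = i then 1 else 0) * f j z := by
  have h1 : HasDerivAt (fun θ : ℝ => Complex.exp (θ * Complex.I)) Complex.I 0 := by
    have h2 : HasDerivAt (fun θ : ℝ => (θ : ℂ) * Complex.I) (1 * Complex.I) 0 :=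
      (Complex.ofRealCLM.hasDerivAt (x := (0:ℝ))).mul_const Complex.I
    have := h2.cexp
    simpa using this
  have h3 : HasDerivAt (fun θ : ℝ => z + eC N i ((Complex.exp (θ * Complex.I) - 1) * z i))
      (eC N i (Complex.I * z i)) 0 := by
    have h4 := ((h1.sub_const 1).mul_const (z i))
    have h5 := ((eC N i).hasFDerivAt.comp_hasDerivAt (0:ℝ) h4).const_add z
    exact h5
  have hfd : HasFDerivAt (f j) (fderiv ℝ (f j) z) z :=
    (((hf j).differentiableOn (by norm_num)).differentiableAt ((isOpen_Bl N R).mem_nhds hz)).hasFDerivAt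
  have h6 : HasDerivAt (fun θ : ℝ => f j (z + eC N i ((Complex.exp (θ * Complex.I) - 1) * z i)))
      (fderiv ℝ (f j) z (eC N i (Complex.I * z i))) 0 := by
    refine HasFDerivAt.comp_hasDerivAt (l := f j) (0:ℝ) ?_ h3
    simpa using hfd
  have h7 : (fun θ : ℝ => f j (z + eC N i ((Complex.exp (θ * Complex.I) - 1) * z i))) =
      fun θ : ℝ => Complex.exp (θ * Complex.I) ^ (m + if j = i then 1 else 0) * f j z := by
    ext θ
    have h8 := hm (Complex.exp (θ * Complex.I)) (Complex.norm_exp_ofReal_mul_I θ) j z hz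
    have h9 : z + eC N i ((Complex.exp (θ * Complex.I) - 1) * z i) = sc i (Complex.exp (θ * Complex.I)) z := by
      ext l
      rw [eC_apply]
      by_cases hl : l = i
      · subst hl; simp [sc]; ring
      · simp [sc, hl]
    rw [h9, h8, pow_add]
    split_ifs <;> simp
  rw [h7] at h6
  have h10 := (h1.pow (m + if j = i then 1 else 0)).mul_const (f j z)
  have := h6.unique h10
  have h11 : Complex.exp (((0:ℝ):ℂ) * Complex.I) = 1 := by simp
  rw [this, h11, one_pow]
  push_cast
  ring

/-- the real monomial -/
def Qm {N : ℕ} (k : Fin N → ℕ) (x : Fin N → ℝ) : ℂ := ∏ i, (x i : ℂ) ^ k i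

theorem Qm_ne {N : ℕ} {R : ℝ} (k : Fin N → ℕ) {x : Fin N → ℝ} (hx : x ∈ Dp N R) : Qm k x ≠ 0 := by
  refine Finset.prod_ne_zero_iff.2 fun i _ => pow_ne_zero _ ?_
  exact_mod_cast (hx.1 i).ne'

/-- coefficients of the potential -/
def gm {N : ℕ} (f : Fin N → (Fin N → ℂ) → ℂ) (k : Fin N → ℕ) (j : Fin N) (x : Fin N → ℝ) : ℂ :=
  2 * f j (cr N x) / Qm k x

theorem gm_diff {N : ℕ} {R : ℝ} {f : Fin N → (Fin N → ℂ) → ℂ} (hf : ∀ i, ContDiffOn ℝ 1 (f i) (Bl N R))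
    (k : Fin N → ℕ) (j : Fin N) {x : Fin N → ℝ} (hx : x ∈ Dp N R) : DifferentiableAt ℝ (gm f k j) x := by
  have hfd : DifferentiableAt ℝ (f j) (cr N x) :=
    (((hf j).differentiableOn (by norm_num)).differentiableAt ((isOpen_Bl N R).mem_nhds (cr_mem hx)))
  have h1 : DifferentiableAt ℝ (fun x => f j (cr N x)) x := hfd.comp x (cr N).differentiableAt
  have h2 : DifferentiableAt ℝ (fun x : Fin N → ℝ => Qm k x) x := by
    unfold Qm
    have h3 : ∀ i ∈ (Finset.univ : Finset (Fin N)), DifferentiableAt ℝ (fun x : Fin N → ℝ => (x i : ℂ) ^ k i) x := by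
      intro i _
      refine DifferentiableAt.fun_pow ?_ _
      exact Complex.ofRealCLM.differentiableAt.comp x (differentiableAt_apply (𝕜 := ℝ) i x)
    exact (HasFDerivAt.finsetProd fun i hi => (h3 i hi).hasFDerivAt).differentiableAt
  unfold gm
  simp only [div_eq_mul_inv]
  exact (h1.const_mul 2).mul (h2.inv (Qm_ne k hx))

theorem gm_deriv {N : ℕ} {R : ℝ} {f : Fin N → (Fin N → ℂ) → ℂ} (hf : ∀ i, ContDiffOn ℝ 1 (f i) (Bl N R))
    {k : Fin N → ℕ} {i j : Fin N} (hij : i ≠ j) (hm : Mode R (k i) i f) {x : Fin N → ℝ} (hx : x ∈ Dp N R) :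
    fderiv ℝ (gm f k j) x (Pi.single i 1) = 4 * dbj i (fderiv ℝ (f j) (cr N x)) / Qm k x := by
  have hxi : (x i : ℂ) ≠ 0 := by exact_mod_cast (hx.1 i).ne'
  have hQ := Qm_ne k hx
  have h0 := mode_deriv hf hm j (cr N x) (cr_mem hx)
  have hfd : HasFDerivAt (f j) (fderiv ℝ (f j) (cr N x)) (cr N x) :=
    (((hf j).differentiableOn (by norm_num)).differentiableAt ((isOpen_Bl N R).mem_nhds (cr_mem hx))).hasFDerivAt
  have hl : HasDerivAt (fun s : ℝ => x + s • Pi.single i (x i)) (Pi.single i (x i)) 0 := by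
    have := ((hasDerivAt_id (0:ℝ)).smul_const (Pi.single i (x i) : Fin N → ℝ)).const_add x
    simpa using this
  have h1 : HasDerivAt (fun s : ℝ => gm f k j (x + s • Pi.single i (x i))) (fderiv ℝ (gm f k j) x (Pi.single i (x i))) 0 := by
    refine HasFDerivAt.comp_hasDerivAt (l := gm f k j) (0:ℝ) ?_ hl
    simpa using (gm_diff hf k j hx).hasFDerivAt
  have h2 : HasDerivAt (fun s : ℝ => f j (cr N (x + s • Pi.single i (x i)))) (fderiv ℝ (f j) (cr N x) (cr N (Pi.single i (x i)))) 0 := by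
    refine HasFDerivAt.comp_hasDerivAt (l := f j) (0:ℝ) ?_ ((cr N).hasFDerivAt.comp_hasDerivAt (0:ℝ) hl)
    simpa using hfd
  have h3 : ∀ s : ℝ, Qm k (x + s • Pi.single i (x i)) = (1 + (s:ℂ)) ^ k i * Qm k x := by
    intro s
    unfold Qm
    have h4 : (1 + (s:ℂ)) ^ k i = ∏ l, (if l = i then (1 + (s:ℂ)) ^ k l else 1) := by
      rw [Finset.prod_ite_eq' Finset.univ i]; simp
    rw [h4, ← Finset.prod_mul_distrib]
    refine Finset.prod_congr rfl fun l _ => ?_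
    by_cases hl : l = i
    · subst hl; simp only [if_true, ← mul_pow]; congr 1; simp; ring
    · simp [hl]
  have h5 : HasDerivAt (fun s : ℝ => (1 + (s:ℂ)) ^ k i * Qm k x) (k i * Qm k x) 0 := by
    have h6 : HasDerivAt (fun s : ℝ => 1 + (s:ℂ)) 1 0 := (Complex.ofRealCLM.hasDerivAt (x := (0:ℝ))).const_add 1
    have := (h6.pow (k i)).mul_const (Qm k x)
    simpa using! this
  have h7 := (h2.const_mul 2).div h5 (by simpa using hQ)
  have h8 := h1.unique (h7.congr_of_eventuallyEq (Filter.Eventually.of_forall fun s => by simp [gm, h3]))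
  have e1 : (Pi.single i (x i) : Fin N → ℝ) = x i • Pi.single i 1 := by
    rw [← Pi.single_smul]; simp
  have e2 : cr N (Pi.single i (x i)) = x i • eC N i 1 := by
    ext l
    rw [cr_apply, eC_apply]
    by_cases hl : l = i
    · subst hl; simp
    · simp [hl]
  have e3 : eC N i (Complex.I * cr N x i) = x i • eC N i Complex.I := by
    rw [← map_smul, cr_apply]; congr 1; rw [Complex.real_smul]; ring
  rw [e3, map_smul, Complex.real_smul, if_neg (Ne.symm hij)] at h0
  rw [e2, e1, map_smul, map_smul, Complex.real_smul, Complex.real_smul] at h8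
  simp only [Complex.ofReal_zero, add_zero, one_pow, one_mul, zero_smul] at h8 h0
  unfold dbj dbL
  simp only [ContinuousLinearMap.comp_apply]
  rw [eq_div_iff (pow_ne_zero 2 hQ)] at h8
  rw [eq_div_iff hQ]
  set A := fderiv ℝ (f j) (cr N x) (eC N i 1)
  set B := fderiv ℝ (f j) (cr N x) (eC N i Complex.I)
  set G := fderiv ℝ (gm f k j) x (Pi.single i 1)
  have : (x i : ℂ) * Qm k x * (G * Qm k x - 4 * ((A + Complex.I * B)/2)) = 0 := by
    linear_combination h8 - 2 * Qm k x * Complex.I * h0 - 2 * Qm k x * k i * f j (cr N x) * Complex.I_sq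
  have h9 := (mul_eq_zero.1 this).resolve_left (mul_ne_zero hxi hQ)
  exact sub_eq_zero.1 h9

theorem exists_potential {N : ℕ} {R : ℝ} {f : Fin N → (Fin N → ℂ) → ℂ} (hf : ClosedF R f)
    {k : Fin N → ℕ} (hm : ∀ i, Mode R (k i) i f) :
    ∃ a : (Fin N → ℝ) → ℂ, ∀ x ∈ Dp N R, HasFDerivAt a
      (∑ j, gm f k j x • Complex.ofRealCLM.comp (ContinuousLinearMap.proj (R := ℝ) (φ := fun _ : Fin N => ℝ) j)) x := by
  let c : Fin N → (Fin N → ℝ) →L[ℝ] ℂ := fun j =>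
    Complex.ofRealCLM.comp (ContinuousLinearMap.proj (R := ℝ) (φ := fun _ : Fin N => ℝ) j)
  let ω : (Fin N → ℝ) → (Fin N → ℝ) →L[ℝ] ℂ := fun x => ∑ j, gm f k j x • c j
  have hω : ∀ x ∈ Dp N R, HasFDerivAt ω (∑ j, (fderiv ℝ (gm f k j) x).smulRight (c j)) x := by
    intro x hx
    refine HasFDerivAt.fun_sum fun j _ => ?_
    exact (gm_diff hf.1 k j hx).hasFDerivAt.smul_const (c j)
  refine (convex_Dp N R).exists_forall_hasFDerivAt_of_fderiv_symmetric (isOpen_Dp N R) (ω := ω)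
    (fun x hx => (hω x hx).differentiableAt.differentiableWithinAt) ?_
  intro a ha x y
  have hexp : ∀ x y : Fin N → ℝ, (∑ j, (fderiv ℝ (gm f k j) a).smulRight (c j)) x y =
      ∑ j, ∑ i, (x i : ℂ) * (y j : ℂ) * fderiv ℝ (gm f k j) a (Pi.single i 1) := by
    intro x y
    rw [sum_apply, sum_apply]
    refine Finset.sum_congr rfl fun j _ => ?_
    have : fderiv ℝ (gm f k j) a x = ∑ i, (x i : ℂ) * fderiv ℝ (gm f k j) a (Pi.single i 1) := by
      conv_lhs => rw [← Finset.univ_sum_single x, map_sum]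
      refine Finset.sum_congr rfl fun i _ => ?_
      have e1 : (Pi.single i (x i) : Fin N → ℝ) = x i • Pi.single i 1 := by
        rw [← Pi.single_smul]; simp
      rw [e1, map_smul, Complex.real_smul]
    simp only [ContinuousLinearMap.smulRight_apply, this]
    change (∑ i, _) * (y j : ℂ) = _
    rw [Finset.sum_mul]
    refine Finset.sum_congr rfl fun i _ => by ring
  rw [(hω a ha).fderiv, hexp, hexp, Finset.sum_comm]
  refine Finset.sum_congr rfl fun i _ => Finset.sum_congr rfl fun j _ => ?_
  by_cases hij : i = j
  · subst hij; ring
  · rw [gm_deriv hf.1 hij (hm i) ha, gm_deriv hf.1 (Ne.symm hij) (hm j) ha, hf.2 _ (cr_mem ha) i j]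
    ring

/-- coordinatewise absolute values -/
def nrm {N : ℕ} (z : Fin N → ℂ) : Fin N → ℝ := fun i => ‖z i‖

theorem mode_full {N : ℕ} {R : ℝ} {f : Fin N → (Fin N → ℂ) → ℂ}
    {k : Fin N → ℕ} (hm : ∀ i, Mode R (k i) i f) (j : Fin N) {w : Fin N → ℂ} (hw : w ∈ Bl N R)
    (hw0 : ∀ i, w i ≠ 0) :
    f j w = (∏ i, (w i / (‖w i‖ : ℂ)) ^ k i) * (w j / (‖w j‖ : ℂ)) * f j (cr N (nrm w)) := by
  classical
  have hn : ∀ i, (‖w i‖ : ℂ) ≠ 0 := fun i => by exact_mod_cast (norm_ne_zero_iff.2 (hw0 i))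
  let ws : Finset (Fin N) → Fin N → ℂ := fun s i => if i ∈ s then w i else (‖w i‖ : ℂ)
  have hws : ∀ s, ws s ∈ Bl N R := by
    intro s
    have : ∑ i, ‖ws s i‖ = ∑ i, ‖w i‖ := by
      refine Finset.sum_congr rfl fun i _ => ?_
      simp only [ws]; split_ifs <;> simp
    simpa [Bl, this] using hw
  have key : ∀ s, f j (ws s) = (∏ i ∈ s, ((w i / (‖w i‖ : ℂ)) ^ k i * (if j = i then w i / (‖w i‖ : ℂ) else 1))) *
      f j (cr N (nrm w)) := by
    intro s
    induction s using Finset.induction_on with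
    | empty =>
      simp only [Finset.prod_empty, one_mul]
      congr 1
    | insert i s hi ih =>
      have h1 : ws (insert i s) = sc i (w i / (‖w i‖ : ℂ)) (ws s) := by
        ext l
        by_cases hl : l = i
        · subst hl; simp [ws, sc, hi]; rw [div_mul_cancel₀ _ (hn l)]
        · simp [ws, sc, hl]
      have h2 := hm i (w i / (‖w i‖ : ℂ)) (by rw [norm_div, Complex.norm_real, norm_norm, div_self (norm_ne_zero_iff.2 (hw0 i))]) j _ (hws s)
      rw [h1, h2, ih, Finset.prod_insert hi]; ring
  have h3 := key Finset.univ
  have h4 : ws Finset.univ = w := by ext i; simp [ws]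
  rw [h4, Finset.prod_mul_distrib] at h3
  simpa using h3

theorem norm_fderiv {w : ℂ} (hw : w ≠ 0) : ∃ L : ℂ →L[ℝ] ℝ, HasFDerivAt (fun x : ℂ => ‖x‖) L w ∧
    ((L 1 : ℂ) + Complex.I * (L Complex.I : ℂ)) / 2 = w / (2 * (‖w‖ : ℂ)) := by
  have h1 := (hasStrictFDerivAt_norm_sq w).hasFDerivAt.sqrt (by positivity)
  refine ⟨_, h1.congr_of_eventuallyEq (Filter.Eventually.of_forall fun x => ?_), ?_⟩
  · simp [Real.sqrt_sq]
  · have h0 : (‖w‖ : ℂ) ≠ 0 := by exact_mod_cast (norm_ne_zero_iff.2 hw)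
    simp only [Real.sqrt_sq (norm_nonneg w), smul_apply, innerSL_apply_apply,
      Complex.inner, smul_eq_mul]
    have h2 : ((1 : ℂ) * (starRingEnd ℂ) w).re = w.re := by simp
    have h3 : ((starRingEnd ℂ) w * (1:ℂ)).re = w.re := by simp
    have h4 : ((starRingEnd ℂ) w * Complex.I).re = w.im := by simp
    have h5 : (Complex.I * (starRingEnd ℂ) w).re = w.im := by simp
    simp only [h2, h3, h4, h5]
    push_cast
    simp only [nsmul_eq_mul]
    push_cast
    field_simp
    conv_rhs => rw [← Complex.re_add_im w]
    ring

/-- the path -/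
def yp {N : ℕ} (p : Fin N → ℝ) (t : ℝ) (z : Fin N → ℂ) : Fin N → ℝ := fun i => (1 - t) * p i + t * ‖z i‖

/-- the integrand -/
def Jp {N : ℕ} (f : Fin N → (Fin N → ℂ) → ℂ) (k : Fin N → ℕ) (p : Fin N → ℝ) (t : ℝ) (z : Fin N → ℂ) : ℂ :=
  (∏ i, (z i / (yp p t z i : ℂ)) ^ k i) * ∑ i, 2 * f i (cr N (yp p t z)) * ((‖z i‖ - p i : ℝ) : ℂ)

theorem yp_mem {N : ℕ} {r R : ℝ} {p : Fin N → ℝ} (hp : ∀ i, 0 < p i) (hpR : ∑ i, p i < R) (hrR : r < R)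
    {t : ℝ} (ht0 : 0 ≤ t) (ht1 : t < 1) {z : Fin N → ℂ} (hz : z ∈ Bl N r) : yp p t z ∈ Dp N R := by
  have hz : ∑ i, ‖z i‖ < r := hz
  refine ⟨fun i => ?_, ?_⟩
  · have h1 := mul_pos (sub_pos.2 ht1) (hp i)
    have h2 := mul_nonneg ht0 (norm_nonneg (z i))
    unfold yp; linarith
  · unfold yp
    rw [Finset.sum_add_distrib, ← Finset.mul_sum, ← Finset.mul_sum]
    have h1 := mul_lt_mul_of_pos_left hpR (sub_pos.2 ht1)
    have h2 := mul_le_mul_of_nonneg_left (hz.trans hrR).le ht0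
    nlinarith

theorem Jp_bound {N : ℕ} {r R b : ℝ} (hb0 : 0 ≤ b) {f : Fin N → (Fin N → ℂ) → ℂ} {k : Fin N → ℕ} {p : Fin N → ℝ}
    (hp : ∀ i, 0 < p i) (hpR : ∑ i, p i < R) (hrR : r < R)
    (hpk : ∀ x : Fin N → ℝ, (∀ j, 0 ≤ x j) → ∑ j, x j < r → ∑ j, (k j : ℝ) * ((x j - p j) / p j) ≤ 0)
    (hb : ∀ i, ∀ z ∈ Bl N R, ‖f i z‖ ≤ b)
    {t : ℝ} (ht0 : 0 ≤ t) (ht1 : t < 1) {z : Fin N → ℂ} (hz : z ∈ Bl N r) : ‖Jp f k p t z‖ ≤ 4 * R * b := by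
  have hy := yp_mem hp hpR hrR ht0 ht1 hz
  have h1 : ‖∏ i, (z i / (yp p t z i : ℂ)) ^ k i‖ ≤ 1 := by
    rw [norm_prod]
    refine le_trans (le_of_eq ?_) (prod_ratio_le N k p (fun i => ‖z i‖) hp (fun i => norm_nonneg _)
      (hpk _ (fun i => norm_nonneg _) hz) t ht0 ht1)
    refine Finset.prod_congr rfl fun i _ => ?_
    rw [norm_pow, norm_div, Complex.norm_real, Real.norm_of_nonneg (hy.1 i).le]
    rfl
  have h2 : ‖∑ i, 2 * f i (cr N (yp p t z)) * ((‖z i‖ - p i : ℝ) : ℂ)‖ ≤ 4 * R * b := by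
    have h3 : ∀ i ∈ (Finset.univ : Finset (Fin N)), ‖2 * f i (cr N (yp p t z)) * ((‖z i‖ - p i : ℝ) : ℂ)‖ ≤ 2 * b * (‖z i‖ + p i) := by
      intro i _
      rw [norm_mul, norm_mul, Complex.norm_real]
      have h4 := hb i _ (cr_mem hy)
      have h5 : ‖(‖z i‖ - p i : ℝ)‖ ≤ ‖z i‖ + p i := by
        rw [Real.norm_eq_abs, abs_le]
        have := hp i; have := norm_nonneg (z i)
        constructor <;> linarith
      have h6 : ‖(2:ℂ)‖ = 2 := by simp
      rw [h6]
      refine mul_le_mul (by linarith) h5 (norm_nonneg _) (by positivity)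
    refine (norm_sum_le_of_le _ h3).trans ?_
    rw [← Finset.mul_sum, Finset.sum_add_distrib]
    have hz : ∑ i, ‖z i‖ < r := hz
    nlinarith
  unfold Jp
  rw [norm_mul]
  calc _ ≤ 1 * (4 * R * b) := mul_le_mul h1 h2 (norm_nonneg _) (by norm_num)
    _ = _ := one_mul _

theorem Jp_cont {N : ℕ} {r R : ℝ} {f : Fin N → (Fin N → ℂ) → ℂ} {k : Fin N → ℕ} {p : Fin N → ℝ}
    (hp : ∀ i, 0 < p i) (hpR : ∑ i, p i < R) (hrR : r < R)
    (hf : ∀ i, ContinuousOn (f i) (Bl N R)) :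
    ContinuousOn (fun q : ℝ × (Fin N → ℂ) => Jp f k p q.1 q.2) (Ico 0 1 ×ˢ Bl N r) := by
  have hy : Continuous (fun q : ℝ × (Fin N → ℂ) => yp p q.1 q.2) := by
    unfold yp; fun_prop
  have hyi : ∀ i, Continuous (fun q : ℝ × (Fin N → ℂ) => (yp p q.1 q.2 i : ℂ)) := fun i =>
    Complex.continuous_ofReal.comp ((continuous_apply i).comp hy)
  unfold Jp
  refine ContinuousOn.mul ?_ ?_
  · refine continuousOn_finsetProd _ fun i _ => ContinuousOn.pow ?_ _
    refine ContinuousOn.div (by fun_prop) (hyi i).continuousOn ?_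
    rintro ⟨t, z⟩ ⟨ht, hz⟩
    exact_mod_cast ((yp_mem hp hpR hrR ht.1 ht.2 hz).1 i).ne'
  · refine continuousOn_finsetSum _ fun i _ => ContinuousOn.mul (continuousOn_const.mul ?_) ?_
    · refine (hf i).comp ((cr N).continuous.comp hy).continuousOn ?_
      rintro ⟨t, z⟩ ⟨ht, hz⟩
      exact cr_mem (yp_mem hp hpR hrR ht.1 ht.2 hz)
    · refine Continuous.continuousOn ?_
      refine Complex.continuous_ofReal.comp ?_
      fun_prop

/-- the solution in the homogeneous case -/
def ub {N : ℕ} (f : Fin N → (Fin N → ℂ) → ℂ) (k : Fin N → ℕ) (p : Fin N → ℝ) (z : Fin N → ℂ) : ℂ :=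
  ∫ t in Ico (0:ℝ) 1, Jp f k p t z

open MeasureTheory in
theorem ub_cont {N : ℕ} {r R b : ℝ} (hb0 : 0 ≤ b) {f : Fin N → (Fin N → ℂ) → ℂ} {k : Fin N → ℕ} {p : Fin N → ℝ}
    (hp : ∀ i, 0 < p i) (hpR : ∑ i, p i < R) (hrR : r < R)
    (hpk : ∀ x : Fin N → ℝ, (∀ j, 0 ≤ x j) → ∑ j, x j < r → ∑ j, (k j : ℝ) * ((x j - p j) / p j) ≤ 0)
    (hb : ∀ i, ∀ z ∈ Bl N R, ‖f i z‖ ≤ b)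
    (hf : ∀ i, ContinuousOn (f i) (Bl N R)) :
    ContinuousOn (ub f k p) (Bl N r) ∧ ∀ z ∈ Bl N r, ‖ub f k p z‖ ≤ 4 * R * b := by
  have hJ := Jp_cont (k := k) hp hpR hrR hf
  constructor
  · unfold ub
    refine continuousOn_of_dominated (bound := fun _ => 4 * R * b) ?_ ?_ ?_ ?_
    · intro z hz
      refine ContinuousOn.aestronglyMeasurable ?_ measurableSet_Ico
      exact hJ.comp (f := fun t : ℝ => (t, z)) (by fun_prop) fun t ht => ⟨ht, hz⟩
    · intro z hz
      refine (ae_restrict_iff' measurableSet_Ico).2 (ae_of_all _ fun t ht => ?_)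
      exact Jp_bound hb0 hp hpR hrR hpk hb ht.1 ht.2 hz
    · exact integrableOn_const (by simp)
    · refine (ae_restrict_iff' measurableSet_Ico).2 (ae_of_all _ fun t ht => ?_)
      exact hJ.comp (f := fun z : Fin N → ℂ => (t, z)) (by fun_prop) fun z hz => ⟨ht, hz⟩
  · intro z hz
    have := norm_setIntegral_le_of_norm_le_const (μ := volume) (s := Ico (0:ℝ) 1) (f := fun t => Jp f k p t z) (C := 4 * R * b)
      (by simp) (fun t ht => Jp_bound hb0 hp hpR hrR hpk hb ht.1 ht.2 hz)
    unfold ub; simpa using this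

open MeasureTheory in
theorem ub_eq {N : ℕ} {r R : ℝ} {f : Fin N → (Fin N → ℂ) → ℂ} {k : Fin N → ℕ} {p : Fin N → ℝ}
    (hp : ∀ i, 0 < p i) (hpR : ∑ i, p i < R) (hrR : r < R)
    (hf : ∀ i, ContDiffOn ℝ 1 (f i) (Bl N R)) {a : (Fin N → ℝ) → ℂ}
    (ha : ∀ x ∈ Dp N R, HasFDerivAt a
      (∑ j, gm f k j x • Complex.ofRealCLM.comp (ContinuousLinearMap.proj (R := ℝ) (φ := fun _ : Fin N => ℝ) j)) x)
    {z : Fin N → ℂ} (hz : z ∈ Bl N r) (hz0 : ∀ i, z i ≠ 0) :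
    ub f k p z = (∏ i, z i ^ k i) * (a (nrm z) - a p) := by
  have hpD : p ∈ Dp N R := ⟨hp, hpR⟩
  have hzD : nrm z ∈ Dp N R := ⟨fun i => norm_pos_iff.2 (hz0 i), lt_trans hz hrR⟩
  have hyD : ∀ t ∈ Icc (0:ℝ) 1, yp p t z ∈ Dp N R := by
    intro t ht
    have := (convex_Dp N R) hpD hzD (sub_nonneg.2 ht.2) ht.1 (by ring)
    exact this
  have hder : ∀ t ∈ uIcc (0:ℝ) 1, HasDerivAt (fun t => a (yp p t z))
      (∑ j, gm f k j (yp p t z) * ((‖z j‖ - p j : ℝ) : ℂ)) t := by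
    intro t ht
    rw [uIcc_of_le zero_le_one] at ht
    have h1 : HasDerivAt (fun t => yp p t z) (fun i => ‖z i‖ - p i) t := by
      rw [hasDerivAt_pi]
      intro i
      have h2 := (((hasDerivAt_id t).const_sub 1).mul_const (p i)).add ((hasDerivAt_id t).mul_const ‖z i‖)
      convert! h2 using 1
      ring
    have h3 := (ha _ (hyD t ht)).comp_hasDerivAt t h1
    convert! h3 using 1
    rw [sum_apply]
    rfl
  have hcont : ContinuousOn (fun t => ∑ j, gm f k j (yp p t z) * ((‖z j‖ - p j : ℝ) : ℂ)) (uIcc (0:ℝ) 1) := by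
    rw [uIcc_of_le zero_le_one]
    refine continuousOn_finsetSum _ fun i _ => ContinuousOn.mul ?_ continuousOn_const
    intro t ht
    have h1 : ContinuousAt (fun t => yp p t z) t := by
      have : Continuous (fun t => yp p t z) := by unfold yp; fun_prop
      exact this.continuousAt
    exact ((gm_diff hf k i (hyD t ht)).continuousAt.comp (f := fun t => yp p t z) h1).continuousWithinAt
  have hftc := intervalIntegral.integral_eq_sub_of_hasDerivAt hder hcont.intervalIntegrable
  have e1 : yp p 1 z = nrm z := by ext i; simp [yp, nrm]
  have e0 : yp p 0 z = p := by ext i; simp [yp]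
  rw [e1, e0, intervalIntegral.integral_of_le zero_le_one, ← integral_Ico_eq_integral_Ioc] at hftc
  rw [← hftc, ← integral_const_mul]
  unfold ub
  refine setIntegral_congr_fun measurableSet_Ico fun t ht => ?_
  have hQ := Qm_ne k (hyD t ⟨ht.1, ht.2.le⟩)
  simp only [Jp]
  have h4 : ∏ i, (z i / (yp p t z i : ℂ)) ^ k i = (∏ i, z i ^ k i) / Qm k (yp p t z) := by
    unfold Qm
    rw [← Finset.prod_div_distrib]
    exact Finset.prod_congr rfl fun i _ => div_pow _ _ _
  rw [h4, div_mul_eq_mul_div, mul_div_assoc, Finset.sum_div]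
  congr 1
  refine Finset.sum_congr rfl fun i _ => ?_
  unfold gm; ring

theorem dbL_restrict (L : ℂ →L[ℂ] ℂ) : dbL (L.restrictScalars ℝ) = 0 := by
  have : L Complex.I = Complex.I * L 1 := by
    rw [← smul_eq_mul, ← map_smul]; simp
  simp only [dbL, ContinuousLinearMap.coe_restrictScalars', this]
  rw [← mul_assoc, Complex.I_mul_I]; ring

theorem add_eC_apply {N : ℕ} (j i : Fin N) (z : Fin N → ℂ) (l : ℂ) :
    (z + eC N j l) i = z i + if i = j then l else 0 := by
  simp [eC_apply, Pi.single_apply]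

theorem ub_weak {N : ℕ} {r R b : ℝ} (hb0 : 0 ≤ b) (hR : 0 < R) {f : Fin N → (Fin N → ℂ) → ℂ} {k : Fin N → ℕ} {p : Fin N → ℝ}
    (hp : ∀ i, 0 < p i) (hpR : ∑ i, p i < R) (hrR : r < R)
    (hpk : ∀ x : Fin N → ℝ, (∀ j, 0 ≤ x j) → ∑ j, x j < r → ∑ j, (k j : ℝ) * ((x j - p j) / p j) ≤ 0)
    (hb : ∀ i, ∀ z ∈ Bl N R, ‖f i z‖ ≤ b)
    (hf : ClosedF R f) (hm : ∀ i, Mode R (k i) i f) (j : Fin N) :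
    WeakDb (Bl N r) j (ub f k p) (f j) := by
  obtain ⟨a, ha⟩ := exists_potential hf hm
  have hfc : ∀ i, ContinuousOn (f i) (Bl N R) := fun i => (hf.1 i).continuousOn
  obtain ⟨huc, hub⟩ := ub_cont hb0 hp hpR hrR hpk hb hfc
  have hrR' := Bl_mono (N := N) hrR.le
  have hRb : 0 ≤ 4 * R * b := by positivity
  refine weak_of_dense (isOpen_Bl N r) j huc ((hfc j).mono hrR') (4 * R * b + b)
    (fun z hz => (hub z hz).trans (by linarith)) (fun z hz => (hb j z (hrR' hz)).trans (by linarith))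
    {z | ∀ i, z i ≠ 0} (dense_nonzero N) ?_
  intro z hz hzD χ hχ hχc hs
  have hne : ∀ l, l ∉ ({-z j} : Set ℂ) → ∀ i, (z + eC N j l) i ≠ 0 := by
    intro l hl i
    rw [add_eC_apply]
    by_cases hi : i = j
    · subst hi
      simp only [if_true]
      intro h
      exact hl (by simpa using (eq_neg_of_add_eq_zero_right h))
    · simpa [hi] using hzD i
  -- derivative
  have hder : ∀ l ∈ {l : ℂ | z + eC N j l ∈ Bl N r}, l ∉ ({-z j} : Set ℂ) →
      ∃ g' : ℂ →L[ℝ] ℂ, HasFDerivAt (fun l => ub f k p (z + eC N j l)) g' l ∧ dbL g' = f j (z + eC N j l) := by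
    intro l hl hlS
    have hw0 := hne l hlS
    set w := z + eC N j l with hw
    have hwD : nrm w ∈ Dp N R := ⟨fun i => norm_pos_iff.2 (hw0 i), lt_trans hl hrR⟩
    obtain ⟨M, hM⟩ : ∃ M : ℂ →L[ℂ] ℂ, HasFDerivAt (fun l => ∏ i, (z + eC N j l) i ^ k i) M l := by
      have : DifferentiableAt ℂ (fun l => ∏ i, (z + eC N j l) i ^ k i) l := by
        simp only [add_eC_apply]
        refine DifferentiableAt.fun_finsetProd fun i _ => ?_
        by_cases hi : i = j
        · simp only [hi, if_true]; fun_prop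
        · simp only [hi, if_false]; fun_prop
      exact ⟨_, this.hasFDerivAt⟩
    have hM' := hM.restrictScalars ℝ
    obtain ⟨L, hL, hLd⟩ := norm_fderiv (hw0 j)
    have hn : HasFDerivAt (fun l => nrm (z + eC N j l))
        (ContinuousLinearMap.pi fun i => if i = j then L else 0) l := by
      rw [hasFDerivAt_pi]
      intro i
      by_cases hi : i = j
      · subst hi
        simp only [if_true]
        have h1 : HasFDerivAt (fun l : ℂ => z i + l) (ContinuousLinearMap.id ℝ ℂ) l :=
          (hasFDerivAt_id l).const_add (z i)
        have hwi : w i = z i + l := by rw [hw, add_eC_apply]; simp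
        rw [hwi] at hL
        have h2 := hL.comp l h1
        rw [ContinuousLinearMap.comp_id] at h2
        convert! h2 using 1
        ext l; simp [nrm, eC_apply]
      · simp only [hi, if_false]
        have : (fun l => nrm (z + eC N j l) i) = fun _ => ‖z i‖ := by
          ext l; simp [nrm, eC_apply, hi]
        rw [this]
        exact hasFDerivAt_const _ _
    have hA := ((ha _ hwD).comp l hn).sub_const (a p)
    have hF := hM'.mul hA
    refine ⟨_, hF.congr_of_eventuallyEq ?_, ?_⟩
    · have ho : {l : ℂ | z + eC N j l ∈ Bl N r} ∩ ({-z j} : Set ℂ)ᶜ ∈ nhds l :=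
        ((slice_open (isOpen_Bl N r) j z).inter (isClosed_singleton.isOpen_compl)).mem_nhds ⟨hl, hlS⟩
      filter_upwards [ho] with l' hl'
      rw [ub_eq hp hpR hrR hf.1 ha hl'.1 (hne l' hl'.2)]
      rfl
    · rw [dbL_add, dbL_smul, dbL_smul, dbL_restrict, mul_zero, add_zero]
      have h1 : dbL ((∑ j, gm f k j (nrm w) • Complex.ofRealCLM.comp (ContinuousLinearMap.proj (R := ℝ) (φ := fun _ : Fin N => ℝ) j)).comp
          (ContinuousLinearMap.pi fun i => if i = j then L else 0)) = gm f k j (nrm w) * (w j / (2 * (‖w j‖ : ℂ))) := by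
        rw [← hLd]
        have h2 : ∀ v, ((∑ j, gm f k j (nrm w) • Complex.ofRealCLM.comp (ContinuousLinearMap.proj (R := ℝ) (φ := fun _ : Fin N => ℝ) j)).comp
          (ContinuousLinearMap.pi fun i => if i = j then L else 0)) v = gm f k j (nrm w) * (L v : ℂ) := by
          intro v
          rw [ContinuousLinearMap.comp_apply, sum_apply, Finset.sum_eq_single j]
          · simp
          · intro i _ hi; simp [hi]
          · simp
        unfold dbL
        rw [h2, h2]; ring
      rw [← hw, h1, mode_full hm j (w := w) (hrR' hl) hw0]
      have hn : ∀ i, (‖w i‖ : ℂ) ≠ 0 := fun i => by exact_mod_cast (norm_ne_zero_iff.2 (hw0 i))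
      have hQ := Qm_ne k hwD
      have h4 : ∏ i, (w i / (‖w i‖ : ℂ)) ^ k i = (∏ i, w i ^ k i) / Qm k (nrm w) := by
        unfold Qm
        rw [← Finset.prod_div_distrib]
        exact Finset.prod_congr rfl fun i _ => div_pow _ _ _
      rw [h4]
      unfold gm
      have := hn j
      field_simp
  classical
  let g' : ℂ → ℂ →L[ℝ] ℂ := fun l => if h : l ∈ {l : ℂ | z + eC N j l ∈ Bl N r} ∧ l ∉ ({-z j} : Set ℂ) then
    (hder l h.1 h.2).choose else 0
  have := cp_loc χ (fun l => ub f k p (z + eC N j l)) (fun l => f j (z + eC N j l)) g'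
    {l : ℂ | z + eC N j l ∈ Bl N r} {-z j} (countable_singleton _) (slice_open (isOpen_Bl N r) j z) hχ hχc hs
    (slice_contOn huc j z) (slice_contOn ((hfc j).mono hrR') j z)
    (fun l hl hlS => by simp only [g']; rw [dif_pos ⟨hl, hlS⟩]; exact (hder l hl hlS).choose_spec.1)
    (fun l hl hlS => by simp only [g']; rw [dif_pos ⟨hl, hlS⟩]; exact (hder l hl hlS).choose_spec.2)
  simpa using this

/-- the inductive claim -/
def SolveJ (N j : ℕ) : Prop := ∀ r R : ℝ, 0 < r → r < R → ∃ M : ℝ, 0 ≤ M ∧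
  ∀ (k : Fin N → ℕ) (f : Fin N → (Fin N → ℂ) → ℂ) (b : ℝ), 0 ≤ b → ClosedF R f →
    (∀ i, ∀ z ∈ Bl N R, ‖f i z‖ ≤ b) → (∀ i : Fin N, (i : ℕ) < j → Mode R (k i) i f) →
    ∃ u : (Fin N → ℂ) → ℂ, ContinuousOn u (Bl N r) ∧ (∀ i, WeakDb (Bl N r) i u (f i)) ∧
      ∀ z ∈ Bl N r, ‖u z‖ ≤ M * b

theorem solve_base (N : ℕ) : SolveJ N N := by
  intro r R hr hrR
  refine ⟨4 * R, by linarith, fun k f b hb0 hf hb hm => ?_⟩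
  obtain ⟨p, hp, hpR, hpk⟩ := exists_p N r R hr hrR k
  have hm' : ∀ i, Mode R (k i) i f := fun i => hm i i.2
  obtain ⟨h1, h2⟩ := ub_cont hb0 hp hpR hrR hpk hb (fun i => (hf.1 i).continuousOn)
  exact ⟨ub f k p, h1, fun i => ub_weak hb0 (hr.trans hrR) hp hpR hrR hpk hb hf hm' i, h2⟩

theorem rlin (M : ℂ →L[ℝ] ℂ) (w : ℂ) : M w = w.re * M 1 + w.im * M Complex.I := by
  have : w = w.re • (1:ℂ) + w.im • Complex.I := by
    simp
  conv_lhs => rw [this, map_add, map_smul, map_smul]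
  simp

theorem dbL_mulr (M : ℂ →L[ℝ] ℂ) (a : ℂ) (M' : ℂ →L[ℝ] ℂ) (h : ∀ v, M' v = M (a * v)) :
    dbL M' = (starRingEnd ℂ) a * dbL M := by
  unfold dbL
  rw [h, h, rlin M (a * 1), rlin M (a * Complex.I)]
  have hc : (starRingEnd ℂ) a = a.re - a.im * Complex.I := by
    apply Complex.ext <;> simp
  rw [hc]
  simp
  linear_combination (a.im * M Complex.I / 2) * Complex.I_sq

/-- linear version of `sc` -/
def scL {N : ℕ} (j : Fin N) (a : ℂ) : (Fin N → ℂ) →L[ℝ] (Fin N → ℂ) :=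
  ContinuousLinearMap.pi fun i => if i = j then a • ContinuousLinearMap.proj (R := ℝ) (φ := fun _ : Fin N => ℂ) i
    else ContinuousLinearMap.proj (R := ℝ) (φ := fun _ : Fin N => ℂ) i

theorem scL_apply {N : ℕ} (j : Fin N) (a : ℂ) (z : Fin N → ℂ) : scL j a z = sc j a z := by
  ext i
  by_cases h : i = j <;> simp [scL, sc, h]

/-- the conjugate factor -/
def cj {N : ℕ} (j l : Fin N) (a : ℂ) : ℂ := if l = j then (starRingEnd ℂ) a else 1

theorem cj_cont {N : ℕ} (j l : Fin N) : Continuous (cj j l) := by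
  unfold cj
  by_cases h : l = j
  · simp only [h, if_true]; exact Complex.continuous_conj
  · simp only [h, if_false]; exact continuous_const

theorem dbj_scL {N : ℕ} (j l : Fin N) (a : ℂ) (L : (Fin N → ℂ) →L[ℝ] ℂ) :
    dbj l (L.comp (scL j a)) = cj j l a * dbj l L := by
  unfold dbj cj
  by_cases h : l = j
  · subst h
    simp only [if_true]
    refine dbL_mulr _ a _ fun v => ?_
    simp only [ContinuousLinearMap.comp_apply]
    congr 1
    rw [scL_apply]
    ext i
    by_cases hi : i = l
    · subst hi; simp [sc, eC_apply]
    · simp [sc, eC_apply, hi]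
  · simp only [h, if_false, one_mul]
    congr 1
    ext v
    simp only [ContinuousLinearMap.comp_apply]
    congr 1
    rw [scL_apply]
    ext i
    by_cases hi : i = j
    · subst hi; simp [sc, eC_apply, Ne.symm h]
    · simp [sc, hi]

theorem sc_sum {N : ℕ} (j : Fin N) {a : ℂ} {s : ℝ} (hs : 1 ≤ s) (ha : ‖a‖ ≤ s) (z : Fin N → ℂ) :
    ∑ i, ‖sc j a z i‖ ≤ s * ∑ i, ‖z i‖ := by
  rw [Finset.mul_sum]
  refine Finset.sum_le_sum fun i _ => ?_
  unfold sc
  split_ifs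
  · rw [norm_mul]; exact mul_le_mul_of_nonneg_right ha (norm_nonneg _)
  · exact le_mul_of_one_le_left (norm_nonneg _) hs

theorem sc_mem {N : ℕ} (j : Fin N) {a : ℂ} {s R R' : ℝ} (hs : 1 ≤ s) (ha : ‖a‖ ≤ s) (hsR : s * R' < R)
    {z : Fin N → ℂ} (hz : ∑ i, ‖z i‖ ≤ R') : sc j a z ∈ Bl N R := by
  have h1 := sc_sum j hs ha z
  have h2 := mul_le_mul_of_nonneg_left hz (zero_le_one.trans hs)
  exact lt_of_le_of_lt (h1.trans h2) hsR

theorem sc_cont {N : ℕ} (j : Fin N) : Continuous (fun p : ℂ × (Fin N → ℂ) => sc j p.1 p.2) := by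
  refine continuous_pi fun i => ?_
  unfold sc
  by_cases h : i = j
  · simp only [h, if_true]; fun_prop
  · simp only [h, if_false]; fun_prop

open MeasureTheory in
theorem param_sc {N : ℕ} (j : Fin N) {s R R' : ℝ} (hs : 1 ≤ s) (hsR : s * R' < R)
    {f : (Fin N → ℂ) → ℂ} (hf : ContDiffOn ℝ 1 f (Bl N R)) {b : ℝ} (hb : ∀ z ∈ Bl N R, ‖f z‖ ≤ b)
    (K : ℂ → ℂ) (hK : Integrable K) (hKS : ∀ l, l ∉ Metric.closedBall (0:ℂ) s → K l = 0) :
    ∃ T' : (Fin N → ℂ) → (Fin N → ℂ) →L[ℝ] ℂ,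
    (∀ z ∈ Bl N R', HasFDerivAt (fun z => ∫ l, K l * f (sc j l z)) (T' z) z) ∧
    ContDiffOn ℝ 1 (fun z => ∫ l, K l * f (sc j l z)) (Bl N R') ∧
    (∀ z ∈ Bl N R', ∀ i, dbj i (T' z) = ∫ l, K l * (cj j i l * dbj i (fderiv ℝ f (sc j l z)))) ∧
    (∀ z ∈ Bl N R', Integrable (fun l => K l * f (sc j l z))) ∧
    (∀ z ∈ Bl N R', ∀ i, Integrable (fun l => K l * (cj j i l * dbj i (fderiv ℝ f (sc j l z))))) ∧
    (∀ z ∈ Bl N R', ‖∫ l, K l * f (sc j l z)‖ ≤ (∫ l, ‖K l‖) * b) := by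
  set S := Metric.closedBall (0:ℂ) s with hS
  have hSm : ∀ l ∈ S, ‖l‖ ≤ s := fun l hl => by simpa [hS] using hl
  let cB : Set (Fin N → ℂ) := {z | ∑ i, ‖z i‖ ≤ R'}
  have hcB : Bl N R' ⊆ cB := fun z hz => show ∑ i, ‖z i‖ ≤ R' from le_of_lt hz
  have hmem : ∀ l ∈ S, ∀ z ∈ cB, sc j l z ∈ Bl N R := fun l hl z hz => sc_mem j hs (hSm l hl) hsR hz
  have hmaps : MapsTo (fun p : ℂ × (Fin N → ℂ) => sc j p.1 p.2) (S ×ˢ cB) (Bl N R) :=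
    fun p hp => hmem _ hp.1 _ hp.2
  let G' : ℂ → (Fin N → ℂ) → (Fin N → ℂ) →L[ℝ] ℂ := fun l z => (fderiv ℝ f (sc j l z)).comp (scL j l)
  have hG'c : ContinuousOn (fun p : ℂ × (Fin N → ℂ) => G' p.1 p.2) (S ×ˢ cB) := by
    rw [continuousOn_clm_apply]
    intro y
    have h1 := (hf.continuousOn_fderiv_of_isOpen (isOpen_Bl N R) le_rfl).comp (sc_cont j).continuousOn hmaps
    refine h1.clm_apply (g := fun p : ℂ × (Fin N → ℂ) => scL j p.1 y) ?_
    simp only [scL_apply]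
    exact ((sc_cont j).comp (by fun_prop : Continuous fun p : ℂ × (Fin N → ℂ) => (p.1, y))).continuousOn
  have hGc : ContinuousOn (fun p : ℂ × (Fin N → ℂ) => f (sc j p.1 p.2)) (S ×ˢ cB) :=
    hf.continuousOn.comp (sc_cont j).continuousOn hmaps
  obtain ⟨b', hb'⟩ := (((isCompact_closedBall (0:ℂ) s).prod (compact_cBl N R')).image_of_continuousOn hG'c).isBounded.exists_norm_le
  have hsub : S ×ˢ Bl N R' ⊆ S ×ˢ cB := prod_mono le_rfl hcB
  have hbG' : ∀ l ∈ S, ∀ z ∈ Bl N R', ‖G' l z‖ ≤ b' := fun l hl z hz =>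
    hb' _ ⟨(l, z), ⟨hl, hcB hz⟩, rfl⟩
  have hbG : ∀ l ∈ S, ∀ z ∈ Bl N R', ‖f (sc j l z)‖ ≤ b := fun l hl z hz => hb _ (hmem l hl z (hcB hz))
  have hd : ∀ l ∈ S, ∀ z ∈ Bl N R', HasFDerivAt (fun z => f (sc j l z)) (G' l z) z := by
    intro l hl z hz
    have h1 := ((hf.differentiableOn (by norm_num)).differentiableAt ((isOpen_Bl N R).mem_nhds (hmem l hl z (hcB hz)))).hasFDerivAt
    have h2 : HasFDerivAt (fun z => sc j l z) (scL j l) z := by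
      have := (scL j l).hasFDerivAt (x := z)
      convert! this using 1
      ext z; rw [scL_apply]
    exact h1.comp z h2
  obtain ⟨d1, d2, d3⟩ := param_deriv K hK S Metric.isClosed_closedBall hKS (Bl N R') (isOpen_Bl N R')
    (fun l z => f (sc j l z)) G' (hGc.mono hsub) b hbG (hG'c.mono hsub) b' hbG' hd
  obtain ⟨i1, -, n1⟩ := param_cont K hK S Metric.isClosed_closedBall hKS (Bl N R')
    (fun l z => f (sc j l z)) (hGc.mono hsub) b hbG
  obtain ⟨i2, -, -⟩ := param_cont K hK S Metric.isClosed_closedBall hKS (Bl N R')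
    G' (hG'c.mono hsub) b' hbG'
  have e : ∀ l z i, K l * (cj j i l * dbj i (fderiv ℝ f (sc j l z))) =
     (K l * G' l z (eC N i 1) + Complex.I * (K l * G' l z (eC N i Complex.I))) / 2 := by
    intro l z i
    rw [← dbj_scL]
    simp only [dbj, dbL, ContinuousLinearMap.comp_apply, G']
    ring
  have i3 : ∀ z ∈ Bl N R', ∀ x, Integrable (fun l => K l * G' l z x) := by
    intro z hz x
    exact (i2 z hz).apply_continuousLinearMap x
  refine ⟨fun z => ∫ l, K l • G' l z, d1, d2, ?_, i1, ?_, n1⟩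
  · intro z hz i
    simp only [e]
    rw [integral_div, integral_add (i3 z hz _) ((i3 z hz _).const_mul _), integral_const_mul, ← d3 z hz, ← d3 z hz]
    rfl
  · intro z hz i
    simp only [e]
    exact ((i3 z hz _).add ((i3 z hz _).const_mul _)).div_const _

open MeasureTheory in
theorem weak_add {N : ℕ} {Ω : Set (Fin N → ℂ)} (hΩ : IsOpen Ω) (j : Fin N)
    {u v g h : (Fin N → ℂ) → ℂ} (hu : ContinuousOn u Ω) (hv : ContinuousOn v Ω)
    (hg : ContinuousOn g Ω) (hh : ContinuousOn h Ω)
    (h1 : WeakDb Ω j u g) (h2 : WeakDb Ω j v h) : WeakDb Ω j (fun z => u z + v z) (fun z => g z + h z) := by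
  intro z hz χ hχ hc hs
  have hs' : ∀ l ∈ tsupport (fun l => dbL (fderiv ℝ χ l)), z + eC N j l ∈ Ω :=
    fun l hl => hs l (tsupport_dbL_subset χ hl)
  have i1 := weak_integrable hΩ j hg z χ hχ.continuous hc hs
  have i2 := weak_integrable hΩ j hh z χ hχ.continuous hc hs
  have i3 := weak_integrable hΩ j hu z _ (dbL_cont hχ) (dbL_compact hc) hs'
  have i4 := weak_integrable hΩ j hv z _ (dbL_cont hχ) (dbL_compact hc) hs'
  have e1 := h1 z hz χ hχ hc hs
  have e2 := h2 z hz χ hχ hc hs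
  have : ∫ l, (χ l * (g (z + eC N j l) + h (z + eC N j l)) +
      dbL (fderiv ℝ χ l) * (u (z + eC N j l) + v (z + eC N j l))) / l =
      (∫ l, (χ l * g (z + eC N j l) + dbL (fderiv ℝ χ l) * u (z + eC N j l)) / l) +
      ∫ l, (χ l * h (z + eC N j l) + dbL (fderiv ℝ χ l) * v (z + eC N j l)) / l := by
    rw [← integral_add]
    · congr 1; ext l; ring
    · simpa only [add_div] using! i1.add i3
    · simpa only [add_div] using! i2.add i4
  rw [this, e1, e2]; ring

open MeasureTheory in
theorem weak_tsum {N : ℕ} {Ω : Set (Fin N → ℂ)} (hΩ : IsOpen Ω) (j : Fin N)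
    {u f : ℕ → (Fin N → ℂ) → ℂ} {F : (Fin N → ℂ) → ℂ} (hu : ∀ m, ContinuousOn (u m) Ω)
    (hf : ∀ m, ContinuousOn (f m) Ω) (B : ℕ → ℝ) (hB : Summable B)
    (hub : ∀ m, ∀ z ∈ Ω, ‖u m z‖ ≤ B m) (hfb : ∀ m, ∀ z ∈ Ω, ‖f m z‖ ≤ B m)
    (hF : ∀ z ∈ Ω, HasSum (fun m => f m z) (F z))
    (hw : ∀ m, WeakDb Ω j (u m) (f m)) : WeakDb Ω j (fun z => ∑' m, u m z) F := by
  intro z hz χ hχ hc hs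
  have hs' : ∀ l ∈ tsupport (fun l => dbL (fderiv ℝ χ l)), z + eC N j l ∈ Ω :=
    fun l hl => hs l (tsupport_dbL_subset χ hl)
  have hU : ∀ z ∈ Ω, HasSum (fun m => u m z) (∑' m, u m z) := fun z hz =>
    (Summable.of_norm_bounded hB (fun m => hub m z hz)).hasSum
  let G : ℕ → ℂ → ℂ := fun m l => (χ l * f m (z + eC N j l) + dbL (fderiv ℝ χ l) * u m (z + eC N j l)) / l
  have iG : ∀ m, Integrable (G m) := by
    intro m
    have i1 := weak_integrable hΩ j (hf m) z χ hχ.continuous hc hs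
    have i3 := weak_integrable hΩ j (hu m) z _ (dbL_cont hχ) (dbL_compact hc) hs'
    simpa only [G, add_div] using! i1.add i3
  have k1 := integrable_kernel χ hχ.continuous hc 0
  have k2 := integrable_kernel _ (dbL_cont hχ) (dbL_compact hc) 0
  simp only [sub_zero] at k1 k2
  have hz0 : ∀ l, l ∉ tsupport χ → χ l = 0 ∧ dbL (fderiv ℝ χ l) = 0 := fun l hl =>
    ⟨image_eq_zero_of_notMem_tsupport hl,
      image_eq_zero_of_notMem_tsupport (f := fun l => dbL (fderiv ℝ χ l)) (fun h => hl (tsupport_dbL_subset χ h))⟩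
  have hGb : ∀ m, ∫ l, ‖G m l‖ ≤ B m * ∫ l, (‖χ l / l‖ + ‖dbL (fderiv ℝ χ l) / l‖) := by
    intro m
    rw [← integral_const_mul]
    refine integral_mono (iG m).norm ((k1.norm.add k2.norm).const_mul _) fun l => ?_
    simp only [G]
    by_cases hl : l ∈ tsupport χ
    · have e1 := hfb m _ (hs l hl)
      have e2 := hub m _ (hs l hl)
      have : (χ l * f m (z + eC N j l) + dbL (fderiv ℝ χ l) * u m (z + eC N j l)) / l =
        χ l / l * f m (z + eC N j l) + dbL (fderiv ℝ χ l) / l * u m (z + eC N j l) := by ring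
      rw [this]
      refine (norm_add_le _ _).trans ?_
      rw [norm_mul, norm_mul]
      nlinarith [mul_le_mul_of_nonneg_left e1 (norm_nonneg (χ l / l)),
        mul_le_mul_of_nonneg_left e2 (norm_nonneg (dbL (fderiv ℝ χ l) / l))]
    · obtain ⟨a1, a2⟩ := hz0 l hl
      simp [a1, a2]
  have hsum : Summable fun m => ∫ l, ‖G m l‖ :=
    Summable.of_nonneg_of_le (fun m => integral_nonneg fun l => norm_nonneg _) hGb (hB.mul_right _)
  have key := hasSum_integral_of_summable_integral_norm iG hsum
  have e1 : ∀ l, ∑' m, G m l = (χ l * F (z + eC N j l) + dbL (fderiv ℝ χ l) * ∑' m, u m (z + eC N j l)) / l := by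
    intro l
    by_cases hl : l ∈ tsupport χ
    · exact ((((hF _ (hs l hl)).mul_left (χ l)).add ((hU _ (hs l hl)).mul_left (dbL (fderiv ℝ χ l)))).div_const l).tsum_eq
    · obtain ⟨a1, a2⟩ := hz0 l hl
      simp [G, a1, a2]
  simp only [e1] at key
  have key2 : HasSum (fun m => ∫ l, G m l) (-(Real.pi : ℂ) * (χ 0 * ∑' m, u m z)) := by
    have : (fun m => ∫ l, G m l) = fun m => -(Real.pi : ℂ) * (χ 0 * u m z) := by
      ext m; exact hw m z hz χ hχ hc hs
    rw [this]
    exact ((hU z hz).mul_left _).mul_left _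
  exact key.unique key2

theorem exists_cutoff (s t : ℝ) (hs : 0 < s) (hst : s < t) : ∃ χ : ℂ → ℂ, ContDiff ℝ 1 χ ∧
    HasCompactSupport χ ∧ tsupport χ ⊆ Metric.closedBall 0 t ∧ (∀ l, ‖l‖ ≤ s → χ l = 1) ∧
    (∀ a l, ‖a‖ = 1 → χ (a * l) = χ l) := by
  have hd : 0 < t ^ 2 - s ^ 2 := by nlinarith
  let χ : ℂ → ℂ := fun l => ((Real.smoothTransition ((t ^ 2 - ‖l‖ ^ 2) / (t ^ 2 - s ^ 2)) : ℝ) : ℂ)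
  have hts : tsupport χ ⊆ Metric.closedBall 0 t := by
    refine closure_minimal ?_ Metric.isClosed_closedBall
    intro l hl
    by_contra h
    apply hl
    have h' : t < ‖l‖ := by simpa using h
    simp only [χ]
    rw [Real.smoothTransition.zero_of_nonpos]
    · simp
    · exact div_nonpos_of_nonpos_of_nonneg (by nlinarith) hd.le
  refine ⟨χ, ?_, (isCompact_closedBall (0:ℂ) t).of_isClosed_subset (isClosed_tsupport _) hts, hts, ?_, ?_⟩
  · refine Complex.ofRealCLM.contDiff.comp (Real.smoothTransition.contDiff.comp ?_)
    exact (contDiff_const.sub (contDiff_norm_sq ℝ)).div_const _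
  · intro l hl
    simp only [χ]
    rw [Real.smoothTransition.one_of_one_le]
    · simp
    · rw [le_div_iff₀ hd]; nlinarith [norm_nonneg l]
  · intro a l ha
    simp only [χ, norm_mul, ha, one_mul]

theorem cutoff_rot {χ : ℂ → ℂ} (hχ : ContDiff ℝ 1 χ) (h : ∀ a l, ‖a‖ = 1 → χ (a * l) = χ l) {a : ℂ} (ha : ‖a‖ = 1)
    (l : ℂ) : dbL (fderiv ℝ χ l) = (starRingEnd ℂ) a * dbL (fderiv ℝ χ (a * l)) := by
  refine dbL_mulr _ a _ fun v => ?_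
  have h1 := (hχ.differentiable (by norm_num)).differentiableAt.hasFDerivAt (x := a * l)
  have h2 : HasFDerivAt (fun l : ℂ => a * l) (a • ContinuousLinearMap.id ℝ ℂ) l := (hasFDerivAt_id l).const_mul a
  have h3 := h1.comp l h2
  have h4 : χ ∘ (fun l => a * l) = χ := by ext l; exact h a l ha
  rw [h4] at h3
  rw [h3.fderiv]
  simp

theorem cutoff_zero {χ : ℂ → ℂ} {s : ℝ} (h : ∀ l, ‖l‖ ≤ s → χ l = 1) {l : ℂ} (hl : ‖l‖ < s) :
    dbL (fderiv ℝ χ l) = 0 := by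
  have : χ =ᶠ[nhds l] fun _ => 1 := by
    have : {l : ℂ | ‖l‖ < s} ∈ nhds l := (isOpen_lt continuous_norm continuous_const).mem_nhds hl
    filter_upwards [this] with x hx
    exact h x (le_of_lt hx)
  rw [this.fderiv_eq]
  simp [dbL]

theorem dbj_add {N : ℕ} (j : Fin N) (L L' : (Fin N → ℂ) →L[ℝ] ℂ) : dbj j (L + L') = dbj j L + dbj j L' := by
  simp [dbj, dbL]; ring

theorem dbj_smul {N : ℕ} (j : Fin N) (c : ℂ) (L : (Fin N → ℂ) →L[ℝ] ℂ) : dbj j (c • L) = c * dbj j L := by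
  simp [dbj, dbL]; ring

/-- conjugate of a coordinate -/
def cjp (N : ℕ) (j : Fin N) : (Fin N → ℂ) →L[ℝ] ℂ :=
  (Complex.conjCLE : ℂ →L[ℝ] ℂ).comp (ContinuousLinearMap.proj (R := ℝ) (φ := fun _ : Fin N => ℂ) j)

theorem cjp_apply {N : ℕ} (j : Fin N) (z : Fin N → ℂ) : cjp N j z = (starRingEnd ℂ) (z j) := by
  simp [cjp]

theorem dbj_cjp {N : ℕ} (i j : Fin N) : dbj i (cjp N j) = if i = j then 1 else 0 := by
  unfold dbj dbL
  simp only [ContinuousLinearMap.comp_apply, cjp_apply, eC_apply, Pi.single_apply]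
  by_cases h : i = j
  · simp [h]
  · simp [h, Ne.symm h]

theorem sc_add_one {N : ℕ} (j : Fin N) (l : ℂ) (z : Fin N → ℂ) : sc j (l + 1) z = z + eC N j (z j * l) := by
  ext i
  by_cases h : i = j
  · subst h; simp [sc, eC_apply]; ring
  · simp [sc, eC_apply, h]

open MeasureTheory in
theorem cp_scaled {N : ℕ} (j i : Fin N) {s R R' : ℝ} (hs : 1 ≤ s) (hsR : s * R' < R)
    {f : Fin N → (Fin N → ℂ) → ℂ} (hf : ClosedF R f)
    {χ : ℂ → ℂ} (hχ : ContDiff ℝ 1 χ) (hc : HasCompactSupport χ) (hts : tsupport χ ⊆ Metric.closedBall 0 s)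
    (hχ1 : χ 1 = 1) {z : Fin N → ℂ} (hz : z ∈ Bl N R') :
    ∫ l, (χ l * ((if i = j then f j (sc j l z) else 0) +
        (starRingEnd ℂ) (z j) * (cj j i l * dbj i (fderiv ℝ (f j) (sc j l z)))) +
      dbL (fderiv ℝ χ l) * (cj j i l * f i (sc j l z))) / (l - 1) = -(Real.pi : ℂ) * f i z := by
  have hmem : ∀ l, l + 1 ∈ tsupport χ → sc j (l + 1) z ∈ Bl N R := fun l hl =>
    sc_mem j hs (by simpa using hts hl) hsR (le_of_lt hz)
  rw [← integral_add_right_eq_self _ (1:ℂ)]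
  have hsc : Continuous (fun l : ℂ => sc j (l + 1) z) :=
    (sc_cont j).comp (by fun_prop : Continuous fun l : ℂ => (l + 1, z))
  have hcj : Continuous (fun l : ℂ => cj j i (l + 1)) := (cj_cont j i).comp (by fun_prop)
  let O : Set ℂ := {l | sc j (l + 1) z ∈ Bl N R}
  have hO : IsOpen O := (isOpen_Bl N R).preimage hsc
  have hmt : MapsTo (fun l : ℂ => sc j (l + 1) z) O (Bl N R) := fun l hl => hl
  have hfc : ∀ i, ContinuousOn (fun l : ℂ => f i (sc j (l + 1) z)) O := fun i =>
    (hf.1 i).continuousOn.comp hsc.continuousOn hmt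
  have hfd : ∀ i, ContinuousOn (fun l : ℂ => fderiv ℝ (f i) (sc j (l + 1) z)) O := fun i =>
    ((hf.1 i).continuousOn_fderiv_of_isOpen (isOpen_Bl N R) le_rfl).comp hsc.continuousOn hmt
  let χ' : ℂ → ℂ := fun l => χ (l + 1)
  have hχ' : ContDiff ℝ 1 χ' := hχ.comp (by fun_prop)
  have hts' : tsupport χ' = (fun l => l + 1) ⁻¹' tsupport χ :=
    tsupport_comp_eq_preimage χ (Homeomorph.addRight (1:ℂ))
  have hc' : HasCompactSupport χ' := hc.comp_homeomorph (Homeomorph.addRight (1:ℂ))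
  have hfχ : ∀ l, fderiv ℝ χ' l = fderiv ℝ χ (l + 1) := fun l => fderiv_comp_add_right (1:ℂ)
  let cc : ℂ →L[ℝ] ℂ := if i = j then (Complex.conjCLE : ℂ →L[ℝ] ℂ) else 0
  let g' : ℂ → ℂ →L[ℝ] ℂ := fun l => cj j i (l + 1) •
      ((fderiv ℝ (f i) (sc j (l + 1) z)).comp ((eC N j).comp (z j • ContinuousLinearMap.id ℝ ℂ))) +
      f i (sc j (l + 1) z) • cc
  have key := cp_loc χ' (fun l => cj j i (l + 1) * f i (sc j (l + 1) z))
    (fun l => (if i = j then f j (sc j (l + 1) z) else 0) +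
        (starRingEnd ℂ) (z j) * (cj j i (l + 1) * dbj i (fderiv ℝ (f j) (sc j (l + 1) z)))) g' O ∅ countable_empty hO hχ' hc'
    ?_ (hcj.continuousOn.mul (hfc i)) ?_ ?_ ?_
  · simp only [hfχ, χ'] at key
    simp only [add_sub_cancel_right]
    rw [key]
    have h1 : sc j 1 z = z := by have := sc_add_one j 0 z; simpa using this
    have h2 : cj j i 1 = 1 := by simp [cj]
    rw [zero_add, h1, h2, hχ1]; ring
  · rw [hts']; exact hmem
  · refine ContinuousOn.add ?_ (continuousOn_const.mul (hcj.continuousOn.mul ?_))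
    · by_cases h : i = j
      · simp only [h, if_true]; exact hfc j
      · simp only [h, if_false]; exact continuousOn_const
    · have : Continuous (dbj (N := N) i) := by unfold dbj dbL; fun_prop
      exact this.comp_continuousOn (hfd j)
  · intro l hl _
    have h1 := ((((hf.1 i).differentiableOn (by norm_num)).differentiableAt ((isOpen_Bl N R).mem_nhds hl))).hasFDerivAt
    have h2 : HasFDerivAt (fun l => sc j (l + 1) z) ((eC N j).comp (z j • ContinuousLinearMap.id ℝ ℂ)) l := by
      simp only [sc_add_one]
      have := (((eC N j).comp (z j • ContinuousLinearMap.id ℝ ℂ)).hasFDerivAt (x := l)).const_add z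
      exact this
    have h3 : HasFDerivAt (fun l => cj j i (l + 1)) cc l := by
      simp only [cj, cc]
      by_cases h : i = j
      · simp only [h, if_true]
        have := ((Complex.conjCLE : ℂ →L[ℝ] ℂ).hasFDerivAt (x := l)).add_const 1
        convert! this using 1
        ext l; simp
      · simp only [h, if_false]; exact hasFDerivAt_const _ _
    exact h3.mul (h1.comp l h2)
  · intro l hl _
    simp only [g', dbL_add, dbL_smul]
    have e1 : dbL ((fderiv ℝ (f i) (sc j (l + 1) z)).comp ((eC N j).comp (z j • ContinuousLinearMap.id ℝ ℂ))) =
        (starRingEnd ℂ) (z j) * dbj j (fderiv ℝ (f i) (sc j (l + 1) z)) :=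
      dbL_mulr _ (z j) _ fun v => by simp
    rw [e1, hf.2 _ hl j i]
    by_cases h : i = j
    · subst h
      have : dbL (Complex.conjCLE : ℂ →L[ℝ] ℂ) = 1 := by simp [dbL]
      simp only [cc, if_true, this]; ring
    · have : dbL 0 = 0 := by simp [dbL]
      simp only [cc, h, if_false, this]; ring

open MeasureTheory in
theorem v_lemma {N : ℕ} (j : Fin N) {s R R' : ℝ} (hs : 1 ≤ s) (hR' : 0 ≤ R') (hsR : s * R' < R)
    {f : Fin N → (Fin N → ℂ) → ℂ} (hf : ClosedF R f) {b : ℝ} (hb0 : 0 ≤ b) (hb : ∀ i, ∀ z ∈ Bl N R, ‖f i z‖ ≤ b)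
    {χ : ℂ → ℂ} (hχ : ContDiff ℝ 1 χ) (hc : HasCompactSupport χ) (hts : tsupport χ ⊆ Metric.closedBall 0 s)
    (hχ1 : χ 1 = 1) :
    ∃ v : (Fin N → ℂ) → ℂ, ∃ v' : (Fin N → ℂ) → (Fin N → ℂ) →L[ℝ] ℂ,
      (∀ z ∈ Bl N R', HasFDerivAt v (v' z) z) ∧
      (∀ z ∈ Bl N R', ∀ i, dbj i (v' z) = f i z - (-(1 / (Real.pi : ℂ)) *
        ∫ l, (dbL (fderiv ℝ χ l) / (l - 1) * cj j i l) * f i (sc j l z))) ∧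
      (∀ z ∈ Bl N R', ‖v z‖ ≤ (1 / Real.pi * R' * ∫ l, ‖χ l / (l - 1)‖) * b) ∧
      (∀ i, ContinuousOn (fun z => ∫ l, (dbL (fderiv ℝ χ l) / (l - 1) * cj j i l) * f i (sc j l z)) (Bl N R')) := by
  have hK := integrable_kernel χ hχ.continuous hc 1
  have hKS : ∀ l, l ∉ Metric.closedBall (0:ℂ) s → χ l / (l - 1) = 0 := fun l hl => by
    rw [image_eq_zero_of_notMem_tsupport (fun h => hl (hts h)), zero_div]
  obtain ⟨T', t1, -, t3, t4, t5, t6⟩ := param_sc j hs hsR (hf.1 j) (hb j) (fun l => χ l / (l - 1)) hK hKS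
  have hd0 : ∀ l, l ∉ Metric.closedBall (0:ℂ) s → dbL (fderiv ℝ χ l) = 0 := fun l hl =>
    image_eq_zero_of_notMem_tsupport (f := fun l => dbL (fderiv ℝ χ l)) (fun h => hl (hts (tsupport_dbL_subset χ h)))
  have hK2 : ∀ i, Integrable (fun l => dbL (fderiv ℝ χ l) / (l - 1) * cj j i l) := by
    intro i
    have := integrable_kernel (fun l => dbL (fderiv ℝ χ l) * cj j i l) ((dbL_cont hχ).mul (cj_cont j i))
      (dbL_compact hc).mul_right 1
    refine this.congr (ae_of_all _ fun l => ?_)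
    simp only; ring
  have P2 := fun i => param_sc j hs hsR (hf.1 i) (hb i) (fun l => dbL (fderiv ℝ χ l) / (l - 1) * cj j i l) (hK2 i)
    (fun l hl => by simp only [hd0 l hl]; simp)
  have hpi : (Real.pi : ℂ) ≠ 0 := by exact_mod_cast Real.pi_ne_zero
  refine ⟨fun z => -(1 / (Real.pi : ℂ)) * (cjp N j z * ∫ l, χ l / (l - 1) * f j (sc j l z)),
    fun z => (-(1 / (Real.pi : ℂ))) • (cjp N j z • T' z + (∫ l, χ l / (l - 1) * f j (sc j l z)) • cjp N j), ?_, ?_, ?_, ?_⟩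
  · intro z hz
    exact (((cjp N j).hasFDerivAt (x := z)).mul (t1 z hz)).const_mul _
  · intro z hz i
    rw [dbj_smul, dbj_add, dbj_smul, dbj_smul, dbj_cjp, t3 z hz i, cjp_apply]
    obtain ⟨_, -, -, -, i4, -, -⟩ := P2 i
    have i4 := i4 z hz
    have key := cp_scaled j i hs hsR hf hχ hc hts hχ1 hz
    have e1 : ∫ l, (χ l * ((if i = j then f j (sc j l z) else 0) +
        (starRingEnd ℂ) (z j) * (cj j i l * dbj i (fderiv ℝ (f j) (sc j l z)))) +
      dbL (fderiv ℝ χ l) * (cj j i l * f i (sc j l z))) / (l - 1) =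
      ((∫ l, χ l / (l - 1) * f j (sc j l z)) * (if i = j then 1 else 0) +
      (starRingEnd ℂ) (z j) * ∫ l, χ l / (l - 1) * (cj j i l * dbj i (fderiv ℝ (f j) (sc j l z)))) +
      ∫ l, (dbL (fderiv ℝ χ l) / (l - 1) * cj j i l) * f i (sc j l z) := by
      rw [← integral_mul_const, ← integral_const_mul, ← integral_add, ← integral_add]
      · congr 1; ext l
        by_cases h : i = j
        · simp only [h, if_true]; ring
        · simp only [h, if_false]; ring
      · exact ((t4 z hz).mul_const _).add ((t5 z hz i).const_mul _)
      · exact i4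
      · exact (t4 z hz).mul_const _
      · exact (t5 z hz i).const_mul _
    rw [e1] at key
    have hpi2 : 1 / (Real.pi : ℂ) * Real.pi = 1 := by field_simp
    linear_combination (-(1 / (Real.pi : ℂ))) * key + f i z * hpi2
  · intro z hz
    have hzj : ‖z j‖ ≤ R' := (Finset.single_le_sum (f := fun i => ‖z i‖) (fun i _ => norm_nonneg _) (Finset.mem_univ j)).trans (le_of_lt hz)
    rw [norm_mul, norm_mul, cjp_apply, RCLike.norm_conj]
    have h1 : ‖-(1 / (Real.pi : ℂ))‖ = 1 / Real.pi := by
      rw [norm_neg, norm_div, Complex.norm_real, norm_one, Real.norm_of_nonneg Real.pi_pos.le]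
    rw [h1]
    have h2 := t6 z hz
    calc _ ≤ 1 / Real.pi * (R' * ((∫ l, ‖χ l / (l - 1)‖) * b)) := by
          have := Real.pi_pos
          gcongr
      _ = _ := by ring
  · intro i
    obtain ⟨_, -, c, -⟩ := P2 i
    exact c.continuousOn

/-- kernels of the modes -/
def Km (χ : ℂ → ℂ) (m : ℕ) (l : ℂ) : ℂ := dbL (fderiv ℝ χ l) * (l⁻¹) ^ (m + 1)

/-- modes of a form -/
def fm {N : ℕ} (χ : ℂ → ℂ) (j : Fin N) (f : Fin N → (Fin N → ℂ) → ℂ) (m : ℕ) (i : Fin N) (z : Fin N → ℂ) : ℂ :=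
  -(1 / (Real.pi : ℂ)) * ∫ l, (Km χ m l * cj j i l) * f i (sc j l z)

/-- properties of the cutoff -/
structure Cut (χ : ℂ → ℂ) (s t : ℝ) : Prop where
  hs : 1 < s
  hst : s < t
  cd : ContDiff ℝ 1 χ
  hc : HasCompactSupport χ
  ts : tsupport χ ⊆ Metric.closedBall 0 t
  one : ∀ l, ‖l‖ ≤ s → χ l = 1
  rot : ∀ a l, ‖a‖ = 1 → χ (a * l) = χ l

theorem Cut.zero {χ : ℂ → ℂ} {s t : ℝ} (h : Cut χ s t) : ∀ l, l ∉ Metric.closedBall (0:ℂ) t → dbL (fderiv ℝ χ l) = 0 :=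
  fun _ hl => image_eq_zero_of_notMem_tsupport (f := fun l => dbL (fderiv ℝ χ l))
    (fun h' => hl (h.ts (tsupport_dbL_subset χ h')))

theorem norm_cj {N : ℕ} (j i : Fin N) {l : ℂ} {t : ℝ} (ht : 1 ≤ t) (hl : ‖l‖ ≤ t) : ‖cj j i l‖ ≤ t := by
  unfold cj
  split_ifs
  · rwa [RCLike.norm_conj]
  · simpa using ht

theorem Km_bound {N : ℕ} {χ : ℂ → ℂ} {s t : ℝ} (h : Cut χ s t) (j i : Fin N) (m : ℕ) (l : ℂ) :
    ‖Km χ m l * cj j i l‖ ≤ (s⁻¹) ^ (m + 1) * t * ‖dbL (fderiv ℝ χ l)‖ := by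
  have hs0 : 0 < s := by linarith [h.hs]
  have ht0 : 1 ≤ t := by linarith [h.hs, h.hst]
  by_cases hl : l ∈ Metric.closedBall (0:ℂ) t
  · have hl' : ‖l‖ ≤ t := by simpa using hl
    by_cases hl2 : ‖l‖ < s
    · simp [Km, cutoff_zero h.one hl2]
    · have h1 : ‖l⁻¹‖ ≤ s⁻¹ := by
        rw [norm_inv]; exact inv_anti₀ hs0 (not_lt.1 hl2)
      have h2 := norm_cj j i ht0 hl'
      unfold Km
      rw [norm_mul, norm_mul, norm_pow]
      calc _ ≤ ‖dbL (fderiv ℝ χ l)‖ * (s⁻¹) ^ (m + 1) * t := by gcongr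
        _ = _ := by ring
  · simp [Km, h.zero l hl]

open MeasureTheory in
theorem Km_int {N : ℕ} {χ : ℂ → ℂ} {s t : ℝ} (h : Cut χ s t) (j i : Fin N) (m : ℕ) :
    Integrable (fun l => Km χ m l * cj j i l) := by
  have h1 : Integrable (fun l => dbL (fderiv ℝ χ l)) :=
    (dbL_cont h.cd).integrable_of_hasCompactSupport (dbL_compact h.hc)
  refine (h1.norm.const_mul ((s⁻¹) ^ (m + 1) * t)).mono' ?_ (ae_of_all _ fun l => Km_bound h j i m l)
  unfold Km
  exact (((dbL_cont h.cd).measurable.mul (measurable_inv.pow_const _)).mul (cj_cont j i).measurable).aestronglyMeasurable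

open MeasureTheory in
theorem Km_norm {N : ℕ} {χ : ℂ → ℂ} {s t : ℝ} (h : Cut χ s t) (j i : Fin N) (m : ℕ) :
    ∫ l, ‖Km χ m l * cj j i l‖ ≤ (s⁻¹) ^ (m + 1) * t * ∫ l, ‖dbL (fderiv ℝ χ l)‖ := by
  have h1 : Integrable (fun l => dbL (fderiv ℝ χ l)) :=
    (dbL_cont h.cd).integrable_of_hasCompactSupport (dbL_compact h.hc)
  rw [← integral_const_mul]
  exact integral_mono (Km_int h j i m).norm (h1.norm.const_mul _) fun l => Km_bound h j i m l

theorem Km_zero {N : ℕ} {χ : ℂ → ℂ} {s t : ℝ} (h : Cut χ s t) (j i : Fin N) (m : ℕ) :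
    ∀ l, l ∉ Metric.closedBall (0:ℂ) t → Km χ m l * cj j i l = 0 := fun l hl => by
  simp [Km, h.zero l hl]

theorem norm_pi_inv : ‖-(1 / (Real.pi : ℂ))‖ = 1 / Real.pi := by
  rw [norm_neg, norm_div, Complex.norm_real, norm_one, Real.norm_of_nonneg Real.pi_pos.le]

open MeasureTheory in
theorem fm_closed {N : ℕ} {χ : ℂ → ℂ} {s t R R' b : ℝ} (h : Cut χ s t) (hsR : t * R' < R) (j : Fin N)
    {f : Fin N → (Fin N → ℂ) → ℂ} (hf : ClosedF R f) (hb : ∀ i, ∀ z ∈ Bl N R, ‖f i z‖ ≤ b) (m : ℕ) :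
    ClosedF R' (fm χ j f m) := by
  have ht0 : 1 ≤ t := by linarith [h.hs, h.hst]
  have P := fun i => param_sc j ht0 hsR (hf.1 i) (hb i) _ (Km_int h j i m) (Km_zero h j i m)
  choose T' t1 t2 t3 _ _ _ using P
  refine ⟨fun i => contDiffOn_const.mul (t2 i), fun z hz i l => ?_⟩
  have e : ∀ i, fderiv ℝ (fm χ j f m i) z = (-(1 / (Real.pi : ℂ))) • T' i z := fun i =>
    ((t1 i z hz).const_mul _).fderiv
  rw [e, e, dbj_smul, dbj_smul, t3 _ z hz, t3 _ z hz]
  congr 2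
  ext μ
  by_cases hμ : μ ∈ Metric.closedBall (0:ℂ) t
  · rw [hf.2 _ (sc_mem j ht0 (by simpa using hμ) hsR (le_of_lt hz)) i l]; ring
  · rw [Km_zero h j l m μ hμ, Km_zero h j i m μ hμ]; ring

open MeasureTheory in
theorem fm_bound {N : ℕ} {χ : ℂ → ℂ} {s t R R' b : ℝ} (h : Cut χ s t) (hsR : t * R' < R) (j : Fin N)
    {f : Fin N → (Fin N → ℂ) → ℂ} (hf : ClosedF R f) (hb0 : 0 ≤ b) (hb : ∀ i, ∀ z ∈ Bl N R, ‖f i z‖ ≤ b) (m : ℕ)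
    (i : Fin N) {z : Fin N → ℂ} (hz : z ∈ Bl N R') :
    ‖fm χ j f m i z‖ ≤ (1 / Real.pi * t * ∫ l, ‖dbL (fderiv ℝ χ l)‖) * (s⁻¹) ^ (m + 1) * b := by
  have ht0 : 1 ≤ t := by linarith [h.hs, h.hst]
  obtain ⟨_, -, -, -, -, -, h6⟩ := param_sc j ht0 hsR (hf.1 i) (hb i) _ (Km_int h j i m) (Km_zero h j i m)
  unfold fm
  rw [norm_mul, norm_pi_inv]
  have := (h6 z hz).trans (mul_le_mul_of_nonneg_right (Km_norm h j i m) hb0)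
  calc _ ≤ 1 / Real.pi * ((s⁻¹) ^ (m + 1) * t * (∫ l, ‖dbL (fderiv ℝ χ l)‖) * b) :=
        mul_le_mul_of_nonneg_left this (by positivity)
    _ = _ := by ring

theorem fm_mode_old {N : ℕ} {χ : ℂ → ℂ} {s t R R' : ℝ} (h : Cut χ s t) (hsR : t * R' < R) (j : Fin N)
    {f : Fin N → (Fin N → ℂ) → ℂ} (m : ℕ) {p : ℕ} {i : Fin N} (hij : i ≠ j) (hm : Mode R p i f) :
    Mode R' p i (fm χ j f m) := by
  have ht0 : 1 ≤ t := by linarith [h.hs, h.hst]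
  intro a ha l z hz
  unfold fm
  rw [mul_left_comm]
  congr 1
  rw [← MeasureTheory.integral_const_mul]
  refine MeasureTheory.integral_congr_ae (Filter.Eventually.of_forall fun μ => ?_)
  beta_reduce
  by_cases hμ : μ ∈ Metric.closedBall (0:ℂ) t
  · have e : sc j μ (sc i a z) = sc i a (sc j μ z) := by
      ext q
      unfold sc
      by_cases h1 : q = i
      · subst h1; simp [hij]
      · simp [h1]
    rw [e, hm a ha l _ (sc_mem j ht0 (by simpa using hμ) hsR (le_of_lt hz))]; ring
  · rw [Km_zero h j l m μ hμ]; ring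

open MeasureTheory in
theorem integral_rot (F : ℂ → ℂ) {a : ℂ} (ha : ‖a‖ = 1) : ∫ l, F (a * l) = ∫ l, F l := by
  let c : Circle := ⟨a, by simpa [Submonoid.unitSphere] using ha⟩
  exact (rotation c).measurePreserving.integral_comp (rotation c).toHomeomorph.measurableEmbedding F

theorem fm_mode_new {N : ℕ} {χ : ℂ → ℂ} {s t R' : ℝ} (h : Cut χ s t) (j : Fin N)
    (f : Fin N → (Fin N → ℂ) → ℂ) (m : ℕ) :
    Mode R' m j (fm χ j f m) := by
  intro a ha i z hz
  have ha0 : a ≠ 0 := by rintro rfl; simp at ha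
  have hca : (starRingEnd ℂ) a * a = 1 := by
    rw [mul_comm, Complex.mul_conj, Complex.normSq_eq_norm_sq, ha]; simp
  unfold fm
  rw [mul_left_comm]
  congr 1
  rw [← MeasureTheory.integral_const_mul]
  conv_rhs => rw [← integral_rot _ ha]
  refine MeasureTheory.integral_congr_ae (Filter.Eventually.of_forall fun μ => ?_)
  beta_reduce
  have e : sc j μ (sc j a z) = sc j (a * μ) z := by
    ext q
    unfold sc
    by_cases h1 : q = j
    · simp [h1]; ring
    · simp [h1]
  have e1 := cutoff_rot h.cd h.rot ha μ
  have e2 : (a * μ)⁻¹ ^ (m + 1) * a ^ (m + 1) = μ⁻¹ ^ (m + 1) := by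
    rw [← mul_pow]; congr 1; rw [mul_inv]; field_simp
  have e3 : cj j i μ = (if i = j then a else 1) * cj j i (a * μ) := by
    unfold cj
    by_cases h1 : i = j
    · simp only [h1, if_true, map_mul]; rw [← mul_assoc, mul_comm a, hca, one_mul]
    · simp [h1]
  rw [e]
  unfold Km
  rw [e1, e3, ← e2]
  linear_combination (dbL (fderiv ℝ χ (a * μ)) * (a * μ)⁻¹ ^ (m + 1) * a ^ m * (if i = j then a else 1) * cj j i (a * μ) * f i (sc j (a * μ) z)) * hca

open MeasureTheory in
theorem fm_hasSum {N : ℕ} {χ : ℂ → ℂ} {s t R R' b : ℝ} (h : Cut χ s t) (hsR : t * R' < R) (j : Fin N)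
    {f : Fin N → (Fin N → ℂ) → ℂ} (hf : ClosedF R f) (hb0 : 0 ≤ b) (hb : ∀ i, ∀ z ∈ Bl N R, ‖f i z‖ ≤ b)
    (i : Fin N) {z : Fin N → ℂ} (hz : z ∈ Bl N R') :
    HasSum (fun m => fm χ j f m i z) (-(1 / (Real.pi : ℂ)) *
        ∫ l, (dbL (fderiv ℝ χ l) / (l - 1) * cj j i l) * f i (sc j l z)) := by
  have ht0 : 1 ≤ t := by linarith [h.hs, h.hst]
  have hs0 : 0 < s := by linarith [h.hs]
  unfold fm
  refine HasSum.mul_left _ ?_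
  have hI : ∀ m, Integrable fun l => (Km χ m l * cj j i l) * f i (sc j l z) := fun m => by
    obtain ⟨_, -, -, -, h4, -, -⟩ := param_sc j ht0 hsR (hf.1 i) (hb i) _ (Km_int h j i m) (Km_zero h j i m)
    exact h4 z hz
  have hB : ∀ m, ∫ l, ‖(Km χ m l * cj j i l) * f i (sc j l z)‖ ≤ (s⁻¹) ^ m * (s⁻¹ * t * (∫ l, ‖dbL (fderiv ℝ χ l)‖) * b) := by
    intro m
    have h1 : ∫ l, ‖(Km χ m l * cj j i l) * f i (sc j l z)‖ ≤ ∫ l, ‖Km χ m l * cj j i l‖ * b := by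
      refine integral_mono (hI m).norm ((Km_int h j i m).norm.mul_const _) fun l => ?_
      simp only
      rw [norm_mul]
      by_cases hμ : l ∈ Metric.closedBall (0:ℂ) t
      · exact mul_le_mul_of_nonneg_left (hb i _ (sc_mem j ht0 (by simpa using hμ) hsR (le_of_lt hz))) (norm_nonneg _)
      · rw [Km_zero h j i m l hμ]; simp
    rw [integral_mul_const] at h1
    refine h1.trans ((mul_le_mul_of_nonneg_right (Km_norm h j i m) hb0).trans (le_of_eq ?_))
    ring
  have hsm : Summable fun m => ∫ l, ‖(Km χ m l * cj j i l) * f i (sc j l z)‖ := by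
    refine Summable.of_nonneg_of_le (fun m => integral_nonneg fun _ => norm_nonneg _) hB (Summable.mul_right _ ?_)
    exact summable_geometric_of_lt_one (by positivity) (inv_lt_one_of_one_lt₀ h.hs)
  have key := hasSum_integral_of_summable_integral_norm hI hsm
  suffices e : (∫ l, (dbL (fderiv ℝ χ l) / (l - 1) * cj j i l) * f i (sc j l z)) =
      ∫ l, ∑' m, (Km χ m l * cj j i l) * f i (sc j l z) by
    rw [e]; exact key
  refine MeasureTheory.integral_congr_ae (Filter.Eventually.of_forall fun l => ?_)
  beta_reduce
  by_cases hl : ‖l‖ < s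
  · simp [Km, cutoff_zero h.one hl]
  · have hl1 : 1 < ‖l‖ := by linarith [h.hs]
    have hl0 : l ≠ 0 := by rintro rfl; simp at hl1; linarith
    have h1 : ‖l⁻¹‖ < 1 := by rw [norm_inv]; exact inv_lt_one_of_one_lt₀ hl1
    have hne : l - 1 ≠ 0 := by
      intro h0; rw [sub_eq_zero.1 h0] at hl1; simp at hl1
    have g := hasSum_geometric_of_norm_lt_one h1
    have g2 := g.mul_left (dbL (fderiv ℝ χ l) * l⁻¹ * cj j i l * f i (sc j l z))
    have e : (fun m : ℕ => dbL (fderiv ℝ χ l) * l⁻¹ * cj j i l * f i (sc j l z) * l⁻¹ ^ m) =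
        fun m => (Km χ m l * cj j i l) * f i (sc j l z) := by
      ext m; unfold Km; ring
    rw [e] at g2
    rw [g2.tsum_eq]
    have : l⁻¹ * (1 - l⁻¹)⁻¹ = 1 / (l - 1) := by
      rw [← mul_inv, mul_sub, mul_one, mul_inv_cancel₀ hl0, one_div]
    linear_combination -(dbL (fderiv ℝ χ l) * cj j i l * f i (sc j l z)) * this

open MeasureTheory in
theorem solve_step (N : ℕ) (J : Fin N) (ih : SolveJ N (J + 1)) : SolveJ N J := by
  intro r R hr hrR
  obtain ⟨R', hrR', hR'R⟩ := exists_between hrR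
  have hR'0 : 0 < R' := hr.trans hrR'
  have hρ : 1 < R / R' := (one_lt_div hR'0).2 hR'R
  obtain ⟨t, ht1, ht⟩ := exists_between hρ
  obtain ⟨s, hs1, hst⟩ := exists_between ht1
  have htR : t * R' < R := (lt_div_iff₀ hR'0).1 ht
  obtain ⟨χ, c1, c2, c3, c4, c5⟩ := exists_cutoff s t (by linarith) hst
  have h : Cut χ s t := ⟨hs1, hst, c1, c2, c3, c4, c5⟩
  obtain ⟨M, hM, ih⟩ := ih r R' hr hrR'
  set C : ℝ := 1 / Real.pi * t * ∫ l, ‖dbL (fderiv ℝ χ l)‖ with hC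
  have hC0 : 0 ≤ C := by
    have h1 : 0 ≤ ∫ l, ‖dbL (fderiv ℝ χ l)‖ := integral_nonneg fun _ => norm_nonneg _
    have := Real.pi_pos
    have : 0 < t := by linarith
    positivity
  set Cv : ℝ := 1 / Real.pi * R' * ∫ l, ‖χ l / (l - 1)‖ with hCv
  have hCv0 : 0 ≤ Cv := by
    have h1 : 0 ≤ ∫ l, ‖χ l / (l - 1)‖ := integral_nonneg fun _ => norm_nonneg _
    have := Real.pi_pos
    positivity
  have hq0 : 0 ≤ s⁻¹ := by positivity
  have hsum : Summable fun m : ℕ => (s⁻¹) ^ (m + 1) :=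
    (summable_nat_add_iff 1).2 (summable_geometric_of_lt_one hq0 (inv_lt_one_of_one_lt₀ hs1))
  have hsum0 : 0 ≤ ∑' m : ℕ, (s⁻¹) ^ (m + 1) := tsum_nonneg fun m => by positivity
  refine ⟨Cv + (M + 1) * C * ∑' m : ℕ, (s⁻¹) ^ (m + 1), by positivity, fun k f b hb0 hf hb hm => ?_⟩
  have hbm : ∀ m i, ∀ z ∈ Bl N R', ‖fm χ J f m i z‖ ≤ C * (s⁻¹) ^ (m + 1) * b := fun m i z hz =>
    fm_bound h htR J hf hb0 hb m i hz
  have hmodes : ∀ m, ∀ i : Fin N, (i : ℕ) < J + 1 → Mode R' (Function.update k J m i) i (fm χ J f m) := by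
    intro m i hi
    by_cases hij : i = J
    · subst hij
      rw [Function.update_self]
      exact fm_mode_new h i f m
    · rw [Function.update_of_ne hij]
      have : (i : ℕ) ≠ J := fun e => hij (Fin.ext e)
      exact fm_mode_old h htR J m hij (hm i (by omega))
  have hcl := fun m => fm_closed h htR J hf hb m
  have H := fun m => ih (Function.update k J m) (fm χ J f m) (C * (s⁻¹) ^ (m + 1) * b) (by positivity) (hcl m)
    (hbm m) (hmodes m)
  choose u hu hw hub using H
  obtain ⟨v, v', d1, d2, d3, d4⟩ := v_lemma J (by linarith : 1 ≤ t) hR'0.le htR hf hb0 hb c1 c2 c3 (c4 1 (by simpa using hs1.le))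
  have hsub := Bl_mono (N := N) hrR'.le
  let B : ℕ → ℝ := fun m => (M + 1) * C * b * (s⁻¹) ^ (m + 1)
  have hB : Summable B := hsum.mul_left _
  have hq : ∀ m : ℕ, 0 ≤ C * (s⁻¹) ^ (m + 1) * b := fun m => by positivity
  have hubB : ∀ m, ∀ z ∈ Bl N r, ‖u m z‖ ≤ B m := fun m z hz => by
    refine (hub m z hz).trans ?_
    have := hq m
    have e : B m = (M + 1) * (C * (s⁻¹) ^ (m + 1) * b) := by simp only [B]; ring
    rw [e]; nlinarith
  have hfbB : ∀ i m, ∀ z ∈ Bl N r, ‖fm χ J f m i z‖ ≤ B m := fun i m z hz => by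
    refine (hbm m i z (hsub hz)).trans ?_
    have := mul_nonneg hM (hq m)
    have e : B m = (M + 1) * (C * (s⁻¹) ^ (m + 1) * b) := by simp only [B]; ring
    rw [e]; linarith
  have hvc : ContinuousOn v (Bl N r) := fun z hz => (d1 z (hsub hz)).continuousAt.continuousWithinAt
  have huc : ContinuousOn (fun z => ∑' m, u m z) (Bl N r) := continuousOn_tsum hu hB hubB
  refine ⟨fun z => v z + ∑' m, u m z, hvc.add huc, fun i => ?_, fun z hz => ?_⟩
  · have hFc : ContinuousOn (fun z => -(1 / (Real.pi : ℂ)) *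
        ∫ l, (dbL (fderiv ℝ χ l) / (l - 1) * cj J i l) * f i (sc J l z)) (Bl N r) :=
      continuousOn_const.mul ((d4 i).mono hsub)
    have hfc : ContinuousOn (f i) (Bl N r) := (hf.1 i).continuousOn.mono (Bl_mono hrR.le)
    have w1 : WeakDb (Bl N r) i v (fun z => f i z - (-(1 / (Real.pi : ℂ)) *
        ∫ l, (dbL (fderiv ℝ χ l) / (l - 1) * cj J i l) * f i (sc J l z))) :=
      weak_of_classical (isOpen_Bl N r) i v' (fun z hz => d1 z (hsub hz)) (hfc.sub hFc)
        (fun z hz => d2 z (hsub hz) i)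
    have w2 := weak_tsum (isOpen_Bl N r) i (u := u) (f := fun m => fm χ J f m i) hu
      (fun m => ((hcl m).1 i).continuousOn.mono hsub) B hB hubB (hfbB i)
      (fun z hz => fm_hasSum h htR J hf hb0 hb i (hsub hz)) (fun m => hw m i)
    have w3 := weak_add (isOpen_Bl N r) i hvc huc (hfc.sub hFc) hFc w1 w2
    convert w3 using 1
    ext z; simp [Pi.sub_apply]
  · have h1 : ‖∑' m, u m z‖ ≤ ∑' m, B m := tsum_of_norm_bounded hB.hasSum fun m => hubB m z hz
    have h2 : ∑' m, B m = (M + 1) * C * b * ∑' m : ℕ, (s⁻¹) ^ (m + 1) := tsum_mul_left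
    refine (norm_add_le _ _).trans ?_
    have h3 := d3 z (hsub hz)
    rw [h2] at h1
    refine (add_le_add h3 h1).trans (le_of_eq ?_)
    ring

theorem solve_all (N j : ℕ) (hj : j ≤ N) : SolveJ N j := by
  induction hj using Nat.decreasingInduction with
  | self => exact solve_base N
  | of_succ k hk ih => exact solve_step N ⟨k, hk⟩ ih

theorem solve_main (N : ℕ) (r R : ℝ) (hr : 0 < r) (hrR : r < R) (f : Fin N → (Fin N → ℂ) → ℂ) (hf : ClosedF R f) :
    ∃ u : (Fin N → ℂ) → ℂ, ContDiffOn ℝ 1 u (Bl N r) ∧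
      ∀ z ∈ Bl N r, ∀ j, dbj j (fderiv ℝ u z) = f j z := by
  obtain ⟨R', hrR', hR'R⟩ := exists_between hrR
  have hb : ∃ b, 0 ≤ b ∧ ∀ i, ∀ z ∈ Bl N R', ‖f i z‖ ≤ b := by
    have : ∀ i, ∃ b, ∀ z ∈ Bl N R', ‖f i z‖ ≤ b := by
      intro i
      have hc : ContinuousOn (f i) {z : Fin N → ℂ | ∑ i, ‖z i‖ ≤ R'} :=
        (hf.1 i).continuousOn.mono fun z hz => lt_of_le_of_lt hz hR'R
      obtain ⟨b, hb⟩ := ((compact_cBl N R').image_of_continuousOn hc).isBounded.exists_norm_le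
      exact ⟨b, fun z hz => hb _ ⟨z, (le_of_lt hz : ∑ i, ‖z i‖ ≤ R'), rfl⟩⟩
    choose b hb using this
    refine ⟨∑ i, |b i|, Finset.sum_nonneg fun i _ => abs_nonneg _, fun i z hz => ?_⟩
    exact (hb i z hz).trans ((le_abs_self _).trans
      (Finset.single_le_sum (f := fun i => |b i|) (fun i _ => abs_nonneg _) (Finset.mem_univ i)))
  obtain ⟨b, hb0, hb⟩ := hb
  have hf' : ClosedF R' f := ⟨fun i => (hf.1 i).mono (Bl_mono hR'R.le), fun z hz => hf.2 z (Bl_mono hR'R.le hz)⟩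
  obtain ⟨M, -, h⟩ := solve_all N 0 (Nat.zero_le N) r R' hr hrR'
  obtain ⟨u, h1, h2, -⟩ := h (fun _ => 0) f b hb0 hf' hb (fun i hi => absurd hi (Nat.not_lt_zero _))
  exact ⟨u, weak_regular (isOpen_Bl N r) h1 (fun j => (hf.1 j).mono (Bl_mono hrR.le)) h2⟩

theorem dbar_add_right {V : Type*} [NormedAddCommGroup V] [NormedSpace ℂ V] (u : V → ℂ) (z ξ η : V) :
    dbar u z (ξ + η) = dbar u z ξ + dbar u z η := by
  simp only [dbar, smul_add, map_add]; ring

theorem dbar_smul_right {V : Type*} [NormedAddCommGroup V] [NormedSpace ℂ V] (u : V → ℂ) (z ξ : V) (a : ℂ) :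
    dbar u z (a • ξ) = (starRingEnd ℂ) a * dbar u z ξ := by
  have e1 : a • ξ = (a.re : ℝ) • ξ + (a.im : ℝ) • (Complex.I • ξ) := by
    conv_lhs => rw [← Complex.re_add_im a]
    rw [add_smul, mul_smul]; rfl
  have e2 : Complex.I • a • ξ = (a.re : ℝ) • (Complex.I • ξ) - (a.im : ℝ) • ξ := by
    rw [e1, smul_add, smul_comm Complex.I a.re, smul_comm Complex.I a.im, smul_smul Complex.I Complex.I,
      Complex.I_mul_I, neg_one_smul, smul_neg, sub_eq_add_neg]
  have e3 : (starRingEnd ℂ) a = a.re - a.im * Complex.I := by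
    apply Complex.ext <;> simp
  simp only [dbar]
  rw [e2, e1, e3, map_add, map_sub]
  simp only [map_smul, Complex.real_smul]
  linear_combination (a.im : ℂ) / 2 * (fderiv ℝ u z) (Complex.I • ξ) * (Complex.I_sq)

theorem dbar_comp {V W : Type*} [NormedAddCommGroup V] [NormedSpace ℂ V] [NormedAddCommGroup W] [NormedSpace ℂ W]
    (T : V →L[ℂ] W) {g : W → ℂ} {z : V} (hg : DifferentiableAt ℝ g (T z)) (ξ : V) :
    dbar (fun z => g (T z)) z ξ = dbar g (T z) (T ξ) := by
  have h : HasFDerivAt (fun z => g (T z)) ((fderiv ℝ g (T z)).comp (T.restrictScalars ℝ)) z :=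
    hg.hasFDerivAt.comp z (T.restrictScalars ℝ).hasFDerivAt
  simp [dbar, h.fderiv]

theorem dbar_sub_left {V : Type*} [NormedAddCommGroup V] [NormedSpace ℂ V] {u v : V → ℂ} {z : V}
    (hu : DifferentiableAt ℝ u z) (hv : DifferentiableAt ℝ v z) (ξ : V) :
    dbar (fun z => u z - v z) z ξ = dbar u z ξ - dbar v z ξ := by
  have h := (hu.hasFDerivAt.sub hv.hasFDerivAt).fderiv
  have h' : fderiv ℝ (fun z => u z - v z) z = fderiv ℝ u z - fderiv ℝ v z := h
  simp only [dbar, h', sub_apply]; ring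

def toE (N : ℕ) : (Fin N → ℂ) →L[ℂ] EN N := (PiLp.continuousLinearEquiv 1 ℂ (fun _ : Fin N => ℂ)).symm
def ofE (N : ℕ) : EN N →L[ℂ] (Fin N → ℂ) := (PiLp.continuousLinearEquiv 1 ℂ (fun _ : Fin N => ℂ))

theorem toE_ofE {N : ℕ} (z : EN N) : toE N (ofE N z) = z := rfl
theorem ofE_toE {N : ℕ} (z : Fin N → ℂ) : ofE N (toE N z) = z := rfl

theorem norm_toE {N : ℕ} (z : Fin N → ℂ) : ‖toE N z‖ = ∑ i, ‖z i‖ := PiLp.norm_eq_of_L1 _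
theorem norm_ofE {N : ℕ} (z : EN N) : ‖z‖ = ∑ i, ‖ofE N z i‖ := PiLp.norm_eq_of_L1 _

theorem sum_single {N : ℕ} (ξ : EN N) : ξ = ∑ j, (ofE N ξ j) • toE N (Pi.single j 1) := by
  have h : ofE N ξ = ∑ j, (ofE N ξ j) • (Pi.single j 1 : Fin N → ℂ) := by
    ext i; simp [Finset.sum_apply, Pi.single_apply]
  conv_lhs => rw [← toE_ofE ξ, h, map_sum]
  simp only [map_smul]

theorem conj_ext {N : ℕ} {F G : EN N → ℂ} (hF : ∀ ξ η, F (ξ + η) = F ξ + F η)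
    (hF' : ∀ (a : ℂ) ξ, F (a • ξ) = (starRingEnd ℂ) a * F ξ)
    (hG : ∀ ξ η, G (ξ + η) = G ξ + G η) (hG' : ∀ (a : ℂ) ξ, G (a • ξ) = (starRingEnd ℂ) a * G ξ)
    (h : ∀ j, F (toE N (Pi.single j 1)) = G (toE N (Pi.single j 1))) (ξ : EN N) : F ξ = G ξ := by
  let F1 : EN N →ₛₗ[starRingEnd ℂ] ℂ := ⟨⟨F, hF⟩, hF'⟩
  let G1 : EN N →ₛₗ[starRingEnd ℂ] ℂ := ⟨⟨G, hG⟩, hG'⟩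
  show F1 ξ = G1 ξ
  rw [sum_single ξ, map_sum, map_sum]
  refine Finset.sum_congr rfl fun j _ => ?_
  rw [LinearMap.map_smulₛₗ, LinearMap.map_smulₛₗ]
  congr 1
  exact h j

theorem dbj_dbar {N : ℕ} (u : (Fin N → ℂ) → ℂ) (z : Fin N → ℂ) (j : Fin N) :
    dbj j (fderiv ℝ u z) = dbar u z (Pi.single j 1) := by
  have : Complex.I • (Pi.single j 1 : Fin N → ℂ) = Pi.single j Complex.I := by
    rw [← Pi.single_smul]; simp
  simp only [dbar, this]
  rfl

theorem contDiff_C {V W : Type*} [NormedAddCommGroup V] [NormedSpace ℂ V] [NormedAddCommGroup W] [NormedSpace ℂ W]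
    (T : V →L[ℂ] W) : ContDiff ℝ 1 T := (T.restrictScalars ℝ).contDiff

theorem exists_sol (N : ℕ) (r R : ℝ) (hr : 0 < r) (hrR : r < R) (f : EN N → EN N → ℂ)
    (hform : IsForm01 1 {z : EN N | ‖z‖ < R} f)
    (hclosed : DbarClosed {z : EN N | ‖z‖ < R} f) :
    ∃ u : EN N → ℂ, ContDiffOn ℝ 1 u {z : EN N | ‖z‖ < r} ∧
      (∀ z : EN N, ‖z‖ < r → ∀ ξ : EN N, dbar u z ξ = f z ξ) := by
  obtain ⟨ha, hs, hc⟩ := hform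
  have hop : ∀ R, IsOpen {z : EN N | ‖z‖ < R} := fun R => isOpen_lt continuous_norm continuous_const
  have hcx : ∀ ξ, ContDiffOn ℝ 1 (fun z => f z ξ) {z : EN N | ‖z‖ < R} := by
    intro ξ
    have : ContDiff ℝ 1 (fun z : EN N => (z, ξ)) := contDiff_id.prodMk contDiff_const
    have hc' : ContDiffOn ℝ 1 (fun p : EN N × EN N => f p.1 p.2) ({z : EN N | ‖z‖ < R} ×ˢ univ) := by
      exact_mod_cast hc
    exact hc'.comp this.contDiffOn fun z hz => ⟨hz, mem_univ _⟩
  have hd : ∀ ξ z, ‖z‖ < R → DifferentiableAt ℝ (fun z => f z ξ) z := fun ξ z hz =>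
    ((hcx ξ).differentiableOn one_ne_zero).differentiableAt ((hop R).mem_nhds hz)
  have hcl : ClosedF R (fun (j : Fin N) z => f (toE N z) (toE N (Pi.single j 1))) := by
    refine ⟨fun i => (hcx _).comp (contDiff_C (toE N)).contDiffOn fun z hz => ?_, fun z hz i j => ?_⟩
    · show ‖_‖ < R
      rw [norm_toE]; exact hz
    · have hz' : ‖toE N z‖ < R := by rw [norm_toE]; exact hz
      rw [dbj_dbar, dbj_dbar, dbar_comp (toE N) (g := fun w => f w (toE N (Pi.single j 1))) (hd _ _ hz'),
        dbar_comp (toE N) (g := fun w => f w (toE N (Pi.single i 1))) (hd _ _ hz')]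
      exact hclosed _ hz' _ _
  obtain ⟨v, hv, hv'⟩ := solve_main N r R hr hrR _ hcl
  have hb : ∀ z : EN N, ‖z‖ < r → ofE N z ∈ Bl N r := fun z hz => by
    show ∑ i, _ < r
    rw [← norm_ofE]; exact hz
  refine ⟨fun z => v (ofE N z), hv.comp (contDiff_C (ofE N)).contDiffOn fun z hz => hb z hz, fun z hz ξ => ?_⟩
  refine conj_ext (dbar_add_right _ _) (fun a ξ => dbar_smul_right _ _ ξ a) (ha z (lt_trans hz hrR))
    (hs z (lt_trans hz hrR)) (fun j => ?_) ξ
  rw [dbar_comp (ofE N) ((hv.differentiableOn one_ne_zero).differentiableAt ((isOpen_Bl N r).mem_nhds (hb z hz))),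
    ofE_toE, ← dbj_dbar, hv' _ (hb z hz), toE_ofE]

def inclL (n N : ℕ) : EN n →L[ℂ] EN N := LinearMap.toContinuousLinearMap
  { toFun := incl n N
    map_add' := fun x y => by
      ext i; simp only [incl]; by_cases h : (i : ℕ) < n <;> simp [h]
    map_smul' := fun a x => by
      ext i; simp only [incl]; by_cases h : (i : ℕ) < n <;> simp [h] }

theorem inclL_apply {n N : ℕ} (z : EN n) : inclL n N z = incl n N z := rfl

def projL {n N : ℕ} (h : n ≤ N) : EN N →L[ℂ] EN n :=
  (toE n).comp (ContinuousLinearMap.pi fun i : Fin n =>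
    (ContinuousLinearMap.proj (Fin.castLE h i)).comp (ofE N))

theorem projL_coord {n N : ℕ} (h : n ≤ N) (z : EN N) (i : Fin n) : projL h z i = z (Fin.castLE h i) := rfl

theorem proj_incl {n N : ℕ} (h : n ≤ N) (z : EN n) : projL h (incl n N z) = z := by
  ext i
  rw [projL_coord]
  simp [incl]

theorem norm_proj {n N : ℕ} (h : n ≤ N) (z : EN N) : ‖projL h z‖ ≤ ‖z‖ := by
  rw [PiLp.norm_eq_of_L1, PiLp.norm_eq_of_L1]
  simp only [projL_coord]
  refine (Finset.sum_map Finset.univ (Fin.castLEEmb h) (fun i => ‖z i‖)).symm.trans_le ?_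
  exact Finset.sum_le_sum_of_subset_of_nonneg (Finset.subset_univ _) fun _ _ _ => norm_nonneg _

theorem norm_incl {n N : ℕ} (h : n ≤ N) (z : EN n) : ‖incl n N z‖ = ‖z‖ := by
  rw [PiLp.norm_eq_of_L1, PiLp.norm_eq_of_L1]
  symm
  rw [← Finset.sum_subset (Finset.subset_univ (Finset.univ.map (Fin.castLEEmb h)))]
  · rw [Finset.sum_map]
    simp [incl]
  · intro i _ hi
    have : ¬ (i : ℕ) < n := fun hi' => hi (Finset.mem_map.2 ⟨⟨i, hi'⟩, Finset.mem_univ _, rfl⟩)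
    simp [incl, this]

theorem Delta_nonneg (q : ℂ) (z : ℕ → ℂ) : 0 ≤ Delta q z := by
  refine tsum_nonneg fun k => ?_
  unfold DeltaTerm nn kk
  positivity

/-- Let `0 < r < R < ∞`, `0 < n ≤ N`, `ι : ℂ^n → ℂ^N` the inclusion, and `f`
a `∂̄`-closed `(0,1)`-form of class `C¹` on `B_N(R)`, Lipschitz continuous on `B_N(R)`.
If `A, Q ≥ 0` and `U` is continuous on the closed ball of radius `r` in `ℂ^n`, `C¹` on
`B_n(r)`, solves `∂̄U = ι^*f` on `B_n(r)` and satisfies `|U(z)| ≤ A·Q^{#z}` for `‖z‖ ≤ r`,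
then there is a `C¹` function `u` on `B_N(r)` with `∂̄u = f` there and
`|u(ι z) − U(z)| ≤ A·Δ(Q, z/r)` for `z ∈ B_n(r)`. -/
theorem statement10 (n N : ℕ) (hn : 0 < n) (hnN : n ≤ N) (r R : ℝ) (hr : 0 < r) (hrR : r < R)
    (f : EN N → EN N → ℂ)
    (hform : IsForm01 1 {z : EN N | ‖z‖ < R} f)
    (hclosed : DbarClosed {z : EN N | ‖z‖ < R} f)
    (hlip : LipschitzForm f {z : EN N | ‖z‖ < R})
    (A Q : ℝ) (hA : 0 ≤ A) (hQ : 0 ≤ Q) (U : EN n → ℂ)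
    (hUc : ContinuousOn U {z : EN n | ‖z‖ ≤ r})
    (hU1 : ContDiffOn ℝ 1 U {z : EN n | ‖z‖ < r})
    (hUsol : ∀ z : EN n, ‖z‖ < r → ∀ ξ : EN n,
      dbar U z ξ = f (incl n N z) (incl n N ξ))
    (hUb : ∀ z : EN n, ‖z‖ ≤ r → ‖U z‖ ≤ A * Q ^ {i : Fin n | z i ≠ 0}.ncard) :
    ∃ u : EN N → ℂ,
      ContDiffOn ℝ 1 u {z : EN N | ‖z‖ < r} ∧
      (∀ z : EN N, ‖z‖ < r → ∀ ξ : EN N, dbar u z ξ = f z ξ) ∧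
      ∀ z : EN n, ‖z‖ < r →
        ‖u (incl n N z) - U z‖ ≤
          A * Delta (Q : ℂ)
            (fun ν : ℕ => if h : ν < n then z ⟨ν, h⟩ / (r : ℂ) else 0) := by
  obtain ⟨v, hv, hv'⟩ := exists_sol N r R hr hrR f hform hclosed
  have hop : ∀ (m : ℕ) (R : ℝ), IsOpen {z : EN m | ‖z‖ < R} := fun m R =>
    isOpen_lt continuous_norm continuous_const
  have hvd : ∀ z : EN N, ‖z‖ < r → DifferentiableAt ℝ v z := fun z hz =>
    (hv.differentiableOn one_ne_zero).differentiableAt ((hop N r).mem_nhds hz)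
  have hUd : ∀ z : EN n, ‖z‖ < r → DifferentiableAt ℝ U z := fun z hz =>
    (hU1.differentiableOn one_ne_zero).differentiableAt ((hop n r).mem_nhds hz)
  have hin : ∀ z : EN n, ‖z‖ < r → ‖inclL n N z‖ < r := fun z hz => by
    rw [inclL_apply, norm_incl hnN]; exact hz
  have hpr : ∀ z : EN N, ‖z‖ < r → ‖projL hnN z‖ < r := fun z hz => (norm_proj hnN z).trans_lt hz
  have hh : ContDiffOn ℝ 1 (fun z : EN n => v (inclL n N z) - U z) {z : EN n | ‖z‖ < r} :=
    (hv.comp (contDiff_C (inclL n N)).contDiffOn hin).sub hU1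
  have hhd : ∀ z : EN n, ‖z‖ < r → DifferentiableAt ℝ (fun z : EN n => v (inclL n N z) - U z) z := fun z hz =>
    (hh.differentiableOn one_ne_zero).differentiableAt ((hop n r).mem_nhds hz)
  have hvi : ∀ z : EN n, ‖z‖ < r → DifferentiableAt ℝ (fun z : EN n => v (inclL n N z)) z := fun z hz =>
    ((hv.comp (contDiff_C (inclL n N)).contDiffOn hin).differentiableOn one_ne_zero).differentiableAt
      ((hop n r).mem_nhds hz)
  have hh0 : ∀ z : EN n, ‖z‖ < r → ∀ ξ, dbar (fun z : EN n => v (inclL n N z) - U z) z ξ = 0 := by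
    intro z hz ξ
    rw [dbar_sub_left (hvi z hz) (hUd z hz), dbar_comp (inclL n N) (hvd _ (hin z hz)), hv' _ (hin z hz),
      hUsol z hz]
    exact sub_self _
  have hp := hh.comp (contDiff_C (projL hnN)).contDiffOn hpr
  refine ⟨fun z => v z - (v (inclL n N (projL hnN z)) - U (projL hnN z)), hv.sub hp, fun z hz ξ => ?_,
    fun z hz => ?_⟩
  · rw [dbar_sub_left (v := fun z => v (inclL n N (projL hnN z)) - U (projL hnN z)) (hvd z hz)
      ((hp.differentiableOn one_ne_zero).differentiableAt ((hop N r).mem_nhds hz)),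
      dbar_comp (projL hnN) (g := fun z : EN n => v (inclL n N z) - U z) (hhd _ (hpr z hz)),
      hh0 _ (hpr z hz), hv' z hz, sub_zero]
  · simp only [proj_incl, inclL_apply, sub_sub_cancel, sub_self, norm_zero]
    exact mul_nonneg hA (Delta_nonneg _ _)
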